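/- Let k be a field of characteristic not 2 or 3 and let m = 4 or 8. The corestriction functor F_k : C ↦ cor_{Z(C)/k}(C), from the groupoid of m-dimensional composition algebras over quadratic étale extensions of k (morphisms: k-algebra isomorphisms) to the groupoid of (m,m)-product algebras over k (morphisms: involution-preserving k-algebra isomorphisms), is an equivalence of categories. In particular, if C and (A,−) correspond under this equivalence then: (i) Aut_k(C) ≅ Aut_k(A,−); (ii) the centre of C is isomorphic to the centroid of the Malcev algebra Skew(A,−)⁻ (the skew elements of A under the commutator product); (iii) (A,−) is decomposable as (A,−) ≅ C₁ ⊗ C₂ if and only if C ≅ C₁ × C₂. -/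

import Mathlib

open scoped TensorProduct

noncomputable section

universe u

/-- A unital, not necessarily associative, algebra with involution over a commutative ring. -/
structure AlgebraWithInvolution (R : Type u) [CommRing R] : Type (u + 1) where
  carrier : Type u
  [isNonAssocRing : NonAssocRing carrier]
  [isModule : Module R carrier]
  [isSMulCommClass : SMulCommClass R carrier carrier]
  [isScalarTower : IsScalarTower R carrier carrier]
  invol : carrier →ₗ[R] carrier
  invol_one : invol 1 = 1
  invol_mul : ∀ x y : carrier, invol (x * y) = invol y * invol x
  invol_invol : ∀ x : carrier, invol (invol x) = x

namespace AlgebraWithInvolution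

attribute [instance] isNonAssocRing isModule isSMulCommClass isScalarTower

instance {R : Type u} [CommRing R] : CoeSort (AlgebraWithInvolution R) (Type u) :=
  ⟨carrier⟩

variable {R : Type u} [CommRing R]

/-- The operator `V_{x,y} z = (x ȳ) z + (z ȳ) x − (z x̄) y` of a (candidate) structurable
algebra. -/
def Vop (A : AlgebraWithInvolution R) (x y z : A) : A :=
  (x * A.invol y) * z + (z * A.invol y) * x - (z * A.invol x) * y

/-- `(A,−)` is a structurable algebra:
`[V_{x,y}, V_{z,w}] = V_{V_{x,y} z, w} − V_{z, V_{y,x} w}`. -/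
def IsStructurable (A : AlgebraWithInvolution R) : Prop :=
  ∀ x y z w v : A,
    A.Vop x y (A.Vop z w v) - A.Vop z w (A.Vop x y v) =
      A.Vop (A.Vop x y z) w v - A.Vop z (A.Vop y x w) v

/-- An element `x` is conjugate-invertible if `V_{x,y} = id` for some `y`. -/
def ConjInvertible (A : AlgebraWithInvolution R) (x : A) : Prop :=
  ∃ y : A, ∀ z : A, A.Vop x y z = z

/-- A structurable division algebra: every nonzero element is conjugate-invertible. -/
def IsStructurableDivisionAlgebra (A : AlgebraWithInvolution R) : Prop :=
  ∀ x : A, x ≠ 0 → A.ConjInvertible x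

/-- The submodule of skew elements of an algebra with involution. -/
def skew (A : AlgebraWithInvolution R) : Submodule R A.carrier where
  carrier := {a | A.invol a = -a}
  add_mem' := by
    intro a b ha hb
    simp only [Set.mem_setOf_eq, map_add] at *
    rw [ha, hb, neg_add]
  zero_mem' := by simp
  smul_mem' := by
    intro c a ha
    simp only [Set.mem_setOf_eq, map_smul] at *
    rw [ha, smul_neg]

/-- `ψ(x,y) = x ȳ − y x̄`. -/
def psi (A : AlgebraWithInvolution R) (x y : A) : A :=
  x * A.invol y - y * A.invol x

/-- Isomorphisms of algebras with involution. -/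
structure Iso (A B : AlgebraWithInvolution R) where
  toLinearEquiv : A.carrier ≃ₗ[R] B.carrier
  map_mul : ∀ x y : A, toLinearEquiv (x * y) = toLinearEquiv x * toLinearEquiv y
  map_one : toLinearEquiv 1 = 1
  map_invol : ∀ x : A, toLinearEquiv (A.invol x) = B.invol (toLinearEquiv x)

/-- Isotopies of (structurable) algebras with involution: pairs `(α, α̂)` of linear
bijections with `α ∘ V_{x,y} ∘ α⁻¹ = V_{α x, α̂ y}`. -/
structure Isotopy (A B : AlgebraWithInvolution R) where
  toLinearEquiv : A.carrier ≃ₗ[R] B.carrier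
  hat : A.carrier ≃ₗ[R] B.carrier
  map_Vop : ∀ x y z : A,
    toLinearEquiv (A.Vop x y z) = B.Vop (toLinearEquiv x) (hat y) (toLinearEquiv z)

/-- Two algebras with involution are isotopic if there is an isotopy between them. -/
def IsIsotopic (A B : AlgebraWithInvolution R) : Prop :=
  Nonempty (A.Isotopy B)

/-- The tensor product of two algebras with involution. -/
def tensor (A B : AlgebraWithInvolution R) : AlgebraWithInvolution R where
  carrier := A.carrier ⊗[R] B.carrier
  invol := TensorProduct.map A.invol B.invol
  invol_one := by
    simp [Algebra.TensorProduct.one_def, A.invol_one, B.invol_one]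
  invol_mul := by
    intro x y
    induction x with
    | zero => simp
    | tmul a b =>
      induction y with
      | zero => simp
      | tmul c d =>
        simp [Algebra.TensorProduct.tmul_mul_tmul, A.invol_mul, B.invol_mul]
      | add u v hu hv =>
        simp only [mul_add, map_add, hu, hv, add_mul]
    | add u v hu hv =>
      simp only [add_mul, map_add, hu, hv, mul_add]
  invol_invol := by
    intro x
    induction x with
    | zero => simp
    | tmul a b => simp [A.invol_invol, B.invol_invol]
    | add u v hu hv => simp [hu, hv]

/-- Base change of an algebra with involution along `R → S`. -/
def baseChange (A : AlgebraWithInvolution R) (S : Type u) [CommRing S] [Algebra R S] :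
    AlgebraWithInvolution S where
  carrier := S ⊗[R] A.carrier
  invol := LinearMap.baseChange S A.invol
  invol_one := by
    simp [Algebra.TensorProduct.one_def, A.invol_one]
  invol_mul := by
    intro x y
    induction x with
    | zero => simp
    | tmul s a =>
      induction y with
      | zero => simp
      | tmul t b =>
        simp only [Algebra.TensorProduct.tmul_mul_tmul, LinearMap.baseChange_tmul,
          A.invol_mul, mul_comm s t]
      | add u v hu hv =>
        simp only [mul_add, map_add, hu, hv, add_mul]
    | add u v hu hv =>
      simp only [add_mul, map_add, hu, hv, mul_add]
  invol_invol := by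
    intro x
    induction x with
    | zero => simp
    | tmul s a => simp [A.invol_invol]
    | add u v hu hv => simp [hu, hv]

end AlgebraWithInvolution

/-- A composition algebra over a field `F`: a unital (possibly non-associative) algebra with a
nondegenerate multiplicative quadratic form, together with its standard involution
`x̄ = b(x,1)·1 − x` (where `b` is the polar form of the norm). -/
structure CompositionAlgebra (F : Type u) [Field F] : Type (u + 1) where
  carrier : Type u
  [isNonAssocRing : NonAssocRing carrier]
  [isModule : Module F carrier]
  [isSMulCommClass : SMulCommClass F carrier carrier]
  [isScalarTower : IsScalarTower F carrier carrier]
  [isFinite : FiniteDimensional F carrier]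
  norm : QuadraticForm F carrier
  norm_one : norm 1 = 1
  norm_mul : ∀ x y : carrier, norm (x * y) = norm x * norm y
  nondegenerate : ∀ x : carrier, (∀ y : carrier, norm (x + y) - norm x - norm y = 0) → x = 0
  conj : carrier →ₗ[F] carrier
  conj_def : ∀ x : carrier, conj x = (norm (x + 1) - norm x - norm 1) • (1 : carrier) - x
  conj_one : conj 1 = 1
  conj_mul : ∀ x y : carrier, conj (x * y) = conj y * conj x
  conj_conj : ∀ x : carrier, conj (conj x) = x

namespace CompositionAlgebra

attribute [instance] isNonAssocRing isModule isSMulCommClass isScalarTower isFinite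

variable {F : Type u} [Field F]

/-- A composition algebra, viewed as an algebra with its standard involution. -/
def toAWI (C : CompositionAlgebra F) : AlgebraWithInvolution F where
  carrier := C.carrier
  invol := C.conj
  invol_one := C.conj_one
  invol_mul := C.conj_mul
  invol_invol := C.conj_conj

end CompositionAlgebra

/-- A splitting datum witnessing that `(A,−)` is an `(m₁, m₂)`-product algebra: a field
extension `K/k` over which `(A,−)` becomes isomorphic, as an algebra with involution, to the
tensor product of two composition algebras (with their standard involutions) of dimensions
`m₁` and `m₂`. -/
structure ProductAlgebraSplitting {k : Type u} [Field k]
    (A : AlgebraWithInvolution k) (m₁ m₂ : ℕ) : Type (u + 1) where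
  K : Type u
  [fieldK : Field K]
  [algK : Algebra k K]
  C₁ : CompositionAlgebra K
  C₂ : CompositionAlgebra K
  finrank₁ : Module.finrank K C₁.carrier = m₁
  finrank₂ : Module.finrank K C₂.carrier = m₂
  iso : (A.baseChange K).Iso (C₁.toAWI.tensor C₂.toAWI)

attribute [instance] ProductAlgebraSplitting.fieldK ProductAlgebraSplitting.algK

/-- `(A,−)` is an `(m₁, m₂)`-product algebra. -/
def IsProductAlgebra {k : Type u} [Field k] (A : AlgebraWithInvolution k) (m₁ m₂ : ℕ) : Prop :=
  Nonempty (ProductAlgebraSplitting A m₁ m₂)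

/-- An Albert form of an `(m₁,m₂)`-product algebra `(A,−)`: a quadratic form `Q` on the space
of skew elements, together with the `♮`-map, satisfying `L_s ∘ L_{s♮} = −Q(s)·id` and such that
`Q(s) ≠ 0` iff left multiplication by `s` is invertible. -/
structure AlbertForm {k : Type u} [Field k] (A : AlgebraWithInvolution k) where
  Q : QuadraticForm k A.skew
  natMap : A.skew →ₗ[k] A.skew
  mul_natMap : ∀ (s : A.skew) (a : A.carrier),
    (s : A.carrier) * ((natMap s : A.carrier) * a) = -(Q s) • a
  nonzero_iff : ∀ s : A.skew,
    Q s ≠ 0 ↔ Function.Bijective fun a : A.carrier => (s : A.carrier) * a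

end

/-- A quadratic étale extension `E/k` (char `k ≠ 2`), together with its nontrivial
`k`-automorphism `ι`. -/
structure QuadraticEtale (k : Type u) [Field k] : Type (u + 1) where
  E : Type u
  [commRing : CommRing E]
  [alg : Algebra k E]
  finrank_eq : Module.finrank k E = 2
  reduced : ∀ x : E, x * x = 0 → x = 0
  iota : E ≃ₐ[k] E
  iota_iota : ∀ x : E, iota (iota x) = x
  iota_ne : ∃ x : E, iota x ≠ x
  fixed : ∀ x : E, iota x = x → ∃ c : k, x = algebraMap k E c

attribute [instance] QuadraticEtale.commRing QuadraticEtale.alg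

/-- A composition algebra over a commutative ring `F`: a unital (possibly non-associative)
algebra, finite free as a module, with a nondegenerate multiplicative quadratic form and its
standard involution. -/
structure CompositionAlgebraO (F : Type u) [CommRing F] : Type (u + 1) where
  carrier : Type u
  [isNonAssocRing : NonAssocRing carrier]
  [isModule : Module F carrier]
  [isSMulCommClass : SMulCommClass F carrier carrier]
  [isScalarTower : IsScalarTower F carrier carrier]
  [isFinite : Module.Finite F carrier]
  [isFree : Module.Free F carrier]
  norm : QuadraticForm F carrier
  norm_one : norm 1 = 1
  norm_mul : ∀ x y : carrier, norm (x * y) = norm x * norm y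
  nondegenerate : ∀ x : carrier, (∀ y : carrier, norm (x + y) - norm x - norm y = 0) → x = 0
  conj : carrier →ₗ[F] carrier
  conj_def : ∀ x : carrier, conj x = (norm (x + 1) - norm x - norm 1) • (1 : carrier) - x
  conj_one : conj 1 = 1
  conj_mul : ∀ x y : carrier, conj (x * y) = conj y * conj x
  conj_conj : ∀ x : carrier, conj (conj x) = x

attribute [instance] CompositionAlgebraO.isNonAssocRing CompositionAlgebraO.isModule
  CompositionAlgebraO.isSMulCommClass CompositionAlgebraO.isScalarTower
  CompositionAlgebraO.isFinite CompositionAlgebraO.isFree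

variable {k : Type u} [Field k]

/-- The conjugate algebra `^ιC` of a composition algebra `C` over a quadratic étale extension
`E/k`: the same ring, with the `E`-action twisted by `ι`. -/
structure ConjAlg (Et : QuadraticEtale k) (C : CompositionAlgebraO Et.E) : Type u where
  ofConj ::
  unConj : C.carrier

namespace ConjAlg

variable {Et : QuadraticEtale k} {C : CompositionAlgebraO Et.E}

theorem ext {x y : ConjAlg Et C} (h : x.unConj = y.unConj) : x = y := by
  cases x; cases y; simpa using h

theorem unConj_injective : Function.Injective (unConj : ConjAlg Et C → C.carrier) := by
  intro x y h; exact ext h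

instance : Zero (ConjAlg Et C) := ⟨⟨0⟩⟩

@[simp] theorem unConj_zero : (0 : ConjAlg Et C).unConj = 0 := rfl
instance : One (ConjAlg Et C) := ⟨⟨1⟩⟩

@[simp] theorem unConj_one : (1 : ConjAlg Et C).unConj = 1 := rfl

instance : Add (ConjAlg Et C) := ⟨fun x y => ⟨x.unConj + y.unConj⟩⟩

@[simp] theorem unConj_add (x y : ConjAlg Et C) : (x + y).unConj = x.unConj + y.unConj := rfl
instance : Neg (ConjAlg Et C) := ⟨fun x => ⟨-x.unConj⟩⟩
instance : Sub (ConjAlg Et C) := ⟨fun x y => ⟨x.unConj - y.unConj⟩⟩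
instance : Mul (ConjAlg Et C) := ⟨fun x y => ⟨x.unConj * y.unConj⟩⟩

@[simp] theorem unConj_mul (x y : ConjAlg Et C) : (x * y).unConj = x.unConj * y.unConj := rfl
instance : SMul ℕ (ConjAlg Et C) := ⟨fun n x => ⟨n • x.unConj⟩⟩
instance : SMul ℤ (ConjAlg Et C) := ⟨fun n x => ⟨n • x.unConj⟩⟩
instance : NatCast (ConjAlg Et C) := ⟨fun n => ⟨n⟩⟩
instance : IntCast (ConjAlg Et C) := ⟨fun n => ⟨n⟩⟩

instance : NonAssocRing (ConjAlg Et C) :=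
  unConj_injective.nonAssocRing unConj rfl rfl (fun _ _ => rfl) (fun _ _ => rfl) (fun _ => rfl)
    (fun _ _ => rfl) (fun _ _ => rfl) (fun _ _ => rfl) (fun _ => rfl) (fun _ => rfl)

/-- The `ι`-twisted `E`-action. -/
instance : SMul Et.E (ConjAlg Et C) := ⟨fun e x => ⟨Et.iota e • x.unConj⟩⟩

theorem smul_def (e : Et.E) (x : ConjAlg Et C) : e • x = ⟨Et.iota e • x.unConj⟩ := rfl

@[simp] theorem unConj_smul (e : Et.E) (x : ConjAlg Et C) :
    (e • x).unConj = Et.iota e • x.unConj := rfl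

instance : MulAction Et.E (ConjAlg Et C) where
  one_smul x := by apply ext; simp
  mul_smul e f x := by apply ext; simp [map_mul, mul_smul]

instance : DistribMulAction Et.E (ConjAlg Et C) where
  smul_zero e := by apply ext; simp
  smul_add e x y := by apply ext; simp [smul_add]

instance : Module Et.E (ConjAlg Et C) where
  add_smul e f x := by apply ext; simp [map_add, add_smul]
  zero_smul x := by apply ext; simp

instance : SMulCommClass Et.E (ConjAlg Et C) (ConjAlg Et C) where
  smul_comm e x y := by
    apply ext
    show Et.iota e • (x.unConj * y.unConj) = x.unConj * (Et.iota e • y.unConj)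
    exact (mul_smul_comm _ _ _).symm

instance : IsScalarTower Et.E (ConjAlg Et C) (ConjAlg Et C) where
  smul_assoc e x y := by
    apply ext
    show (Et.iota e • x.unConj) * y.unConj = Et.iota e • (x.unConj * y.unConj)
    exact smul_mul_assoc _ _ _

/-- The (untwisted) `k`-module structure on `^ιC`. -/
instance : SMul k (ConjAlg Et C) := ⟨fun c x => ⟨algebraMap k Et.E c • x.unConj⟩⟩

@[simp] theorem unConj_ksmul (c : k) (x : ConjAlg Et C) :
    (c • x).unConj = algebraMap k Et.E c • x.unConj := rfl

instance : MulAction k (ConjAlg Et C) where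
  one_smul x := by apply ext; simp
  mul_smul c c' x := by apply ext; simp [map_mul, mul_smul]

instance : DistribMulAction k (ConjAlg Et C) where
  smul_zero c := by apply ext; simp
  smul_add c x y := by apply ext; simp [smul_add]

instance : Module k (ConjAlg Et C) where
  add_smul c c' x := by apply ext; simp [map_add, add_smul]
  zero_smul x := by apply ext; simp

instance : SMulCommClass Et.E k (ConjAlg Et C) where
  smul_comm e c x := by
    apply ext
    show Et.iota e • (algebraMap k Et.E c • x.unConj) = algebraMap k Et.E c • (Et.iota e • x.unConj)
    rw [smul_smul, smul_smul, mul_comm]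

instance : SMulCommClass k (ConjAlg Et C) (ConjAlg Et C) where
  smul_comm c x y := by
    apply ext
    show algebraMap k Et.E c • (x.unConj * y.unConj) = x.unConj * (algebraMap k Et.E c • y.unConj)
    exact (mul_smul_comm _ _ _).symm

instance : IsScalarTower k (ConjAlg Et C) (ConjAlg Et C) where
  smul_assoc c x y := by
    apply ext
    show (algebraMap k Et.E c • x.unConj) * y.unConj = algebraMap k Et.E c • (x.unConj * y.unConj)
    exact smul_mul_assoc _ _ _

end ConjAlg

namespace Corestriction

variable (Et : QuadraticEtale k) (C : CompositionAlgebraO Et.E)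

/-- The ambient algebra `^ιC ⊗_E C`. -/
abbrev Amb := ConjAlg Et C ⊗[Et.E] C.carrier

theorem ksmul_def (c : k) (t : Amb Et C) : c • t = algebraMap k Et.E c • t := by
  induction t using TensorProduct.induction_on with
  | zero => simp
  | tmul x y =>
    rw [TensorProduct.smul_tmul', TensorProduct.smul_tmul']
    apply congr_arg₂ (· ⊗ₜ[Et.E] ·) _ rfl
    apply ConjAlg.ext
    simp
  | add a b ha hb => rw [smul_add, smul_add, ha, hb]

/-- The switch map `^ιx ⊗ y ↦ ^ιy ⊗ x` (an `ι`-semilinear automorphism of `^ιC ⊗_E C`). -/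
noncomputable def switchAux : Amb Et C →+ Amb Et C :=
  TensorProduct.liftAddHom
    (AddMonoidHom.mk'
      (fun x => AddMonoidHom.mk'
        (fun y => (ConjAlg.ofConj y : ConjAlg Et C) ⊗ₜ[Et.E] x.unConj)
        (fun y y' => by
          show (ConjAlg.ofConj (y + y') : ConjAlg Et C) ⊗ₜ[Et.E] x.unConj = _
          rw [show (ConjAlg.ofConj (y + y') : ConjAlg Et C)
                = ConjAlg.ofConj y + ConjAlg.ofConj y' from rfl, TensorProduct.add_tmul]))
      (fun x x' => by
        apply AddMonoidHom.ext
        intro y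
        show (ConjAlg.ofConj y : ConjAlg Et C) ⊗ₜ[Et.E] (x + x').unConj = _
        rw [ConjAlg.unConj_add, TensorProduct.tmul_add]
        rfl))
    (fun e x y => by
      show (ConjAlg.ofConj y : ConjAlg Et C) ⊗ₜ[Et.E] (e • x).unConj
          = (ConjAlg.ofConj (e • y) : ConjAlg Et C) ⊗ₜ[Et.E] x.unConj
      rw [ConjAlg.unConj_smul,
        show (ConjAlg.ofConj (e • y) : ConjAlg Et C) = Et.iota e • ConjAlg.ofConj y from by
          apply ConjAlg.ext; simp [Et.iota_iota],
        TensorProduct.tmul_smul]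
      exact (TensorProduct.smul_tmul' _ _ _).symm)

@[simp] theorem switchAux_tmul (x : ConjAlg Et C) (y : C.carrier) :
    switchAux Et C (x ⊗ₜ[Et.E] y) = (ConjAlg.ofConj y : ConjAlg Et C) ⊗ₜ[Et.E] x.unConj :=
  TensorProduct.liftAddHom_tmul _ _ _ _

theorem switchAux_smul (e : Et.E) (t : Amb Et C) :
    switchAux Et C (e • t) = Et.iota e • switchAux Et C t := by
  induction t using TensorProduct.induction_on with
  | zero => simp
  | tmul x y =>
    rw [TensorProduct.smul_tmul', switchAux_tmul, switchAux_tmul, ConjAlg.unConj_smul,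
      TensorProduct.tmul_smul]
  | add a b ha hb => rw [smul_add, map_add, ha, hb, map_add, smul_add]

theorem switchAux_one : switchAux Et C 1 = 1 := by
  rw [Algebra.TensorProduct.one_def, switchAux_tmul]; rfl

theorem switchAux_mul (a b : Amb Et C) :
    switchAux Et C (a * b) = switchAux Et C a * switchAux Et C b := by
  induction a using TensorProduct.induction_on with
  | zero => rw [zero_mul, map_zero, zero_mul]
  | tmul x y =>
    induction b using TensorProduct.induction_on with
    | zero => rw [mul_zero, map_zero, mul_zero]
    | tmul x' y' =>
      rw [Algebra.TensorProduct.tmul_mul_tmul, switchAux_tmul, switchAux_tmul, switchAux_tmul,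
        Algebra.TensorProduct.tmul_mul_tmul]
      rfl
    | add u v hu hv => rw [mul_add, map_add, hu, hv, map_add, mul_add]
  | add u v hu hv => rw [add_mul, map_add, hu, hv, map_add, add_mul]

/-- The corestriction, as a `k`-submodule of `^ιC ⊗_E C`: the fixed points of the switch map. -/
noncomputable def corSubmodule : Submodule k (Amb Et C) where
  carrier := {t | switchAux Et C t = t}
  add_mem' := by
    intro a b ha hb
    simp only [Set.mem_setOf_eq] at *
    rw [map_add, ha, hb]
  zero_mem' := by simp
  smul_mem' := by
    intro c t ht
    simp only [Set.mem_setOf_eq] at *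
    rw [ksmul_def, switchAux_smul, ht, AlgEquiv.commutes]

theorem mem_corSubmodule {t : Amb Et C} :
    t ∈ corSubmodule Et C ↔ switchAux Et C t = t := Iff.rfl

attribute [irreducible] corSubmodule

theorem one_mem_cor : (1 : Amb Et C) ∈ corSubmodule Et C :=
  (mem_corSubmodule Et C).2 (switchAux_one Et C)

theorem mul_mem_cor {a b : Amb Et C} (ha : a ∈ corSubmodule Et C)
    (hb : b ∈ corSubmodule Et C) : a * b ∈ corSubmodule Et C := by
  rw [mem_corSubmodule] at *
  rw [switchAux_mul, ha, hb]

noncomputable instance : One ↥(corSubmodule Et C) := ⟨⟨1, one_mem_cor Et C⟩⟩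
noncomputable instance : Mul ↥(corSubmodule Et C) :=
  ⟨fun a b => ⟨a.1 * b.1, mul_mem_cor Et C a.2 b.2⟩⟩
noncomputable instance : NatCast ↥(corSubmodule Et C) :=
  ⟨fun n => ⟨n, by rw [← nsmul_one]; exact nsmul_mem (one_mem_cor Et C) n⟩⟩
noncomputable instance : IntCast ↥(corSubmodule Et C) :=
  ⟨fun n => ⟨n, by rw [← zsmul_one]; exact zsmul_mem (one_mem_cor Et C) n⟩⟩

noncomputable instance : NonAssocRing ↥(corSubmodule Et C) :=
  Subtype.val_injective.nonAssocRing _ rfl rfl (fun _ _ => rfl) (fun _ _ => rfl) (fun _ => rfl)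
    (fun _ _ => rfl) (fun _ _ => rfl) (fun _ _ => rfl) (fun _ => rfl) (fun _ => rfl)

instance : SMulCommClass Et.E Et.E (ConjAlg Et C) :=
  ⟨fun a b x => by rw [smul_smul, smul_smul, mul_comm]⟩

instance : SMulCommClass k ↥(corSubmodule Et C) ↥(corSubmodule Et C) where
  smul_comm c x y := by
    apply Subtype.ext
    show c • (x.1 * y.1) = x.1 * (c • y.1)
    rw [ksmul_def, ksmul_def, mul_smul_comm]

instance : IsScalarTower k ↥(corSubmodule Et C) ↥(corSubmodule Et C) where
  smul_assoc c x y := by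
    apply Subtype.ext
    show (c • x.1) * y.1 = c • (x.1 * y.1)
    rw [ksmul_def, ksmul_def, smul_mul_assoc]

/-- The conjugation of `^ιC`. -/
noncomputable def conjC : ConjAlg Et C →ₗ[Et.E] ConjAlg Et C where
  toFun x := ⟨C.conj x.unConj⟩
  map_add' x y := by apply ConjAlg.ext; simp
  map_smul' e x := by apply ConjAlg.ext; simp

/-- The involution `^ιτ ⊗ τ` on `^ιC ⊗_E C`. -/
noncomputable def involAux : Amb Et C →ₗ[Et.E] Amb Et C :=
  TensorProduct.map (conjC Et C) C.conj

@[simp] theorem involAux_tmul (x : ConjAlg Et C) (y : C.carrier) :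
    involAux Et C (x ⊗ₜ[Et.E] y) = conjC Et C x ⊗ₜ[Et.E] C.conj y :=
  TensorProduct.map_tmul _ _ _ _

theorem involAux_switch (t : Amb Et C) :
    involAux Et C (switchAux Et C t) = switchAux Et C (involAux Et C t) := by
  induction t using TensorProduct.induction_on with
  | zero => simp
  | tmul x y =>
    rw [switchAux_tmul, involAux_tmul, involAux_tmul, switchAux_tmul]
    rfl
  | add a b ha hb => rw [map_add, map_add, ha, hb, map_add, map_add]

theorem involAux_one : involAux Et C 1 = 1 := by
  rw [Algebra.TensorProduct.one_def, involAux_tmul]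
  rw [show conjC Et C 1 = 1 from ConjAlg.ext (C.conj_one), C.conj_one]

theorem involAux_mul (a b : Amb Et C) :
    involAux Et C (a * b) = involAux Et C b * involAux Et C a := by
  induction a using TensorProduct.induction_on with
  | zero => rw [zero_mul, map_zero, mul_zero]
  | tmul x y =>
    induction b using TensorProduct.induction_on with
    | zero => rw [mul_zero, map_zero, zero_mul]
    | tmul x' y' =>
      rw [Algebra.TensorProduct.tmul_mul_tmul, involAux_tmul, involAux_tmul, involAux_tmul,
        Algebra.TensorProduct.tmul_mul_tmul]
      apply congr_arg₂ (· ⊗ₜ[Et.E] ·)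
      · exact ConjAlg.ext (C.conj_mul _ _)
      · exact C.conj_mul _ _
    | add u v hu hv => rw [mul_add, map_add, hu, hv, map_add, add_mul]
  | add u v hu hv => rw [add_mul, map_add, hu, hv, map_add, mul_add]

theorem involAux_involAux (t : Amb Et C) : involAux Et C (involAux Et C t) = t := by
  induction t using TensorProduct.induction_on with
  | zero => simp
  | tmul x y =>
    rw [involAux_tmul, involAux_tmul]
    apply congr_arg₂ (· ⊗ₜ[Et.E] ·)
    · exact ConjAlg.ext (C.conj_conj _)
    · exact C.conj_conj _
  | add a b ha hb => rw [map_add, map_add, ha, hb]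

/-- **The corestriction** `cor_{E/k}(C)` of a composition algebra `C` over a quadratic étale
extension `E/k`: the fixed points of the switch map on `^ιC ⊗_E C`, with the restriction of the
involution `^ιτ ⊗ τ`. -/
noncomputable def corestriction : AlgebraWithInvolution k where
  carrier := ↥(corSubmodule Et C)
  invol :=
    { toFun := fun a => ⟨involAux Et C a.1, by
        rw [mem_corSubmodule, ← involAux_switch,
          show switchAux Et C a.1 = a.1 from (mem_corSubmodule Et C).1 a.2]⟩
      map_add' := fun a b => Subtype.ext (map_add _ _ _)
      map_smul' := fun c a => Subtype.ext (by
        show involAux Et C (c • a.1) = c • involAux Et C a.1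
        rw [ksmul_def, map_smul, ksmul_def]) }
  invol_one := Subtype.ext (involAux_one Et C)
  invol_mul := fun a b => Subtype.ext (involAux_mul Et C a.1 b.1)
  invol_invol := fun a => Subtype.ext (involAux_involAux Et C a.1)

end Corestriction

-- Malcev-algebra structure on the skew elements, its multiplication algebra and centroid.

variable {k : Type u} [Field k] in
/-- The bracket operator `ad_s : t ↦ st − ts` on the skew space of `(A,−)`. -/
noncomputable def adOp (A : AlgebraWithInvolution k) (s : A.skew) :
    Module.End k ↥A.skew where
  toFun t := ⟨(s : A.carrier) * t - (t : A.carrier) * s, by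
    have hs : A.invol s = -(s : A.carrier) := s.2
    have ht : A.invol t = -(t : A.carrier) := t.2
    show A.invol _ = -_
    rw [map_sub, A.invol_mul, A.invol_mul, hs, ht, neg_mul_neg, neg_mul_neg, neg_sub]⟩
  map_add' t t' := by
    apply Subtype.ext
    show (s : A.carrier) * (t + t') - (t + t') * s = _
    rw [mul_add, add_mul]
    show _ = ((s : A.carrier) * t - t * s) + ((s : A.carrier) * t' - t' * s)
    abel
  map_smul' c t := by
    apply Subtype.ext
    show (s : A.carrier) * (c • t) - (c • t : A.skew) * s = c • ((s : A.carrier) * t - t * s)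
    rw [smul_sub, mul_smul_comm, Submodule.coe_smul, smul_mul_assoc]

variable {k : Type u} [Field k] in
/-- The multiplication algebra of the Malcev algebra `Skew(A,−)⁻`: the subalgebra of
`End_k(Skew(A,−))` generated by the bracket operators. -/
noncomputable def malcevMultAlg (A : AlgebraWithInvolution k) :
    Subalgebra k (Module.End k ↥A.skew) :=
  Algebra.adjoin k (Set.range (adOp A))

variable {k : Type u} [Field k] in
/-- The centroid of the Malcev algebra `Skew(A,−)⁻`: the centre of its multiplication
algebra. -/
noncomputable def malcevCentroid (A : AlgebraWithInvolution k) :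
    Subalgebra k (Module.End k ↥A.skew) :=
  malcevMultAlg A ⊓ Subalgebra.centralizer k ↑(malcevMultAlg A)

namespace QuadraticEtale

variable (Et : QuadraticEtale k)

instance : Nontrivial Et.E := by
  obtain ⟨x, hx⟩ := Et.iota_ne
  exact ⟨⟨_, _, hx⟩⟩

instance : Module.Finite k Et.E :=
  Module.finite_of_finrank_pos (by rw [Et.finrank_eq]; norm_num)

instance : IsReduced Et.E := by
  rw [isReduced_iff_pow_one_lt 2 one_lt_two]
  intro x hx
  exact Et.reduced x (by rwa [pow_two] at hx)

theorem isUnit_two (hk2 : (2 : k) ≠ 0) : IsUnit (2 : Et.E) := by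
  have := (IsUnit.mk0 _ hk2).map (algebraMap k Et.E)
  rwa [map_ofNat] at this

/-- An étale quadratic extension is generated by an element `δ` with `ι δ = -δ`. -/
theorem exists_generator : ∃ (δ : Et.E) (d : k),
    Et.iota δ = -δ ∧ d ≠ 0 ∧ δ * δ = algebraMap k Et.E d := by
  obtain ⟨x, hx⟩ := Et.iota_ne
  have h1 : Et.iota (x - Et.iota x) = -(x - Et.iota x) := by
    rw [map_sub, Et.iota_iota, neg_sub]
  obtain ⟨d, hd⟩ := Et.fixed ((x - Et.iota x) * (x - Et.iota x)) (by
    rw [map_mul, h1, neg_mul_neg])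
  refine ⟨_, d, h1, ?_, hd⟩
  rintro rfl
  rw [map_zero] at hd
  exact hx (sub_eq_zero.1 (Et.reduced _ hd)).symm

theorem exists_trace (e : Et.E) : ∃ c : k, e + Et.iota e = algebraMap k Et.E c :=
  Et.fixed _ (by rw [map_add, Et.iota_iota, add_comm])

variable {Et}

theorem exists_coords (hk2 : (2 : k) ≠ 0) {δ : Et.E} {d : k} (hδ : Et.iota δ = -δ) (hd : d ≠ 0)
    (hδd : δ * δ = algebraMap k Et.E d) (e : Et.E) :
    ∃ a b : k, e = algebraMap k Et.E a + algebraMap k Et.E b * δ := by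
  obtain ⟨a, ha⟩ := Et.exists_trace e
  obtain ⟨b, hb⟩ := Et.fixed ((e - Et.iota e) * δ) (by
    rw [map_mul, map_sub, Et.iota_iota, hδ]; ring)
  refine ⟨a / 2, b / (2 * d), ?_⟩
  have h2 : algebraMap k Et.E 2⁻¹ * 2 = 1 := by
    rw [← map_ofNat (algebraMap k Et.E) 2, ← map_mul, inv_mul_cancel₀ hk2, map_one]
  have h3 : algebraMap k Et.E d⁻¹ * algebraMap k Et.E d = 1 := by
    rw [← map_mul, inv_mul_cancel₀ hd, map_one]
  rw [div_eq_mul_inv, div_eq_mul_inv, mul_inv, map_mul, map_mul, map_mul, ← ha, ← hb]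
  linear_combination (-e) * h2 - (e - Et.iota e) * algebraMap k Et.E 2⁻¹ * h3 -
    (e - Et.iota e) * algebraMap k Et.E 2⁻¹ * algebraMap k Et.E d⁻¹ * hδd

/-- There is an idempotent `f` cutting out a residue field of `E`. -/
theorem exists_idempotent (hk2 : (2 : k) ≠ 0) (Et : QuadraticEtale k) : ∃ f : Et.E,
    f * f = f ∧ f ≠ 0 ∧ (∀ a, f * a ≠ 0 → ∃ b, a * b = f) ∧
      (f = 1 ∨ Et.iota f = 1 - f) := by
  obtain ⟨δ, d, hδ, hd, hδd⟩ := Et.exists_generator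
  by_cases hsq : ∃ c : k, c * c = d
  · obtain ⟨c, rfl⟩ := hsq
    have hc : c ≠ 0 := fun h => hd (by simp [h])
    set t := algebraMap k Et.E with ht
    have h2 : t 2⁻¹ * 2 = 1 := by
      rw [← map_ofNat t 2, ← map_mul, inv_mul_cancel₀ hk2, map_one]
    have h3 : t c⁻¹ * t c = 1 := by rw [← map_mul, inv_mul_cancel₀ hc, map_one]
    rw [map_mul] at hδd
    have hδf : δ * (t 2⁻¹ * (1 + t c⁻¹ * δ)) = t c * (t 2⁻¹ * (1 + t c⁻¹ * δ)) := by
      linear_combination t 2⁻¹ * t c⁻¹ * hδd + (t 2⁻¹ * t c - t 2⁻¹ * δ) * h3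
    have hff : t 2⁻¹ * (1 + t c⁻¹ * δ) * (t 2⁻¹ * (1 + t c⁻¹ * δ)) =
        t 2⁻¹ * (1 + t c⁻¹ * δ) := by
      linear_combination t 2⁻¹ * t c⁻¹ * hδf + (t 2⁻¹ * (1 + t c⁻¹ * δ)) * t 2⁻¹ * h3 +
        (t 2⁻¹ * (1 + t c⁻¹ * δ)) * h2
    have hif : Et.iota (t 2⁻¹ * (1 + t c⁻¹ * δ)) = 1 - t 2⁻¹ * (1 + t c⁻¹ * δ) := by
      rw [map_mul, map_add, map_mul, hδ, map_one, ht, AlgEquiv.commutes, AlgEquiv.commutes]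
      linear_combination h2
    generalize t 2⁻¹ * (1 + t c⁻¹ * δ) = f at *
    refine ⟨f, hff, ?_, ?_, Or.inr hif⟩
    · rintro rfl
      simp at hif
    · intro a ha
      obtain ⟨α, β, rfl⟩ := exists_coords hk2 hδ (mul_ne_zero hc hc)
        (by rw [map_mul]; exact hδd) a
      have key : f * (t α + t β * δ) = t (α + β * c) * f := by
        rw [map_add, map_mul]
        linear_combination t β * hδf
      rw [← ht, key] at ha
      have hne : α + β * c ≠ 0 := fun h => ha (by simp [h])
      refine ⟨t (α + β * c)⁻¹ * f, ?_⟩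
      have h4 : t (α + β * c)⁻¹ * t (α + β * c) = 1 := by
        rw [← map_mul, inv_mul_cancel₀ hne, map_one]
      linear_combination t (α + β * c)⁻¹ * key + f * h4
  · refine ⟨1, one_mul 1, one_ne_zero, fun a ha => ?_, Or.inl rfl⟩
    rw [one_mul] at ha
    obtain ⟨α, β, rfl⟩ := exists_coords hk2 hδ hd hδd a
    set t := algebraMap k Et.E with ht
    have hN : α * α - β * β * d ≠ 0 := by
      intro h
      by_cases hβ : β = 0
      · subst hβ
        have : α = 0 := by simpa using h
        exact ha (by simp [this])
      · exact hsq ⟨α / β, by field_simp; linear_combination h⟩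
    refine ⟨t (α * α - β * β * d)⁻¹ * (t α - t β * δ), ?_⟩
    have h4 : t (α * α - β * β * d)⁻¹ * t (α * α - β * β * d) = 1 := by
      rw [← map_mul, inv_mul_cancel₀ hN, map_one]
    rw [map_sub, map_mul, map_mul, map_mul] at h4
    linear_combination h4 - t (α * α - β * β * d)⁻¹ * t β * t β * hδd

theorem isUnit_of_idempotent {f : Et.E} (hf : ∀ a, f * a ≠ 0 → ∃ b, a * b = f)
    (hf1 : f = 1 ∨ Et.iota f = 1 - f) {a : Et.E} (h1 : f * a ≠ 0) (h2 : Et.iota f * a ≠ 0) :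
    IsUnit a := by
  obtain ⟨b, hb⟩ := hf a h1
  rcases hf1 with rfl | hι
  · exact IsUnit.of_mul_eq_one _ hb
  · obtain ⟨b', hb'⟩ := hf (Et.iota a) (fun h => h2 (by
      rw [← Et.iota_iota a, ← map_mul, h, map_zero]))
    have hb2 := congrArg Et.iota hb'
    rw [map_mul, Et.iota_iota, hι] at hb2
    exact IsUnit.of_mul_eq_one (b + Et.iota b') (by linear_combination hb + hb2)

end QuadraticEtale

namespace CompositionAlgebraO

open QuadraticMap

section Identities

variable {R : Type u} [CommRing R] {C : CompositionAlgebraO R}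

theorem conj_eq (x : C.carrier) : C.conj x = polar C.norm x 1 • (1 : C.carrier) - x := C.conj_def x

theorem polar_mul_mul_left (x y z : C.carrier) :
    polar C.norm (x * y) (x * z) = C.norm x * polar C.norm y z := by
  simp only [polar, ← mul_add, C.norm_mul]; ring

theorem polar_mul_mul_right (x y z : C.carrier) :
    polar C.norm (y * x) (z * x) = C.norm x * polar C.norm y z := by
  simp only [polar, ← add_mul, C.norm_mul]; ring

theorem polar_exchange (x y z w : C.carrier) :
    polar C.norm (x * y) (z * w) + polar C.norm (x * w) (z * y) =
      polar C.norm x z * polar C.norm y w := by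
  have h := polar_mul_mul_left (x + z) y w
  have h1 := polar_mul_mul_left x y w
  have h2 := polar_mul_mul_left z y w
  have h3 := polar_comm C.norm (z * y) (x * w)
  simp only [add_mul, polar_add_left, polar_add_right] at h
  have h4 : C.norm (x + z) = C.norm x + C.norm z + polar C.norm x z := by simp only [polar]; ring
  rw [h4] at h
  linear_combination h - h1 - h2 - h3

theorem polar_mul_left (x y z : C.carrier) :
    polar C.norm (x * y) z = polar C.norm y (C.conj x * z) := by
  have h := polar_exchange x y 1 z
  rw [one_mul, one_mul] at h
  rw [conj_eq, sub_mul, smul_mul_assoc, one_mul, sub_eq_add_neg, polar_add_right,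
    polar_smul_right, polar_neg_right, polar_comm _ y (x * z), smul_eq_mul]
  linear_combination h

theorem polar_mul_right (x y z : C.carrier) :
    polar C.norm (y * x) z = polar C.norm y (z * C.conj x) := by
  have h := polar_exchange y x z 1
  rw [mul_one, mul_one] at h
  rw [conj_eq, mul_sub, mul_smul_comm, mul_one, sub_eq_add_neg, polar_add_right,
    polar_smul_right, polar_neg_right, smul_eq_mul]
  linear_combination h

theorem eq_of_polar {x y : C.carrier} (h : ∀ z, polar C.norm x z = polar C.norm y z) : x = y := by
  rw [← sub_eq_zero]
  refine C.nondegenerate _ fun z => ?_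
  have : polar C.norm (x - y) z = 0 := by
    rw [sub_eq_add_neg, polar_add_left, polar_neg_left, h, add_neg_cancel]
  exact this

theorem conj_mul_mul (x y : C.carrier) : C.conj x * (x * y) = C.norm x • y := by
  refine eq_of_polar fun z => ?_
  rw [polar_mul_left, C.conj_conj, polar_mul_mul_left, polar_smul_left, smul_eq_mul]

theorem mul_mul_conj (x y : C.carrier) : y * x * C.conj x = C.norm x • y := by
  refine eq_of_polar fun z => ?_
  rw [polar_mul_right, C.conj_conj, polar_mul_mul_right, polar_smul_left, smul_eq_mul]

variable (C) in
/-- The pure (trace zero) elements. -/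
def pureSub : Submodule R C.carrier := LinearMap.eqLocus C.conj (-LinearMap.id)

theorem mem_pureSub {x : C.carrier} : x ∈ C.pureSub ↔ C.conj x = -x := Iff.rfl

/-- The commutator of two elements. -/
def br {A : Type*} [NonUnitalNonAssocRing A] (x y : A) : A := x * y - y * x

section br

variable {A : Type*} [NonUnitalNonAssocRing A]

theorem br_add (x y z : A) : br x (y + z) = br x y + br x z := by
  simp only [br, mul_add, add_mul]; abel

theorem add_br (x y z : A) : br (x + y) z = br x z + br y z := by
  simp only [br, mul_add, add_mul]; abel

theorem br_comm (x y : A) : br y x = -br x y := by simp [br]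

theorem br_smul {S : Type*} [CommRing S] [Module S A] [SMulCommClass S A A] [IsScalarTower S A A]
    (c : S) (x y : A) : br x (c • y) = c • br x y := by
  simp only [br, mul_smul_comm, smul_mul_assoc, smul_sub]

theorem smul_br {S : Type*} [CommRing S] [Module S A] [SMulCommClass S A A] [IsScalarTower S A A]
    (c : S) (x y : A) : br (c • x) y = c • br x y := by
  simp only [br, mul_smul_comm, smul_mul_assoc, smul_sub]

end br

theorem polar_one_of_mem (h2 : IsUnit (2 : R)) {x : C.carrier} (hx : x ∈ C.pureSub) :
    polar C.norm x 1 = 0 := by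
  have h1 : polar C.norm x 1 • (1 : C.carrier) = 0 := by
    have := conj_eq x
    rw [mem_pureSub.1 hx] at this
    have h := congrArg (· + x) this
    simpa using h.symm
  have h3 := congrArg (fun z => polar C.norm z 1) h1
  simp only [polar_smul_left, polar_self, polar_zero_left, C.norm_one] at h3
  rw [two_smul, one_add_one_eq_two, smul_eq_mul] at h3
  exact (h2.mul_left_eq_zero).1 h3

theorem mem_pureSub_of_polar {x : C.carrier} (hx : polar C.norm x 1 = 0) : x ∈ C.pureSub := by
  rw [mem_pureSub, conj_eq, hx, zero_smul, zero_sub]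

theorem br_mem (x y : C.carrier) : br x y ∈ C.pureSub := by
  apply mem_pureSub_of_polar
  rw [br, sub_eq_add_neg, polar_add_left, polar_neg_left, polar_mul_left, polar_mul_right,
    mul_one, one_mul, add_neg_cancel]

section Pure

variable {x y z : C.carrier}

theorem mul_self_of_mem (hx : x ∈ C.pureSub) : x * x = -(C.norm x • (1 : C.carrier)) := by
  have := conj_mul_mul x 1
  rw [mul_one, mem_pureSub.1 hx, neg_mul] at this
  rw [← this, neg_neg]

theorem mul_mul_of_mem (hx : x ∈ C.pureSub) (y : C.carrier) : x * (x * y) = -(C.norm x • y) := by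
  have := conj_mul_mul x y
  rw [mem_pureSub.1 hx, neg_mul] at this
  rw [← this, neg_neg]

theorem mul_mul_of_mem' (hx : x ∈ C.pureSub) (y : C.carrier) : y * x * x = -(C.norm x • y) := by
  have := mul_mul_conj x y
  rw [mem_pureSub.1 hx, mul_neg] at this
  rw [← this, neg_neg]

theorem mul_add_mul_of_mem (hx : x ∈ C.pureSub) (hy : y ∈ C.pureSub) :
    x * y + y * x = -(polar C.norm x y • (1 : C.carrier)) := by
  have h := mul_self_of_mem (add_mem hx hy)
  have h1 := mul_self_of_mem hx
  have h2 := mul_self_of_mem hy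
  rw [add_mul, mul_add, mul_add, h1, h2] at h
  have h3 : polar C.norm x y = C.norm (x + y) - C.norm x - C.norm y := rfl
  rw [h3, sub_smul, sub_smul]
  rw [eq_comm, ← sub_eq_zero] at h
  rw [← sub_eq_zero, ← neg_eq_zero, ← h]
  abel

theorem br_eq_of_mem (hx : x ∈ C.pureSub) (hy : y ∈ C.pureSub) :
    br x y = (2 : R) • (x * y) + polar C.norm x y • (1 : C.carrier) := by
  have h := mul_add_mul_of_mem hx hy
  rw [← neg_eq_iff_eq_neg] at h
  rw [← h, br, two_smul]; abel

/-- The fundamental identity of the Malcev algebra of pure elements. -/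
theorem br_br_of_mem (hx : x ∈ C.pureSub) (hy : y ∈ C.pureSub) :
    br x (br x y) = -((4 * C.norm x) • y) + (2 * polar C.norm x y) • x := by
  have h := mul_add_mul_of_mem hx hy
  have hyx : y * x = -(polar C.norm x y • (1 : C.carrier)) - x * y := by rw [← h]; abel
  have hxy : x * y = -(polar C.norm x y • (1 : C.carrier)) - y * x := by rw [← h]; abel
  have e1 : x * (y * x) = -(polar C.norm x y • x) + C.norm x • y := by
    rw [hyx, mul_sub, mul_neg, mul_smul_comm, mul_one, mul_mul_of_mem hx]; abel
  have e2 : x * y * x = -(polar C.norm x y • x) + C.norm x • y := by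
    rw [hxy, sub_mul, neg_mul, smul_mul_assoc, one_mul, mul_mul_of_mem' hx]; abel
  rw [br, br, mul_sub, sub_mul, e1, e2, mul_mul_of_mem hx, mul_mul_of_mem' hx]
  module

end Pure

/-- Projection onto the pure elements. -/
noncomputable def pureProj (C : CompositionAlgebraO R) (h2 : IsUnit (2 : R)) : C.carrier →ₗ[R] C.carrier :=
  (h2.unit⁻¹ : Rˣ).val • (LinearMap.id - C.conj)

variable (h2 : IsUnit (2 : R))
include h2

theorem pureProj_mem (x : C.carrier) : C.pureProj h2 x ∈ C.pureSub := by
  rw [mem_pureSub]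
  simp [pureProj, C.conj_conj, ← smul_neg]

theorem pureProj_of_mem {x : C.carrier} (hx : x ∈ C.pureSub) : C.pureProj h2 x = x := by
  simp only [pureProj, LinearMap.smul_apply, LinearMap.sub_apply, LinearMap.id_apply,
    mem_pureSub.1 hx, sub_neg_eq_add]
  rw [← two_smul R x, smul_smul, IsUnit.val_inv_mul, one_smul]

theorem decomp (x : C.carrier) :
    ((h2.unit⁻¹ : Rˣ).val * polar C.norm x 1) • (1 : C.carrier) + C.pureProj h2 x = x := by
  simp only [pureProj, LinearMap.smul_apply, LinearMap.sub_apply, LinearMap.id_apply, conj_eq]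
  rw [mul_smul, ← smul_add]
  have : polar C.norm x 1 • (1 : C.carrier) + (x - (polar C.norm x 1 • (1 : C.carrier) - x)) =
    (2 : R) • x := by rw [two_smul]; abel
  rw [this, smul_smul, IsUnit.val_inv_mul, one_smul]

theorem exists_decomp (x : C.carrier) : ∃ (e : R) (y : C.carrier), y ∈ C.pureSub ∧
    x = e • (1 : C.carrier) + y :=
  ⟨_, _, pureProj_mem h2 x, (decomp h2 x).symm⟩

theorem mul_of_mem {x y : C.carrier} (hx : x ∈ C.pureSub) (hy : y ∈ C.pureSub) :
    x * y = (h2.unit⁻¹ : Rˣ).val • (br x y - polar C.norm x y • (1 : C.carrier)) := by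
  rw [br_eq_of_mem hx hy, add_sub_cancel_right, smul_smul, IsUnit.val_inv_mul, one_smul]

theorem smul_one_injective {e : R} (he : e • (1 : C.carrier) = 0) : e = 0 := by
  have h3 := congrArg (fun z => polar C.norm z 1) he
  simp only [polar_smul_left, polar_self, polar_zero_left, C.norm_one] at h3
  rw [two_smul, one_add_one_eq_two, smul_eq_mul] at h3
  exact (h2.mul_left_eq_zero).1 h3

theorem smul_one_add_eq_zero {e : R} {x : C.carrier} (hx : x ∈ C.pureSub)
    (h : e • (1 : C.carrier) + x = 0) : e = 0 ∧ x = 0 := by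
  have h3 := congrArg (fun z => polar C.norm z 1) h
  simp only [polar_add_left, polar_smul_left, polar_self, polar_zero_left, C.norm_one,
    polar_one_of_mem h2 hx] at h3
  rw [two_smul, one_add_one_eq_two, smul_eq_mul, add_zero] at h3
  have he := (h2.mul_left_eq_zero).1 h3
  subst he
  exact ⟨rfl, by simpa using h⟩

end Identities

end CompositionAlgebraO

namespace CompositionAlgebraO

open QuadraticMap

/-- Over a reduced ring, multiplication by a nonzero scalar cannot map a module of rank at least
three into a submodule generated by two elements. -/
theorem eq_zero_of_smul_mem_span_pair {R M : Type*} [CommRing R] [IsReduced R] [AddCommGroup M]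
    [Module R M] {z : Fin 3 → M} (hz : LinearIndependent R z) {d : R} {u v : M}
    (h : ∀ i, ∃ α β : R, d • z i = α • u + β • v) : d = 0 := by
  choose α β hαβ using h
  rw [Fintype.linearIndependent_iff] at hz
  have h0 := hαβ 0
  have h1 := hαβ 1
  have h2 := hαβ 2
  have hc := hz ![d * (α 1 * β 2 - α 2 * β 1), d * (α 2 * β 0 - α 0 * β 2),
    d * (α 0 * β 1 - α 1 * β 0)] (by
      simp only [Fin.sum_univ_three, Matrix.cons_val_zero, Matrix.cons_val_one, Matrix.cons_val]
      rw [mul_comm d, mul_comm d, mul_comm d, mul_smul, mul_smul, mul_smul, h0, h1, h2]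
      module) 2
  have hA := hz ![-(d * (d * α 1)), d * (d * α 0), 0] (by
      simp only [Fin.sum_univ_three, Matrix.cons_val_zero, Matrix.cons_val_one, Matrix.cons_val]
      have : -(d * (d * α 1)) • z 0 + (d * (d * α 0)) • z 1 =
        (d * α 0) • (d • z 1) - (d * α 1) • (d • z 0) := by module
      rw [this, h0, h1]
      have : (d * α 0) • (α 1 • u + β 1 • v) - (d * α 1) • (α 0 • u + β 0 • v) =
        (d * (α 0 * β 1 - α 1 * β 0)) • v := by module
      simp only [Matrix.cons_val] at hc
      rw [this, hc]; simp)
  have hB := hz ![-(d * (d * β 1)), d * (d * β 0), 0] (by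
      simp only [Fin.sum_univ_three, Matrix.cons_val_zero, Matrix.cons_val_one, Matrix.cons_val]
      have : -(d * (d * β 1)) • z 0 + (d * (d * β 0)) • z 1 =
        (d * β 0) • (d • z 1) - (d * β 1) • (d • z 0) := by module
      rw [this, h0, h1]
      have : (d * β 0) • (α 1 • u + β 1 • v) - (d * β 1) • (α 0 • u + β 0 • v) =
        -((d * (α 0 * β 1 - α 1 * β 0)) • u) := by module
      simp only [Matrix.cons_val] at hc
      rw [this, hc]; simp)
  have hA0 := hA 1
  have hB0 := hB 1
  simp only [Matrix.cons_val_one, Matrix.cons_val_zero] at hA0 hB0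
  have hd := hz ![d * d * d, 0, 0] (by
      simp only [Fin.sum_univ_three, Matrix.cons_val_zero, Matrix.cons_val_one, Matrix.cons_val]
      rw [mul_smul, h0, smul_add, smul_smul, smul_smul, mul_assoc, mul_assoc, hA0, hB0]; simp) 0
  exact pow_eq_zero_iff (three_ne_zero) |>.1 (by
    simpa [pow_succ] using hd)

section Etale

variable {Et : QuadraticEtale k} {C : CompositionAlgebraO Et.E}

theorem exists_linearIndependent {m : ℕ} (hm : m = 4 ∨ m = 8)
    (hC : Module.finrank Et.E C.carrier = m) :
    ∃ z : Fin 3 → C.carrier, LinearIndependent Et.E z := by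
  have b := Module.finBasis Et.E C.carrier
  have h3 : 3 ≤ Module.finrank Et.E C.carrier := by omega
  exact ⟨_, b.linearIndependent.comp _ (Fin.castLE_injective h3)⟩

theorem eq_zero_of_forall {m : ℕ} (hm : m = 4 ∨ m = 8)
    (hC : Module.finrank Et.E C.carrier = m) {d : Et.E} {u v : C.carrier}
    (h : ∀ z, ∃ α β : Et.E, d • z = α • u + β • v) : d = 0 := by
  obtain ⟨z, hz⟩ := exists_linearIndependent hm hC
  exact eq_zero_of_smul_mem_span_pair hz fun i => h (z i)

theorem eq_zero_of_forall_pure (hk2 : (2 : k) ≠ 0) {m : ℕ} (hm : m = 4 ∨ m = 8)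
    (hC : Module.finrank Et.E C.carrier = m) {d : Et.E} {v : C.carrier}
    (h : ∀ z ∈ C.pureSub, ∃ β : Et.E, d • z = β • v) : d = 0 := by
  refine eq_zero_of_forall hm hC (u := 1) (v := v) fun z => ?_
  obtain ⟨e, y, hy, rfl⟩ := exists_decomp (Et.isUnit_two hk2) z
  obtain ⟨β, hβ⟩ := h y hy
  exact ⟨d * e, β, by rw [smul_add, hβ, mul_smul]⟩

theorem exists_isUnit_norm (hk2 : (2 : k) ≠ 0) (V : Submodule Et.E C.carrier)
    (hnd : ∀ x ∈ V, (∀ y ∈ V, polar C.norm x y = 0) → x = 0)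
    (hrk : ∀ g : Et.E, (∀ v ∈ V, g • v = 0) → g = 0) : ∃ x ∈ V, IsUnit (C.norm x) := by
  obtain ⟨f, hff, hf0, hf, hf1⟩ := QuadraticEtale.exists_idempotent hk2 Et
  have key : ∀ g : Et.E, g ≠ 0 → ∃ v ∈ V, g * C.norm v ≠ 0 := by
    intro g hg
    by_contra! hcon
    refine hg (hrk g fun v hv => hnd _ (V.smul_mem g hv) fun w hw => ?_)
    rw [polar_smul_left, smul_eq_mul, polar, mul_sub, mul_sub, hcon _ (V.add_mem hv hw), hcon v hv,
      hcon w hw, sub_zero, sub_zero]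
  obtain ⟨v, hv, hv1⟩ := key f hf0
  have hιf : Et.iota f ≠ 0 := fun h => hf0 (by simpa using h)
  obtain ⟨w, hw, hw1⟩ := key _ hιf
  rcases hf1 with rfl | hι
  · exact ⟨v, hv, QuadraticEtale.isUnit_of_idempotent hf (Or.inl rfl) hv1 (by simpa using hv1)⟩
  · refine ⟨f • v + Et.iota f • w, V.add_mem (V.smul_mem _ hv) (V.smul_mem _ hw),
      QuadraticEtale.isUnit_of_idempotent hf (Or.inr hι) ?_ ?_⟩
    all_goals
      have h : C.norm (f • v + Et.iota f • w) = f * C.norm v + Et.iota f * C.norm w := by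
        have h4 : C.norm (f • v + Et.iota f • w) = C.norm (f • v) + C.norm (Et.iota f • w) +
          polar C.norm (f • v) (Et.iota f • w) := by simp only [polar]; ring
        rw [h4, polar_smul_left, polar_smul_right, QuadraticMap.map_smul, QuadraticMap.map_smul, hι]
        simp only [smul_eq_mul]
        linear_combination (C.norm v + C.norm w - polar C.norm v w) * hff
      rw [h]
    · convert hv1 using 1
      rw [hι]; linear_combination (C.norm v - C.norm w) * hff
    · convert hw1 using 1
      rw [hι]; linear_combination (C.norm w - C.norm v) * hff

variable (C) in
/-- A pair of orthogonal pure elements of invertible norm. -/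
structure UnitPair where
  x : C.carrier
  y : C.carrier
  hx : x ∈ C.pureSub
  hy : y ∈ C.pureSub
  orth : polar C.norm x y = 0
  ux : IsUnit (C.norm x)
  uy : IsUnit (C.norm y)

theorem eq_zero_of_polar_pure (hk2 : (2 : k) ≠ 0) {x : C.carrier} (hx : x ∈ C.pureSub)
    (h : ∀ y ∈ C.pureSub, polar C.norm x y = 0) : x = 0 := by
  refine C.nondegenerate x fun z => ?_
  obtain ⟨e, y, hy, rfl⟩ := exists_decomp (Et.isUnit_two hk2) z
  change polar C.norm x _ = 0
  rw [polar_add_right, polar_smul_right, polar_one_of_mem (Et.isUnit_two hk2) hx, h y hy,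
    smul_zero, add_zero]

theorem nonempty_unitPair (hk2 : (2 : k) ≠ 0) {m : ℕ} (hm : m = 4 ∨ m = 8)
    (hC : Module.finrank Et.E C.carrier = m) : Nonempty (UnitPair C) := by
  obtain ⟨x, hx, hxu⟩ := exists_isUnit_norm hk2 C.pureSub
    (fun x hx h => eq_zero_of_polar_pure hk2 hx h)
    (fun g hg => eq_zero_of_forall_pure hk2 hm hC (v := 0) fun z hz => ⟨0, by simp [hg z hz]⟩)
  obtain ⟨c, hc⟩ := ((Et.isUnit_two hk2).mul hxu).exists_left_inv
  have hdec : ∀ z ∈ C.pureSub, ∃ (β : Et.E) (w : C.carrier), w ∈ C.pureSub ∧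
      polar C.norm x w = 0 ∧ z = β • x + w := by
    intro z hz
    refine ⟨c * polar C.norm x z, z - (c * polar C.norm x z) • x,
      sub_mem hz (C.pureSub.smul_mem _ hx), ?_, by abel⟩
    rw [sub_eq_add_neg, polar_add_right, polar_neg_right, polar_smul_right, polar_self,
      smul_eq_mul, nsmul_eq_mul]
    push_cast
    linear_combination (-polar C.norm x z) * hc
  obtain ⟨y, ⟨hy, hxy⟩, hyu⟩ := exists_isUnit_norm hk2
    (C.pureSub ⊓ LinearMap.ker (polarBilin C.norm x)) (by
      rintro y ⟨hy, hxy⟩ h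
      refine eq_zero_of_polar_pure hk2 hy fun z hz => ?_
      obtain ⟨β, w, hw, hxw, rfl⟩ := hdec z hz
      rw [polar_add_right, polar_smul_right, h w ⟨hw, hxw⟩, polar_comm,
        show polar C.norm x y = 0 from hxy, smul_zero, add_zero]) (by
      intro g hg
      refine eq_zero_of_forall_pure hk2 hm hC (v := x) fun z hz => ?_
      obtain ⟨β, w, hw, hxw, rfl⟩ := hdec z hz
      exact ⟨g * β, by rw [smul_add, hg w ⟨hw, hxw⟩, add_zero, mul_smul]⟩)
  exact ⟨⟨x, y, hx, hy, hxy, hxu, hyu⟩⟩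

theorem smul_br_br {x z : C.carrier} (hx : x ∈ C.pureSub) (hz : z ∈ C.pureSub) {u e : Et.E}
    (hu : u * (4 * C.norm x) = -e) :
    br (u • x) (br x z) = e • z + (u * (2 * polar C.norm x z)) • x := by
  rw [smul_br, br_br_of_mem hx hz, smul_add, smul_neg, smul_smul, smul_smul, hu, neg_smul, neg_neg]

namespace UnitPair

variable (P : UnitPair C)

theorem exists_inv (hk2 : (2 : k) ≠ 0) : ∃ a b : Et.E, a * (4 * C.norm P.x) = -1 ∧ b * (4 * C.norm P.y) = -1 := by
  have h4 : IsUnit (4 : Et.E) := by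
    have := (Et.isUnit_two hk2).mul (Et.isUnit_two hk2)
    norm_num at this
    exact this
  obtain ⟨a, ha⟩ := (h4.mul P.ux).exists_left_inv
  obtain ⟨b, hb⟩ := (h4.mul P.uy).exists_left_inv
  exact ⟨-a, -b, by rw [neg_mul, ha], by rw [neg_mul, hb]⟩

/-- Scalar multiplications on the pure elements are polynomials in bracket operators. -/
theorem smul_eq {a b : Et.E} (ha : a * (4 * C.norm P.x) = -1) (hb : b * (4 * C.norm P.y) = -1)
    (e : Et.E) {z : C.carrier} (hz : z ∈ C.pureSub) :
    e • z = br ((e * b) • P.y) (br P.y z) + br ((e * a) • P.x) (br P.x z) -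
      br ((e * a) • P.x) (br P.x (br (b • P.y) (br P.y z))) := by
  have hea : (e * a) * (4 * C.norm P.x) = -e := by linear_combination e * ha
  have heb : (e * b) * (4 * C.norm P.y) = -e := by linear_combination e * hb
  have hw : z + (b * (2 * polar C.norm P.y z)) • P.y ∈ C.pureSub :=
    add_mem hz (C.pureSub.smul_mem _ P.hy)
  rw [smul_br_br P.hy hz heb, smul_br_br P.hx hz hea, smul_br_br P.hy hz hb, one_smul,
    smul_br_br P.hx hw hea, polar_add_right, polar_smul_right, P.orth]
  simp only [smul_eq_mul, mul_zero, add_zero]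
  module

end UnitPair

end Etale

end CompositionAlgebraO

namespace CompositionAlgebraO

open QuadraticMap

section Centroid

variable {Et : QuadraticEtale k} {C : CompositionAlgebraO Et.E}

theorem UnitPair.exists_br (hk2 : (2 : k) ≠ 0) (P : UnitPair C) {z : C.carrier}
    (hz : z ∈ C.pureSub) : ∃ u ∈ C.pureSub, ∃ v ∈ C.pureSub, ∃ u' ∈ C.pureSub, ∃ v' ∈ C.pureSub,
      z = br u v + br u' v' := by
  obtain ⟨a, b, ha, hb⟩ := P.exists_inv hk2
  refine ⟨a • P.x, C.pureSub.smul_mem _ P.hx, br P.x z, br_mem _ _,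
    (-(a * (2 * polar C.norm P.x z)) * b) • P.y, C.pureSub.smul_mem _ P.hy, br P.y P.x,
    br_mem _ _, ?_⟩
  have h := smul_br_br P.hy P.hx hb
  rw [polar_comm _ P.y P.x, P.orth, mul_zero, mul_zero, zero_smul, add_zero, one_smul] at h
  rw [smul_br_br P.hx hz ha, one_smul, mul_smul _ b, smul_br _ (b • P.y), h, neg_smul,
    add_neg_cancel_right]

theorem UnitPair.exists_centroid (hk2 : (2 : k) ≠ 0) (P : UnitPair C) (φ : C.carrier →+ C.carrier)
    (hφ : ∀ z ∈ C.pureSub, φ z ∈ C.pureSub)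
    (hbr : ∀ x ∈ C.pureSub, ∀ z ∈ C.pureSub, φ (br x z) = br (φ x) z) :
    ∃ e : Et.E, ∀ z ∈ C.pureSub, φ z = e • z := by
  have hbr' : ∀ x ∈ C.pureSub, ∀ z ∈ C.pureSub, φ (br x z) = br x (φ z) := by
    intro x hx z hz
    rw [br_comm z x, map_neg, hbr z hz x hx, br_comm (φ z) x]
  obtain ⟨a, b, ha, hb⟩ := P.exists_inv hk2
  have hlin : ∀ (e : Et.E), ∀ z ∈ C.pureSub, φ (e • z) = e • φ z := by
    intro e z hz
    rw [P.smul_eq ha hb e hz, P.smul_eq ha hb e (hφ z hz), map_sub, map_add,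
      hbr' _ (C.pureSub.smul_mem _ P.hy) _ (br_mem _ _),
      hbr' _ (C.pureSub.smul_mem _ P.hx) _ (br_mem _ _),
      hbr' _ (C.pureSub.smul_mem _ P.hx) _ (br_mem _ _), hbr' _ P.hy _ hz, hbr' _ P.hx _ hz,
      hbr' _ P.hx _ (br_mem _ _), hbr' _ (C.pureSub.smul_mem _ P.hy) _ (br_mem _ _),
      hbr' _ P.hy _ hz]
  have hx : φ P.x = (-(a * (2 * polar C.norm P.x (φ P.x)))) • P.x := by
    have h := smul_br_br P.hx (hφ _ P.hx) ha
    rw [← hbr' _ P.hx _ P.hx, show br P.x P.x = 0 from sub_self _, map_zero, one_smul,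
      show br (a • P.x) (0 : C.carrier) = 0 by simp [br]] at h
    rw [neg_smul]
    exact eq_neg_of_add_eq_zero_left h.symm
  set e := -(a * (2 * polar C.norm P.x (φ P.x)))
  refine ⟨e, fun z hz => ?_⟩
  have h := smul_br_br P.hx hz ha
  have h' := congrArg φ h
  rw [hbr' _ (C.pureSub.smul_mem _ P.hx) _ (br_mem _ _), hbr _ P.hx _ hz, hx, smul_br e P.x z, br_smul e, h,
    map_add, hlin _ _ P.hx, hx, one_smul, smul_add, smul_comm e] at h'
  exact (add_right_cancel h').symm

theorem UnitPair.exists_eq_smul_one (hk2 : (2 : k) ≠ 0) (P : UnitPair C) {z : C.carrier}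
    (h : ∀ y ∈ C.pureSub, br z y = 0) : ∃ e : Et.E, z = e • (1 : C.carrier) := by
  obtain ⟨a, b, ha, hb⟩ := P.exists_inv hk2
  obtain ⟨e, y, hy, rfl⟩ := exists_decomp (Et.isUnit_two hk2) z
  refine ⟨e, ?_⟩
  have h' : ∀ w ∈ C.pureSub, br w y = 0 := by
    intro w hw
    have h2 := h w hw
    rw [add_br, smul_br, show br (1 : C.carrier) w = 0 by simp [br], smul_zero, zero_add,
      br_comm, neg_eq_zero] at h2
    exact h2
  have h1 := smul_br_br P.hx hy ha
  have h3 := smul_br_br P.hy hy hb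
  rw [h' _ P.hx, show br (a • P.x) (0 : C.carrier) = 0 by simp [br], one_smul] at h1
  rw [h' _ P.hy, show br (b • P.y) (0 : C.carrier) = 0 by simp [br], one_smul,
    eq_neg_of_add_eq_zero_left h1.symm, polar_neg_right, polar_smul_right,
    polar_comm _ P.y P.x, P.orth, smul_zero, neg_zero, mul_zero, mul_zero, zero_smul, add_zero] at h3
  rw [eq_neg_of_add_eq_zero_left h1.symm, ← h3, add_zero]

theorem UnitPair.smul_one_eq (P : UnitPair C) {a : Et.E} (ha : a * (4 * C.norm P.x) = -1)
    (e : Et.E) : e • (1 : C.carrier) = ((e * (a * 4)) • P.x) * P.x := by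
  rw [smul_mul_assoc, mul_self_of_mem P.hx, smul_neg, smul_smul, ← neg_smul]
  congr 1
  linear_combination e * ha

theorem UnitPair.eq_of_eqOn_pure (hk2 : (2 : k) ≠ 0) (P : UnitPair C) {B : Type*}
    [NonAssocRing B] {g g' : C.carrier →+ B}
    (hg : ∀ x y, g (x * y) = g x * g y) (hg' : ∀ x y, g' (x * y) = g' x * g' y)
    (h : ∀ z ∈ C.pureSub, g z = g' z) : g = g' := by
  obtain ⟨a, b, ha, hb⟩ := P.exists_inv hk2
  ext z
  obtain ⟨e, y, hy, rfl⟩ := exists_decomp (Et.isUnit_two hk2) z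
  rw [map_add, map_add, h y hy, P.smul_one_eq ha, hg, hg', h _ (C.pureSub.smul_mem _ P.hx),
    h _ P.hx]

theorem eq_of_smul_pure (hk2 : (2 : k) ≠ 0) {m : ℕ} (hm : m = 4 ∨ m = 8)
    (hC : Module.finrank Et.E C.carrier = m) {e e' : Et.E}
    (h : ∀ z ∈ C.pureSub, e • z = e' • z) : e = e' := by
  rw [← sub_eq_zero]
  exact eq_zero_of_forall_pure hk2 hm hC (v := 0) fun z hz => ⟨0, by
    rw [sub_smul, h z hz, sub_self, smul_zero]⟩

end Centroid

section Isomorphism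

variable {Et Et' : QuadraticEtale k} {C : CompositionAlgebraO Et.E}
  {C' : CompositionAlgebraO Et'.E}

/-- An additive map between pure parts that respects commutators is semilinear. -/
theorem exists_semilinear (hk2 : (2 : k) ≠ 0) {m : ℕ} (hm : m = 4 ∨ m = 8)
    (hC' : Module.finrank Et'.E C'.carrier = m) (f : C.carrier →+ C'.carrier)
    (f' : C'.carrier →+ C.carrier)
    (hf : ∀ z ∈ C.pureSub, f z ∈ C'.pureSub) (hf' : ∀ z ∈ C'.pureSub, f' z ∈ C.pureSub)
    (hff' : ∀ z ∈ C.pureSub, f' (f z) = z) (hf'f : ∀ z ∈ C'.pureSub, f (f' z) = z)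
    (hbr : ∀ x ∈ C.pureSub, ∀ y ∈ C.pureSub, f (br x y) = br (f x) (f y))
    (hk : ∀ (c : k), ∀ x ∈ C.pureSub, f (algebraMap k Et.E c • x) = algebraMap k Et'.E c • f x) :
    ∃ σ : Et.E →ₐ[k] Et'.E, ∀ e, ∀ z ∈ C.pureSub, f (e • z) = σ e • f z := by
  obtain ⟨P⟩ := nonempty_unitPair hk2 hm hC'
  have key : ∀ e : Et.E, ∃ e' : Et'.E, ∀ z ∈ C.pureSub, f (e • z) = e' • f z := by
    intro e
    obtain ⟨e', he'⟩ := P.exists_centroid hk2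
      ((f.comp (DistribSMul.toAddMonoidHom C.carrier e)).comp f')
      (fun z hz => hf _ (C.pureSub.smul_mem _ (hf' z hz))) (by
        intro x hx z hz
        change f (e • f' (br x z)) = br (f (e • f' x)) z
        have h1 : br x z = f (br (f' x) (f' z)) := by
          rw [hbr _ (hf' x hx) _ (hf' z hz), hf'f x hx, hf'f z hz]
        rw [h1, hff' _ (br_mem _ _), ← smul_br, hbr _ (C.pureSub.smul_mem _ (hf' x hx)) _
          (hf' z hz), hf'f z hz])
    refine ⟨e', fun z hz => ?_⟩
    have := he' (f z) (hf z hz)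
    change f (e • f' (f z)) = _ at this
    rwa [hff' z hz] at this
  choose σ hσ using key
  have huniq : ∀ (e : Et'.E) (e' : Et'.E), (∀ z ∈ C.pureSub, e • f z = e' • f z) → e = e' := by
    intro e e' h
    refine eq_of_smul_pure hk2 hm hC' fun z hz => ?_
    rw [← hf'f z hz]
    exact h _ (hf' z hz)
  refine ⟨AlgHom.mk (RingHom.mk (MonoidHom.mk (OneHom.mk σ ?_) ?_) ?_ ?_) ?_, hσ⟩
  · exact huniq _ _ fun z hz => by rw [← hσ _ z hz, one_smul, one_smul]
  · intro x y
    refine huniq _ _ fun z hz => ?_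
    simp only
    rw [← hσ _ z hz, mul_smul, hσ _ _ (C.pureSub.smul_mem _ hz), hσ _ z hz, mul_smul]
  · exact huniq _ _ fun z hz => by simp [← hσ _ z hz]
  · intro x y
    refine huniq _ _ fun z hz => ?_
    simp only
    rw [← hσ _ z hz, add_smul, map_add, hσ _ z hz, hσ _ z hz, add_smul]
  · intro c
    exact huniq _ _ fun z hz => by simp [← hσ _ z hz, hk c z hz]

theorem map_norm (hk2 : (2 : k) ≠ 0) {m : ℕ} (hm : m = 4 ∨ m = 8)
    (hC' : Module.finrank Et'.E C'.carrier = m) (f : C.carrier →+ C'.carrier)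
    (hf : ∀ z ∈ C.pureSub, f z ∈ C'.pureSub)
    (hsurj : ∀ z ∈ C'.pureSub, ∃ w ∈ C.pureSub, f w = z)
    (hbr : ∀ x ∈ C.pureSub, ∀ y ∈ C.pureSub, f (br x y) = br (f x) (f y))
    (σ : Et.E →ₐ[k] Et'.E) (hσ : ∀ e, ∀ z ∈ C.pureSub, f (e • z) = σ e • f z)
    {x : C.carrier} (hx : x ∈ C.pureSub) : σ (C.norm x) = C'.norm (f x) := by
  have h4 : IsUnit (4 : Et'.E) := by
    have := (Et'.isUnit_two hk2).mul (Et'.isUnit_two hk2)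
    norm_num at this
    exact this
  rw [← sub_eq_zero]
  refine (h4.mul_right_eq_zero).1 ?_
  refine eq_zero_of_forall_pure hk2 hm hC' (v := f x) fun z hz => ?_
  obtain ⟨w, hw, rfl⟩ := hsurj z hz
  have h := congrArg f (br_br_of_mem hx hw)
  rw [hbr _ hx _ (br_mem _ _), hbr _ hx _ hw, br_br_of_mem (hf _ hx) hz, map_add, map_neg,
    hσ _ _ hw, hσ _ _ hx, map_mul, map_ofNat] at h
  refine ⟨σ (2 * polar C.norm x w) - 2 * polar C'.norm (f x) (f w), ?_⟩
  rw [mul_sub, sub_smul, sub_smul]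
  rw [add_comm, ← sub_eq_add_neg, add_comm, ← sub_eq_add_neg] at h
  rw [sub_eq_sub_iff_add_eq_add] at h ⊢
  rw [add_comm, ← h]

theorem exists_ringHom (hk2 : (2 : k) ≠ 0) {m : ℕ} (hm : m = 4 ∨ m = 8)
    (hC' : Module.finrank Et'.E C'.carrier = m) (f : C.carrier →+ C'.carrier)
    (f' : C'.carrier →+ C.carrier)
    (hf : ∀ z ∈ C.pureSub, f z ∈ C'.pureSub) (hf' : ∀ z ∈ C'.pureSub, f' z ∈ C.pureSub)
    (hff' : ∀ z ∈ C.pureSub, f' (f z) = z) (hf'f : ∀ z ∈ C'.pureSub, f (f' z) = z)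
    (hbr : ∀ x ∈ C.pureSub, ∀ y ∈ C.pureSub, f (br x y) = br (f x) (f y))
    (hk : ∀ (c : k), ∀ x ∈ C.pureSub, f (algebraMap k Et.E c • x) = algebraMap k Et'.E c • f x) :
    ∃ g : C.carrier →+ C'.carrier, (∀ x y, g (x * y) = g x * g y) ∧ g 1 = 1 ∧
      (∀ (c : k) x, g (algebraMap k Et.E c • x) = algebraMap k Et'.E c • g x) ∧
      ∀ z ∈ C.pureSub, g z = f z := by
  obtain ⟨σ, hσ⟩ := exists_semilinear hk2 hm hC' f f' hf hf' hff' hf'f hbr hk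
  have hn : ∀ x ∈ C.pureSub, σ (C.norm x) = C'.norm (f x) := fun x hx =>
    map_norm hk2 hm hC' f hf (fun z hz => ⟨_, hf' z hz, hf'f z hz⟩) hbr σ hσ hx
  have hp : ∀ x ∈ C.pureSub, ∀ y ∈ C.pureSub,
      σ (polar C.norm x y) = polar C'.norm (f x) (f y) := by
    intro x hx y hy
    simp only [polar, map_sub, hn _ hx, hn _ hy, hn _ (add_mem hx hy), map_add]
  have h2 := Et.isUnit_two hk2
  have h2' := Et'.isUnit_two hk2
  have hu : σ ((h2.unit⁻¹ : Et.Eˣ) : Et.E) = ((h2'.unit⁻¹ : Et'.Eˣ) : Et'.E) := by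
    apply h2'.mul_left_cancel
    rw [h2'.mul_val_inv, ← map_ofNat σ 2, ← map_mul, h2.mul_val_inv, map_one]
  let tr : C.carrier →+ Et.E :=
    ((AddMonoidHom.mulLeft ((h2.unit⁻¹ : Et.Eˣ) : Et.E)).comp
      ((polarBilin C.norm).flip 1).toAddMonoidHom)
  let g : C.carrier →+ C'.carrier :=
    ((AddMonoidHom.mk' (fun e : Et'.E => e • (1 : C'.carrier)) (fun a b => add_smul a b _)).comp
      σ.toRingHom.toAddMonoidHom).comp tr + f.comp (C.pureProj h2).toAddMonoidHom
  have hg : ∀ (e : Et.E), ∀ y ∈ C.pureSub, g (e • 1 + y) = σ e • (1 : C'.carrier) + f y := by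
    intro e y hy
    change σ (((h2.unit⁻¹ : Et.Eˣ) : Et.E) * polar C.norm (e • 1 + y) 1) • (1 : C'.carrier) +
      f (C.pureProj h2 (e • 1 + y)) = _
    have h1 : polar C.norm (e • 1 + y) 1 = 2 * e := by
      rw [polar_add_left, polar_one_of_mem h2 hy, polar_smul_left, polar_self, C.norm_one]
      simp [mul_comm]
    rw [h1, ← mul_assoc, h2.val_inv_mul, one_mul, map_add, pureProj_of_mem h2 hy]
    have h3 := decomp h2 (e • 1 + y)
    rw [h1, ← mul_assoc, h2.val_inv_mul, one_mul, map_add, pureProj_of_mem h2 hy] at h3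
    rw [add_left_cancel h3]
  have hg1 : ∀ e : Et.E, g (e • 1) = σ e • (1 : C'.carrier) := by
    intro e
    have := hg e 0 (zero_mem _)
    rwa [add_zero, map_zero, add_zero] at this
  have hgp : ∀ z ∈ C.pureSub, g z = f z := by
    intro z hz
    have := hg 0 z hz
    rwa [zero_smul, map_zero, zero_smul, zero_add, zero_add] at this
  have hgs : ∀ (e : Et.E) x, g (e • x) = σ e • g x := by
    intro e x
    obtain ⟨d, y, hy, rfl⟩ := exists_decomp h2 x
    rw [smul_add, smul_smul, hg _ _ (C.pureSub.smul_mem _ hy), hg _ _ hy, hσ _ _ hy, map_mul,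
      smul_add, mul_smul]
  have hgpp : ∀ x ∈ C.pureSub, ∀ y ∈ C.pureSub, g (x * y) = g x * g y := by
    intro x hx y hy
    rw [mul_of_mem h2 hx hy, hgs, map_sub, hgp _ (br_mem _ _), hg1, hbr _ hx _ hy, hgp _ hx,
      hgp _ hy, mul_of_mem h2' (hf _ hx) (hf _ hy), hu, hp _ hx _ hy]
  refine ⟨g, ?_, ?_, ?_, hgp⟩
  · intro x y
    obtain ⟨d, x, hx, rfl⟩ := exists_decomp h2 x
    obtain ⟨e, y, hy, rfl⟩ := exists_decomp h2 y
    simp only [add_mul, mul_add, smul_mul_assoc, mul_smul_comm, one_mul, mul_one, map_add, hgs,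
      hgpp _ hx _ hy]
    have : g (1 : C.carrier) = 1 := by simpa using hg1 1
    rw [this]
    simp only [one_mul, mul_one]
  · simpa using hg1 1
  · intro c x
    rw [hgs, σ.commutes]

end Isomorphism

/-- `k`-algebra isomorphisms of composition algebras over quadratic étale extensions of `k`. -/
structure KIso {Et Et' : QuadraticEtale k} (C : CompositionAlgebraO Et.E)
    (C' : CompositionAlgebraO Et'.E) where
  toAddEquiv : C.carrier ≃+ C'.carrier
  map_mul : ∀ x y, toAddEquiv (x * y) = toAddEquiv x * toAddEquiv y
  map_one : toAddEquiv 1 = 1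
  map_smul : ∀ (c : k) x,
    toAddEquiv (algebraMap k Et.E c • x) = algebraMap k Et'.E c • toAddEquiv x

section KIso

variable {Et Et' : QuadraticEtale k} {C : CompositionAlgebraO Et.E}
  {C' : CompositionAlgebraO Et'.E}

/-- An isomorphism between the pure parts, with respect to the commutator, comes from an
isomorphism of `k`-algebras. -/
theorem exists_kIso (hk2 : (2 : k) ≠ 0) {m : ℕ} (hm : m = 4 ∨ m = 8)
    (hC : Module.finrank Et.E C.carrier = m)
    (hC' : Module.finrank Et'.E C'.carrier = m) (f : C.carrier →+ C'.carrier)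
    (f' : C'.carrier →+ C.carrier)
    (hf : ∀ z ∈ C.pureSub, f z ∈ C'.pureSub) (hf' : ∀ z ∈ C'.pureSub, f' z ∈ C.pureSub)
    (hff' : ∀ z ∈ C.pureSub, f' (f z) = z) (hf'f : ∀ z ∈ C'.pureSub, f (f' z) = z)
    (hbr : ∀ x ∈ C.pureSub, ∀ y ∈ C.pureSub, f (br x y) = br (f x) (f y))
    (hk : ∀ (c : k), ∀ x ∈ C.pureSub, f (algebraMap k Et.E c • x) = algebraMap k Et'.E c • f x) :
    ∃ g : KIso C C', ∀ z ∈ C.pureSub, g.toAddEquiv z = f z := by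
  obtain ⟨g, hg, hg1, hgk, hgf⟩ := exists_ringHom hk2 hm hC' f f' hf hf' hff' hf'f hbr hk
  obtain ⟨g', hg', hg1', hgk', hgf'⟩ := exists_ringHom hk2 hm hC f' f hf' hf hf'f hff' (by
      intro x hx y hy
      nth_rw 1 [← hf'f x hx, ← hf'f y hy]
      rw [← hbr _ (hf' x hx) _ (hf' y hy), hff' _ (br_mem _ _)]) (by
      intro c x hx
      nth_rw 1 [← hf'f x hx]
      rw [← hk _ _ (hf' x hx), hff' _ (C.pureSub.smul_mem _ (hf' x hx))])
  obtain ⟨P⟩ := nonempty_unitPair hk2 hm hC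
  obtain ⟨P'⟩ := nonempty_unitPair hk2 hm hC'
  have h1 : g'.comp g = AddMonoidHom.id _ := P.eq_of_eqOn_pure hk2
    (fun x y => by simp [hg, hg']) (fun x y => rfl) fun z hz => by
      change g' (g z) = z
      rw [hgf z hz, hgf' _ (hf z hz), hff' z hz]
  have h2 : g.comp g' = AddMonoidHom.id _ := P'.eq_of_eqOn_pure hk2
    (fun x y => by simp [hg, hg']) (fun x y => rfl) fun z hz => by
      change g (g' z) = z
      rw [hgf' z hz, hgf _ (hf' z hz), hf'f z hz]
  exact ⟨⟨⟨⟨g, g', DFunLike.congr_fun h1, DFunLike.congr_fun h2⟩, g.map_add⟩, hg, hg1, hgk⟩, hgf⟩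

namespace KIso

/-- The inverse of an isomorphism. -/
def symm (g : KIso C C') : KIso C' C where
  toAddEquiv := g.toAddEquiv.symm
  map_mul x y := g.toAddEquiv.injective (by simp [g.map_mul])
  map_one := g.toAddEquiv.injective (by simp [g.map_one])
  map_smul c x := g.toAddEquiv.injective (by simp [g.map_smul])

theorem map_br (g : KIso C C') (x y : C.carrier) :
    g.toAddEquiv (br x y) = br (g.toAddEquiv x) (g.toAddEquiv y) := by
  simp [br, g.map_mul]

theorem map_pure (hk2 : (2 : k) ≠ 0) (P : UnitPair C) (g : KIso C C') {z : C.carrier}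
    (hz : z ∈ C.pureSub) : g.toAddEquiv z ∈ C'.pureSub := by
  obtain ⟨u, -, v, -, u', -, v', -, rfl⟩ := P.exists_br hk2 hz
  rw [_root_.map_add, g.map_br, g.map_br]
  exact add_mem (br_mem _ _) (br_mem _ _)

theorem exists_algHom (hk2 : (2 : k) ≠ 0) (P' : UnitPair C') (g : KIso C C') :
    ∃ σ : Et.E →ₐ[k] Et'.E, (∀ e z, g.toAddEquiv (e • z) = σ e • g.toAddEquiv z) ∧
      ∀ e, σ (Et.iota e) = Et'.iota (σ e) := by
  have key : ∀ e : Et.E, ∃ e' : Et'.E, g.toAddEquiv (e • 1) = e' • (1 : C'.carrier) := by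
    intro e
    refine P'.exists_eq_smul_one hk2 fun y _ => ?_
    obtain ⟨w, rfl⟩ := g.toAddEquiv.surjective y
    rw [← g.map_br]
    simp [br]
  choose σ hσ using key
  have hσ' : ∀ e z, g.toAddEquiv (e • z) = σ e • g.toAddEquiv z := by
    intro e z
    rw [← one_mul z, ← smul_mul_assoc, g.map_mul, hσ, smul_mul_assoc, one_mul, one_mul]
  have h2' := Et'.isUnit_two hk2
  have huniq : ∀ (e : Et'.E) (e' : Et'.E), e • (1 : C'.carrier) = e' • (1 : C'.carrier) →
      e = e' := by
    intro e e' h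
    rw [← sub_eq_zero]
    exact smul_one_injective h2' (C := C') (by rw [sub_smul, h, sub_self])
  let τ : Et.E →ₐ[k] Et'.E := AlgHom.mk (RingHom.mk (MonoidHom.mk (OneHom.mk σ
    (huniq _ _ (by rw [← hσ, one_smul, one_smul, g.map_one])))
    (fun x y => huniq _ _ (by
      simp only
      rw [← hσ, mul_smul, hσ', hσ, mul_smul])))
    (huniq _ _ (by
      simp only
      rw [← hσ, zero_smul, zero_smul, _root_.map_zero]))
    (fun x y => huniq _ _ (by
      simp only
      rw [← hσ, add_smul, _root_.map_add, hσ, hσ, add_smul])))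
    (fun c => huniq _ _ (by
      change σ _ • (1 : C'.carrier) = _
      rw [← hσ, g.map_smul, g.map_one]))
  have hinj : ∀ e, τ e = 0 → e = 0 := by
    intro e he
    have h := hσ e
    rw [show σ e = 0 from he, zero_smul, EmbeddingLike.map_eq_zero_iff] at h
    exact smul_one_injective (Et.isUnit_two hk2) h
  refine ⟨τ, hσ', ?_⟩
  obtain ⟨δ, d, hδ, hd, hδd⟩ := Et.exists_generator
  obtain ⟨δ', d', hδ', hd', hδd'⟩ := Et'.exists_generator
  have hτδ : Et'.iota (τ δ) = -τ δ := by
    obtain ⟨a, b, hab⟩ := QuadraticEtale.exists_coords hk2 hδ' hd' hδd' (τ δ)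
    have h1 : τ δ * τ δ = algebraMap k Et'.E d := by
      rw [← _root_.map_mul, hδd, τ.commutes]
    have h2 : algebraMap k Et'.E (2 * a * b) * δ' =
        algebraMap k Et'.E (d - a * a - b * b * d') := by
      simp only [_root_.map_mul, map_sub, map_ofNat]
      rw [hab] at h1
      linear_combination h1 + (algebraMap k Et'.E b * algebraMap k Et'.E b) * -hδd'
    have h3 : algebraMap k Et'.E (2 * a * b) * δ' = 0 := by
      have h4 := congrArg Et'.iota h2
      rw [_root_.map_mul, AlgEquiv.commutes, AlgEquiv.commutes, hδ', ← h2] at h4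
      refine h2'.mul_right_eq_zero.1 ?_
      linear_combination -h4
    have h5 : 2 * a * b = 0 := by
      by_contra hne
      have h6 : δ' = 0 := by
        refine ((IsUnit.mk0 _ hne).map (algebraMap k Et'.E)).mul_right_eq_zero.1 h3
      rw [h6, mul_zero] at hδd'
      exact hd' ((map_eq_zero _).1 hδd'.symm)
    rcases mul_eq_zero.1 h5 with h6 | h6
    · have ha : a = 0 := by simpa [hk2] using h6
      rw [hab, ha]
      simp [hδ']
    · exfalso
      have h7 : δ - algebraMap k Et.E a = 0 := hinj _ (by
        rw [map_sub, hab, h6, τ.commutes]; simp)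
      have h8 := congrArg Et.iota h7
      rw [map_sub, hδ, AlgEquiv.commutes, _root_.map_zero] at h8
      have h9 : (2 : Et.E) * δ = 0 := by linear_combination h7 - h8
      rw [(Et.isUnit_two hk2).mul_right_eq_zero] at h9
      rw [h9, mul_zero] at hδd
      exact hd ((map_eq_zero _).1 hδd.symm)
  intro e
  obtain ⟨a, b, rfl⟩ := QuadraticEtale.exists_coords hk2 hδ hd hδd e
  simp [hδ, hτδ]

theorem map_conj (hk2 : (2 : k) ≠ 0) (P : UnitPair C) (P' : UnitPair C') (g : KIso C C')
    (z : C.carrier) : g.toAddEquiv (C.conj z) = C'.conj (g.toAddEquiv z) := by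
  obtain ⟨σ, hσ, -⟩ := g.exists_algHom hk2 P'
  obtain ⟨e, y, hy, rfl⟩ := exists_decomp (Et.isUnit_two hk2) z
  have h1 := mem_pureSub.1 (g.map_pure hk2 P hy)
  rw [_root_.map_add, _root_.map_add, mem_pureSub.1 hy, _root_.map_add, _root_.map_add, map_neg,
    h1, hσ, g.map_one, LinearMap.map_smul, LinearMap.map_smul, C.conj_one, C'.conj_one, hσ,
    g.map_one]

end KIso

end KIso

end CompositionAlgebraO

namespace CompositionAlgebraO

variable (Et : QuadraticEtale k) (C : CompositionAlgebraO Et.E)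

/-- The identity map, as a semilinear equivalence from an algebra to its conjugate. -/
def conjEquiv : C.carrier ≃+ ConjAlg Et C where
  toFun := ConjAlg.ofConj
  invFun := ConjAlg.unConj
  left_inv _ := rfl
  right_inv _ := rfl
  map_add' _ _ := rfl

variable {Et C}

theorem conjEquiv_smul (e : Et.E) (x : C.carrier) :
    conjEquiv Et C (e • x) = Et.iota e • conjEquiv Et C x :=
  ConjAlg.ext (by simp [conjEquiv, Et.iota_iota])

instance : Module.Free Et.E (ConjAlg Et C) :=
  letI := RingHomInvPair.of_ringEquiv Et.iota.toRingEquiv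
  letI := RingHomInvPair.symm (Et.iota.toRingEquiv : Et.E →+* Et.E)
    (Et.iota.toRingEquiv.symm : Et.E →+* Et.E)
  Module.Free.of_equiv (M := C.carrier)
    ({ conjEquiv Et C with
      map_smul' := conjEquiv_smul } :
      C.carrier ≃ₛₗ[(Et.iota.toRingEquiv : Et.E →+* Et.E)] ConjAlg Et C)

instance : Module.Finite Et.E (ConjAlg Et C) := by
  obtain ⟨s, hs⟩ := Module.Finite.fg_top (R := Et.E) (M := C.carrier)
  classical
  refine ⟨⟨s.image (conjEquiv Et C), ?_⟩⟩
  rw [eq_top_iff]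
  rintro x -
  obtain ⟨y, rfl⟩ := (conjEquiv Et C).surjective x
  have hy : y ∈ Submodule.span Et.E (s : Set C.carrier) := hs ▸ Submodule.mem_top
  induction hy using Submodule.span_induction with
  | mem x h => exact Submodule.subset_span (Finset.mem_coe.2 (Finset.mem_image_of_mem _ h))
  | zero => simp
  | add x y _ _ hx hy => rw [map_add]; exact add_mem hx hy
  | smul a x _ hx => rw [conjEquiv_smul]; exact Submodule.smul_mem _ _ hx

theorem finrank_conjAlg : Module.finrank Et.E (ConjAlg Et C) = Module.finrank Et.E C.carrier := by
  have := rank_eq_of_equiv_equiv (Et.iota : Et.E → Et.E) (conjEquiv Et C) Et.iota.bijective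
    conjEquiv_smul
  rw [Module.finrank, Module.finrank, this]

end CompositionAlgebraO

namespace Corestriction

open CompositionAlgebraO QuadraticMap

variable {Et : QuadraticEtale k} {C : CompositionAlgebraO Et.E}

instance : IsScalarTower k Et.E (Amb Et C) :=
  ⟨fun c e t => by rw [ksmul_def, smul_smul, Algebra.smul_def]⟩

theorem finrank_amb {m : ℕ} (hC : Module.finrank Et.E C.carrier = m) :
    Module.finrank k (Amb Et C) = 2 * m ^ 2 := by
  rw [← Module.finrank_mul_finrank k Et.E (Amb Et C), Et.finrank_eq, Module.finrank_tensorProduct,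
    finrank_conjAlg, hC, pow_two]

theorem switchAux_switchAux (t : Amb Et C) : switchAux Et C (switchAux Et C t) = t := by
  induction t using TensorProduct.induction_on with
  | zero => simp
  | tmul x y => rw [switchAux_tmul, switchAux_tmul]
  | add a b ha hb => rw [map_add, map_add, ha, hb]

theorem add_switch_mem (t : Amb Et C) : t + switchAux Et C t ∈ corSubmodule Et C := by
  rw [mem_corSubmodule, map_add, switchAux_switchAux, add_comm]

theorem isUnit_delta {δ : Et.E} {d : k} (hd : d ≠ 0) (hδd : δ * δ = algebraMap k Et.E d) :
    IsUnit δ :=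
  isUnit_of_mul_isUnit_left (y := δ) (hδd ▸ (IsUnit.mk0 d hd).map (algebraMap k Et.E))

theorem finrank_cor (hk2 : (2 : k) ≠ 0) {m : ℕ} (hC : Module.finrank Et.E C.carrier = m) :
    Module.finrank k (corSubmodule Et C) = m ^ 2 := by
  obtain ⟨δ, d, hδ, hd, hδd⟩ := Et.exists_generator
  have hδu := isUnit_delta hd hδd
  have h2 := Et.isUnit_two hk2
  let F : (corSubmodule Et C × corSubmodule Et C) →ₗ[k] Amb Et C :=
    (corSubmodule Et C).subtype.coprod
      ((LinearMap.lsmul Et.E (Amb Et C) δ).restrictScalars k ∘ₗ (corSubmodule Et C).subtype)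
  have hF : Function.Bijective F := by
    constructor
    · rw [injective_iff_map_eq_zero]
      rintro ⟨⟨a, ha⟩, ⟨b, hb⟩⟩ h
      change a + δ • b = 0 at h
      rw [mem_corSubmodule] at ha hb
      have h' := congrArg (switchAux Et C) h
      rw [map_add, switchAux_smul, ha, hb, hδ, map_zero] at h'
      have ha0 : a = 0 := by
        have : (2 : Et.E) • a = 0 := by
          have h3 : (2 : Et.E) • a = (a + δ • b) + (a + -δ • b) := by module
          rw [h3, h, h', add_zero]
        rwa [h2.smul_eq_zero] at this
      rw [ha0, zero_add, hδu.smul_eq_zero] at h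
      subst ha0; subst h; rfl
    · intro T
      obtain ⟨c, hc⟩ := (h2.mul hδu).exists_left_inv
      have hcι : Et.iota c = -c := by
        apply (h2.mul hδu).mul_left_cancel
        have := congrArg Et.iota hc
        rw [map_mul, map_mul, map_ofNat, hδ, map_one] at this
        linear_combination -this + hc
      refine ⟨(⟨(c * δ) • (T + switchAux Et C T), ?_⟩, ⟨c • (T - switchAux Et C T), ?_⟩), ?_⟩
      · rw [mem_corSubmodule, switchAux_smul, map_add, switchAux_switchAux, map_mul, hδ, hcι,
          neg_mul_neg, add_comm]
      · rw [mem_corSubmodule, switchAux_smul, map_sub, switchAux_switchAux, hcι, neg_smul,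
          ← smul_neg, neg_sub]
      · change (c * δ) • (T + switchAux Et C T) + δ • (c • (T - switchAux Et C T)) = T
        have : (c * δ) • (T + switchAux Et C T) + δ • (c • (T - switchAux Et C T)) =
          (c * (2 * δ)) • T := by module
        rw [this, hc, one_smul]
  have hfin := (LinearEquiv.ofBijective F hF).finrank_eq
  have : Module.Finite k (Amb Et C) := Module.Finite.trans Et.E _
  rw [Module.finrank_prod, finrank_amb hC] at hfin
  omega

/-- The symmetrisation map `x ↦ ^ιx ⊗ 1 + 1 ⊗ x`. -/
noncomputable def symAmb : C.carrier →+ Amb Et C where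
  toFun x := (ConjAlg.ofConj x : ConjAlg Et C) ⊗ₜ[Et.E] (1 : C.carrier) + 1 ⊗ₜ[Et.E] x
  map_zero' := by
    rw [TensorProduct.tmul_zero, add_zero]
    exact TensorProduct.zero_tmul _ _
  map_add' x y := by
    rw [TensorProduct.tmul_add, show (ConjAlg.ofConj (x + y) : ConjAlg Et C)
      = ConjAlg.ofConj x + ConjAlg.ofConj y from rfl, TensorProduct.add_tmul]
    abel

theorem symAmb_apply (x : C.carrier) : symAmb x =
    (ConjAlg.ofConj x : ConjAlg Et C) ⊗ₜ[Et.E] (1 : C.carrier) + 1 ⊗ₜ[Et.E] x := rfl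

theorem symAmb_mem (x : C.carrier) : symAmb x ∈ corSubmodule Et C := by
  rw [mem_corSubmodule, symAmb_apply, map_add, switchAux_tmul, switchAux_tmul, add_comm]
  rfl

theorem involAux_symAmb (x : C.carrier) :
    involAux Et C (symAmb x) = symAmb (C.conj x) := by
  rw [symAmb_apply, map_add, involAux_tmul, involAux_tmul, C.conj_one,
    show conjC Et C 1 = 1 from ConjAlg.ext C.conj_one]
  rfl

theorem symAmb_mul (x y : C.carrier) : symAmb (C := C) x * symAmb y =
    symAmb (x * y) + ((ConjAlg.ofConj x : ConjAlg Et C) ⊗ₜ[Et.E] y +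
      (ConjAlg.ofConj y : ConjAlg Et C) ⊗ₜ[Et.E] x) := by
  simp only [symAmb_apply, add_mul, mul_add, Algebra.TensorProduct.tmul_mul_tmul, one_mul, mul_one]
  rw [show (ConjAlg.ofConj (x * y) : ConjAlg Et C) = ConjAlg.ofConj x * ConjAlg.ofConj y from rfl]
  abel

theorem br_symAmb (x y : C.carrier) :
    br (symAmb (C := C) x) (symAmb y) = symAmb (br x y) := by
  rw [br, br, symAmb_mul, symAmb_mul, map_sub]
  abel

theorem symAmb_ksmul (c : k) (x : C.carrier) :
    symAmb (algebraMap k Et.E c • x) = c • symAmb (C := C) x := by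
  rw [ksmul_def, symAmb_apply, symAmb_apply, smul_add, TensorProduct.tmul_smul,
    TensorProduct.smul_tmul']
  congr 2
  exact ConjAlg.ext (by simp)

theorem ofConj_smul (e : Et.E) (x : C.carrier) :
    (ConjAlg.ofConj (e • x) : ConjAlg Et C) = Et.iota e • ConjAlg.ofConj x :=
  conjEquiv_smul e x

theorem smul_one_tmul_add (e : Et.E) (x : C.carrier) : symAmb (e • x) =
    Et.iota e • ((ConjAlg.ofConj x : ConjAlg Et C) ⊗ₜ[Et.E] (1 : C.carrier)) +
      e • ((1 : ConjAlg Et C) ⊗ₜ[Et.E] x) := by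
  rw [symAmb_apply, ofConj_smul, TensorProduct.tmul_smul]
  rfl

theorem symAmb_smul_one (e : Et.E) :
    symAmb (e • (1 : C.carrier)) = (e + Et.iota e) • (1 : Amb Et C) := by
  rw [smul_one_tmul_add, Algebra.TensorProduct.one_def, add_smul, add_comm]
  rfl

/-- An `E`-linear left inverse of twice the symmetrisation map, on pure elements. -/
noncomputable def retraction : Amb Et C →ₗ[Et.E] C.carrier :=
  TensorProduct.lift
    { toFun := fun x => Et.iota (polar C.norm x.unConj 1) • LinearMap.id
      map_add' := fun x y => by
        simp [polar_add_left, add_smul]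
      map_smul' := fun e x => by
        simp [polar_smul_left, mul_smul, Et.iota_iota] }

theorem retraction_symAmb (hk2 : (2 : k) ≠ 0) {x : C.carrier} (hx : x ∈ C.pureSub) :
    retraction (symAmb x) = (2 : Et.E) • x := by
  rw [symAmb_apply, map_add, retraction, TensorProduct.lift.tmul, TensorProduct.lift.tmul]
  simp only [LinearMap.coe_mk, AddHom.coe_mk, LinearMap.smul_apply, LinearMap.id_apply,
    polar_one_of_mem (Et.isUnit_two hk2) hx, map_zero, zero_smul, ConjAlg.unConj_one,
    polar_self, C.norm_one]
  rw [LinearMap.zero_apply, zero_add, nsmul_eq_mul, mul_one, Nat.cast_ofNat, map_ofNat]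

theorem symAmb_injOn (hk2 : (2 : k) ≠ 0) {x y : C.carrier} (hx : x ∈ C.pureSub)
    (hy : y ∈ C.pureSub) (h : symAmb x = symAmb y) : x = y := by
  have := congrArg retraction h
  rw [retraction_symAmb hk2 hx, retraction_symAmb hk2 hy] at this
  exact (Et.isUnit_two hk2).smul_left_cancel.1 this

theorem tmul_decomp (a d : Et.E) (x y : C.carrier) :
    (ConjAlg.ofConj (a • (1 : C.carrier) + x) : ConjAlg Et C) ⊗ₜ[Et.E] (d • (1 : C.carrier) + y) =
      (Et.iota a * d) • (1 : Amb Et C) + (Et.iota a • ((1 : ConjAlg Et C) ⊗ₜ[Et.E] y) +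
      d • ((ConjAlg.ofConj x : ConjAlg Et C) ⊗ₜ[Et.E] (1 : C.carrier))) +
      (ConjAlg.ofConj x : ConjAlg Et C) ⊗ₜ[Et.E] y := by
  rw [show (ConjAlg.ofConj (a • (1 : C.carrier) + x) : ConjAlg Et C) =
    Et.iota a • 1 + ConjAlg.ofConj x from congrArg (· + ConjAlg.ofConj x) (ofConj_smul a 1)]
  simp only [TensorProduct.add_tmul, TensorProduct.tmul_add, ← TensorProduct.smul_tmul',
    TensorProduct.tmul_smul, Algebra.TensorProduct.one_def, smul_smul, smul_add]
  module

theorem exists_symAmb_of_skew (hk2 : (2 : k) ≠ 0) {t : Amb Et C} (ht : t ∈ corSubmodule Et C)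
    (hskew : involAux Et C t = -t) : ∃ x ∈ C.pureSub, t = symAmb x := by
  have h2 := Et.isUnit_two hk2
  have key : ∀ T : Amb Et C, ∃ w ∈ C.pureSub,
      (T - involAux Et C T) + switchAux Et C (T - involAux Et C T) = symAmb w := by
    intro T
    induction T using TensorProduct.induction_on with
    | zero => exact ⟨0, zero_mem _, by simp⟩
    | add S T hS hT =>
      obtain ⟨w, hw, hw'⟩ := hS
      obtain ⟨v, hv, hv'⟩ := hT
      refine ⟨w + v, add_mem hw hv, ?_⟩
      rw [map_add, map_add, ← hw', ← hv', map_sub, map_add, map_add, map_sub, map_sub]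
      abel
    | tmul x y =>
      obtain ⟨a, x, hx, hax⟩ := exists_decomp h2 x.unConj
      obtain ⟨d, y, hy, rfl⟩ := exists_decomp h2 y
      obtain rfl := ConjAlg.ext (x := _) (y := ConjAlg.ofConj (a • 1 + x)) hax
      refine ⟨(2 * Et.iota a) • y + (2 * Et.iota d) • x,
        add_mem (C.pureSub.smul_mem _ hy) (C.pureSub.smul_mem _ hx), ?_⟩
      have hcx : conjC Et C (ConjAlg.ofConj x) = -ConjAlg.ofConj x :=
        ConjAlg.ext (mem_pureSub.1 hx)
      have hc1 : conjC Et C 1 = 1 := ConjAlg.ext C.conj_one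
      rw [tmul_decomp]
      simp only [map_add, map_smul, involAux_one, involAux_tmul, hcx, hc1, mem_pureSub.1 hy,
        C.conj_one, TensorProduct.neg_tmul, TensorProduct.tmul_neg, neg_neg, smul_neg, map_sub,
        map_neg, switchAux_smul, switchAux_tmul, switchAux_one, smul_one_tmul_add, map_mul,
        map_ofNat, Et.iota_iota, ConjAlg.unConj_one]
      rw [show (ConjAlg.ofConj (1 : C.carrier) : ConjAlg Et C) = 1 from rfl]
      module
  obtain ⟨w, hw, h⟩ := key t
  obtain ⟨c, hc⟩ := (h2.mul h2).exists_left_inv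
  have hc' : c = algebraMap k Et.E ((2 * 2)⁻¹) := by
    apply (h2.mul h2).mul_right_cancel
    rw [hc, ← map_ofNat (algebraMap k Et.E) 2, ← map_mul, ← map_mul,
      inv_mul_cancel₀ (mul_ne_zero hk2 hk2), map_one]
  refine ⟨c • w, C.pureSub.smul_mem _ hw, ?_⟩
  rw [hc', symAmb_ksmul, ← h, hskew, ksmul_def, ← hc', sub_neg_eq_add, map_add,
    (mem_corSubmodule Et C).1 ht]
  have : c • (t + t + (t + t)) = (c * (2 * 2)) • t := by module
  rw [this, hc, one_smul]

theorem cor_le_of_mem (hk2 : (2 : k) ≠ 0) (S : Submodule k (Amb Et C)) (h1 : 1 ∈ S)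
    (hs : ∀ x ∈ C.pureSub, symAmb x ∈ S)
    (hss : ∀ x ∈ C.pureSub, ∀ y ∈ C.pureSub, symAmb (C := C) x * symAmb y ∈ S) :
    corSubmodule Et C ≤ S := by
  have h2 := Et.isUnit_two hk2
  have htr : ∀ e : Et.E, (e + Et.iota e) • (1 : Amb Et C) ∈ S := by
    intro e
    obtain ⟨c, hc⟩ := Et.exists_trace e
    rw [hc, ← ksmul_def]
    exact S.smul_mem _ h1
  have key : ∀ T : Amb Et C, T + switchAux Et C T ∈ S := by
    intro T
    induction T using TensorProduct.induction_on with
    | zero => simp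
    | add X T hS hT =>
      have : X + T + switchAux Et C (X + T) =
        (X + switchAux Et C X) + (T + switchAux Et C T) := by rw [map_add]; abel
      rw [this]
      exact add_mem hS hT
    | tmul x y =>
      obtain ⟨a, x, hx, hax⟩ := exists_decomp h2 x.unConj
      obtain ⟨d, y, hy, rfl⟩ := exists_decomp h2 y
      obtain rfl := ConjAlg.ext (x := _) (y := ConjAlg.ofConj (a • 1 + x)) hax
      obtain ⟨e, w, hw, hew⟩ := exists_decomp h2 (x * y)
      have h4 : (ConjAlg.ofConj x : ConjAlg Et C) ⊗ₜ[Et.E] y +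
          (ConjAlg.ofConj y : ConjAlg Et C) ⊗ₜ[Et.E] x ∈ S := by
        have := symAmb_mul (Et := Et) x y
        rw [add_comm, ← sub_eq_iff_eq_add] at this
        rw [← this, hew, map_add, symAmb_smul_one]
        exact sub_mem (hss _ hx _ hy) (add_mem (htr e) (hs _ hw))
      have h3 := add_mem (add_mem (htr (Et.iota a * d)) (hs _ (C.pureSub.smul_mem (Et.iota a) hy)))
        (add_mem (hs _ (C.pureSub.smul_mem (Et.iota d) hx)) h4)
      convert h3 using 1
      rw [tmul_decomp]
      simp only [map_add, switchAux_smul, switchAux_tmul, switchAux_one, smul_one_tmul_add,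
        map_mul, Et.iota_iota, ConjAlg.unConj_one]
      rw [show (ConjAlg.ofConj (1 : C.carrier) : ConjAlg Et C) = 1 from rfl]
      module
  intro t ht
  have h := key t
  rw [(mem_corSubmodule Et C).1 ht, ← two_smul k] at h
  have := S.smul_mem (2⁻¹ : k) h
  rwa [smul_smul, inv_mul_cancel₀ hk2, one_smul] at this

end Corestriction

namespace Corestriction

open CompositionAlgebraO

section Functor

variable {Et Et' : QuadraticEtale k} {C : CompositionAlgebraO Et.E}
  {C' : CompositionAlgebraO Et'.E}

/-- The symmetrisation map `x ↦ ^ιx ⊗ 1 + 1 ⊗ x`, with values in the corestriction. -/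
noncomputable def symCor (x : C.carrier) : (corestriction Et C).carrier := ⟨symAmb x, symAmb_mem x⟩

theorem symCor_add (x y : C.carrier) : symCor (x + y) = symCor x + symCor (C := C) y :=
  Subtype.ext (map_add _ _ _)

theorem symCor_ksmul (c : k) (x : C.carrier) :
    symCor (algebraMap k Et.E c • x) = c • symCor (C := C) x :=
  Subtype.ext (symAmb_ksmul c x)

theorem br_symCor (x y : C.carrier) : br (symCor x) (symCor y) = symCor (C := C) (br x y) :=
  Subtype.ext (br_symAmb x y)

theorem symCor_mem_skew {x : C.carrier} (hx : x ∈ C.pureSub) :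
    symCor x ∈ (corestriction Et C).skew :=
  Subtype.ext (by
    refine (involAux_symAmb x).trans ?_
    rw [mem_pureSub.1 hx, map_neg]
    rfl)

theorem symCor_injOn (hk2 : (2 : k) ≠ 0) {x y : C.carrier} (hx : x ∈ C.pureSub)
    (hy : y ∈ C.pureSub) (h : symCor x = symCor y) : x = y :=
  symAmb_injOn hk2 hx hy (congrArg Subtype.val h)

theorem exists_symCor_of_skew (hk2 : (2 : k) ≠ 0) {t : (corestriction Et C).carrier}
    (ht : t ∈ (corestriction Et C).skew) : ∃ x ∈ C.pureSub, t = symCor x := by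
  obtain ⟨x, hx, h⟩ := exists_symAmb_of_skew hk2 t.2 (congrArg Subtype.val ht)
  exact ⟨x, hx, Subtype.ext h⟩

theorem eq_top_of_symCor_mem (hk2 : (2 : k) ≠ 0) (S : Submodule k (corestriction Et C).carrier)
    (h1 : 1 ∈ S) (hs : ∀ x ∈ C.pureSub, symCor x ∈ S)
    (hss : ∀ x ∈ C.pureSub, ∀ y ∈ C.pureSub, symCor (C := C) x * symCor y ∈ S) : S = ⊤ := by
  let S' : Submodule k (Amb Et C) :=
    Submodule.map (corSubmodule Et C).subtype (show Submodule k (corSubmodule Et C) from S)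
  have h := cor_le_of_mem hk2 S' ⟨_, h1, rfl⟩ (fun x hx => ⟨_, hs x hx, rfl⟩)
    (fun x hx y hy => ⟨_, hss x hx y hy, rfl⟩)
  rw [eq_top_iff]
  rintro t -
  obtain ⟨t', ht', heq⟩ := h t.2
  exact (Subtype.ext heq : t' = t) ▸ ht'

theorem linearMap_ext (hk2 : (2 : k) ≠ 0) {B : AlgebraWithInvolution k}
    {F F' : (corestriction Et C).carrier →ₗ[k] B.carrier} (hF : ∀ x y, F (x * y) = F x * F y)
    (hF' : ∀ x y, F' (x * y) = F' x * F' y) (h1 : F 1 = F' 1)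
    (h : ∀ x ∈ C.pureSub, F (symCor x) = F' (symCor x)) : F = F' := by
  have := eq_top_of_symCor_mem hk2 (LinearMap.eqLocus F F') h1 h fun x hx y hy => by
    change F _ = F' _
    rw [hF, hF', h x hx, h y hy]
  ext t
  exact (this ▸ Submodule.mem_top : t ∈ LinearMap.eqLocus F F')

theorem exists_ambMap (hk2 : (2 : k) ≠ 0) (P' : UnitPair C') (g : KIso C C') :
    ∃ G : Amb Et C →+ Amb Et' C', ∀ x y, G (x ⊗ₜ[Et.E] y) =
      (ConjAlg.ofConj (g.toAddEquiv x.unConj) : ConjAlg Et' C') ⊗ₜ[Et'.E] g.toAddEquiv y := by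
  obtain ⟨σ, hσ, hσι⟩ := g.exists_algHom hk2 P'
  let b : ConjAlg Et C →+ C.carrier →+ Amb Et' C' := AddMonoidHom.mk' (fun x =>
    AddMonoidHom.mk' (fun y => (ConjAlg.ofConj (g.toAddEquiv x.unConj) : ConjAlg Et' C') ⊗ₜ[Et'.E]
      g.toAddEquiv y) fun y y' => by rw [map_add, TensorProduct.tmul_add]) fun x x' => by
        ext y
        change (ConjAlg.ofConj (g.toAddEquiv (x + x').unConj) : ConjAlg Et' C') ⊗ₜ[Et'.E] _ = _
        rw [ConjAlg.unConj_add, map_add]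
        exact TensorProduct.add_tmul _ _ _
  refine ⟨TensorProduct.liftAddHom b ?_, fun x y => TensorProduct.liftAddHom_tmul _ _ _ _⟩
  intro e x y
  change (ConjAlg.ofConj (g.toAddEquiv (e • x).unConj) : ConjAlg Et' C') ⊗ₜ[Et'.E] _ =
    (ConjAlg.ofConj (g.toAddEquiv x.unConj) : ConjAlg Et' C') ⊗ₜ[Et'.E] g.toAddEquiv (e • y)
  rw [ConjAlg.unConj_smul, hσ, hσ, ofConj_smul, hσι, Et'.iota_iota, TensorProduct.tmul_smul]
  rfl

/-- The map induced by an isomorphism on the ambient algebras. -/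
noncomputable def ambMap (hk2 : (2 : k) ≠ 0) (P' : UnitPair C') (g : KIso C C') :
    Amb Et C →+ Amb Et' C' := (exists_ambMap hk2 P' g).choose

theorem ambMap_tmul (hk2 : (2 : k) ≠ 0) (P' : UnitPair C') (g : KIso C C') (x : ConjAlg Et C)
    (y : C.carrier) : ambMap hk2 P' g (x ⊗ₜ[Et.E] y) =
      (ConjAlg.ofConj (g.toAddEquiv x.unConj) : ConjAlg Et' C') ⊗ₜ[Et'.E] g.toAddEquiv y :=
  (exists_ambMap hk2 P' g).choose_spec x y

variable (hk2 : (2 : k) ≠ 0) (P : UnitPair C) (P' : UnitPair C') (g : KIso C C')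

theorem ambMap_symAmb (x : C.carrier) :
    ambMap hk2 P' g (symAmb x) = symAmb (g.toAddEquiv x) := by
  rw [symAmb_apply, map_add, ambMap_tmul, ambMap_tmul, ConjAlg.unConj_one, g.map_one]
  rfl

theorem ambMap_one : ambMap hk2 P' g 1 = 1 := by
  rw [Algebra.TensorProduct.one_def, ambMap_tmul, ConjAlg.unConj_one, g.map_one]
  rfl

theorem ambMap_mul (a b : Amb Et C) :
    ambMap hk2 P' g (a * b) = ambMap hk2 P' g a * ambMap hk2 P' g b := by
  induction a using TensorProduct.induction_on with
  | zero => rw [zero_mul, map_zero, zero_mul]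
  | tmul x y =>
    induction b using TensorProduct.induction_on with
    | zero => rw [mul_zero, map_zero, mul_zero]
    | tmul x' y' =>
      rw [Algebra.TensorProduct.tmul_mul_tmul, ambMap_tmul, ambMap_tmul, ambMap_tmul,
        Algebra.TensorProduct.tmul_mul_tmul, ConjAlg.unConj_mul, g.map_mul, g.map_mul]
      rfl
    | add u v hu hv => rw [mul_add, map_add, hu, hv, map_add, mul_add]
  | add u v hu hv => rw [add_mul, map_add, hu, hv, map_add, add_mul]

theorem ambMap_switch (t : Amb Et C) :
    ambMap hk2 P' g (switchAux Et C t) = switchAux Et' C' (ambMap hk2 P' g t) := by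
  induction t using TensorProduct.induction_on with
  | zero => simp
  | tmul x y => rw [switchAux_tmul, ambMap_tmul, ambMap_tmul, switchAux_tmul]
  | add a b ha hb => rw [map_add, map_add, ha, hb, map_add, map_add]

theorem ambMap_ksmul (c : k) (t : Amb Et C) :
    ambMap hk2 P' g (c • t) = c • ambMap hk2 P' g t := by
  induction t using TensorProduct.induction_on with
  | zero => simp
  | tmul x y =>
    rw [TensorProduct.smul_tmul', ambMap_tmul, ambMap_tmul, ConjAlg.unConj_ksmul, g.map_smul,
      TensorProduct.smul_tmul']
    rfl
  | add a b ha hb => rw [smul_add, map_add, ha, hb, map_add, smul_add]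

include P in
theorem ambMap_invol (t : Amb Et C) :
    ambMap hk2 P' g (involAux Et C t) = involAux Et' C' (ambMap hk2 P' g t) := by
  induction t using TensorProduct.induction_on with
  | zero => simp
  | tmul x y =>
    rw [involAux_tmul, ambMap_tmul, ambMap_tmul, involAux_tmul, ← g.map_conj hk2 P P']
    congr 1
    exact ConjAlg.ext (g.map_conj hk2 P P' x.unConj)
  | add a b ha hb => rw [map_add, map_add, ha, hb, map_add, map_add]

theorem ambMap_symm (t : Amb Et C) : ambMap hk2 P g.symm (ambMap hk2 P' g t) = t := by
  induction t using TensorProduct.induction_on with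
  | zero => simp
  | tmul x y =>
    rw [ambMap_tmul, ambMap_tmul]
    congr 1
    · exact ConjAlg.ext (g.toAddEquiv.symm_apply_apply _)
    · exact g.toAddEquiv.symm_apply_apply _
  | add a b ha hb => rw [map_add, map_add, ha, hb]

include P' in
include P hk2 in
/-- The corestriction functor on isomorphisms. -/
theorem exists_iso : ∃ F : (corestriction Et C).Iso (corestriction Et' C'),
    ∀ x, F.toLinearEquiv (symCor x) = symCor (g.toAddEquiv x) := by
  have hmem : ∀ {t : Amb Et C}, t ∈ corSubmodule Et C →
      ambMap hk2 P' g t ∈ corSubmodule Et' C' := by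
    intro t ht
    rw [mem_corSubmodule, ← ambMap_switch, (mem_corSubmodule Et C).1 ht]
  have hmem' : ∀ {t : Amb Et' C'}, t ∈ corSubmodule Et' C' →
      ambMap hk2 P g.symm t ∈ corSubmodule Et C := by
    intro t ht
    rw [mem_corSubmodule, ← ambMap_switch, (mem_corSubmodule Et' C').1 ht]
  let e : corSubmodule Et C ≃ₗ[k] corSubmodule Et' C' :=
    { toFun := fun t => ⟨ambMap hk2 P' g t.1, hmem t.2⟩
      invFun := fun t => ⟨ambMap hk2 P g.symm t.1, hmem' t.2⟩
      map_add' := fun s t => Subtype.ext (map_add _ _ _)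
      map_smul' := fun c t => Subtype.ext (ambMap_ksmul _ _ _ _ _)
      left_inv := fun t => Subtype.ext (ambMap_symm _ _ _ _ _)
      right_inv := fun t => Subtype.ext (ambMap_symm hk2 P' P g.symm _) }
  exact ⟨⟨e, fun x y => Subtype.ext (ambMap_mul _ _ _ _ _), Subtype.ext (ambMap_one _ _ _),
    fun x => Subtype.ext (ambMap_invol hk2 P _ _ _)⟩, fun x => Subtype.ext (ambMap_symAmb _ _ _ _)⟩

include hk2 in
theorem exists_pure_map (F : (corestriction Et C).Iso (corestriction Et' C')) :
    ∃ f : C.carrier →+ C'.carrier, (∀ z, f z ∈ C'.pureSub) ∧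
      ∀ z ∈ C.pureSub, F.toLinearEquiv (symCor z) = symCor (f z) := by
  have h2 := Et.isUnit_two hk2
  have key : ∀ z : C.carrier, ∃ w ∈ C'.pureSub,
      F.toLinearEquiv (symCor (C.pureProj h2 z)) = symCor w := by
    intro z
    refine exists_symCor_of_skew hk2 ?_
    have h := symCor_mem_skew (pureProj_mem h2 z)
    change (corestriction Et' C').invol _ = _
    rw [← F.map_invol, show (corestriction Et C).invol _ = _ from h, map_neg]
  choose f hf hfF using key
  refine ⟨AddMonoidHom.mk' f fun x y => ?_, hf, fun z hz => ?_⟩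
  · refine symCor_injOn hk2 (hf _) (add_mem (hf _) (hf _)) ?_
    rw [← hfF, symCor_add, ← hfF, ← hfF, map_add, symCor_add, map_add]
  · have := hfF z
    rwa [pureProj_of_mem h2 hz] at this

/-- The inverse of an isomorphism of algebras with involution. -/
def isoSymm {A B : AlgebraWithInvolution k} (F : A.Iso B) : B.Iso A where
  toLinearEquiv := F.toLinearEquiv.symm
  map_mul x y := F.toLinearEquiv.injective (by simp [F.map_mul])
  map_one := F.toLinearEquiv.injective (by simp [F.map_one])
  map_invol x := F.toLinearEquiv.injective (by simp [F.map_invol])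

include hk2 in
/-- The corestriction functor is full. -/
theorem exists_kIso_of_iso {m : ℕ} (hm : m = 4 ∨ m = 8)
    (hC : Module.finrank Et.E C.carrier = m) (hC' : Module.finrank Et'.E C'.carrier = m)
    (F : (corestriction Et C).Iso (corestriction Et' C')) :
    ∃ g : KIso C C', ∀ z ∈ C.pureSub, F.toLinearEquiv (symCor z) = symCor (g.toAddEquiv z) := by
  obtain ⟨f, hf, hfF⟩ := exists_pure_map hk2 F
  obtain ⟨f', hf', hfF'⟩ := exists_pure_map hk2 (isoSymm F)
  obtain ⟨g, hg⟩ := exists_kIso hk2 hm hC hC' f f' (fun z _ => hf z) (fun z _ => hf' z)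
    (fun z hz => symCor_injOn hk2 (hf' _) hz (by
      rw [← hfF' _ (hf z), ← hfF z hz]
      exact F.toLinearEquiv.symm_apply_apply _))
    (fun z hz => symCor_injOn hk2 (hf _) hz (by
      rw [← hfF _ (hf' z), ← hfF' z hz]
      exact F.toLinearEquiv.apply_symm_apply _))
    (fun x hx y hy => symCor_injOn hk2 (hf _) (br_mem _ _) (by
      rw [← hfF _ (br_mem _ _), ← br_symCor, ← br_symCor, ← hfF x hx, ← hfF y hy, br, br, map_sub,
        F.map_mul, F.map_mul]))
    (fun c x hx => symCor_injOn hk2 (hf _) (C'.pureSub.smul_mem _ (hf _)) (by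
      rw [← hfF _ (C.pureSub.smul_mem _ hx), symCor_ksmul, symCor_ksmul, ← hfF x hx, map_smul]))
  exact ⟨g, fun z hz => by rw [hfF z hz, hg z hz]⟩

end Functor

section Centroid

variable {Et : QuadraticEtale k} {C : CompositionAlgebraO Et.E}

theorem bijective_skew (hk2 : (2 : k) ≠ 0) : Function.Bijective
    (fun x : C.pureSub => (⟨symCor x.1, symCor_mem_skew x.2⟩ : (corestriction Et C).skew)) := by
  constructor
  · intro x y h
    exact Subtype.ext (symCor_injOn hk2 x.2 y.2 (congrArg Subtype.val h))
  · intro t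
    obtain ⟨x, hx, h⟩ := exists_symCor_of_skew hk2 t.2
    exact ⟨⟨x, hx⟩, Subtype.ext h.symm⟩

/-- The identification of the pure elements with the skew elements of the corestriction. -/
noncomputable def skewEquiv (hk2 : (2 : k) ≠ 0) : C.pureSub ≃+ (corestriction Et C).skew :=
  AddEquiv.mk' (Equiv.ofBijective _ (bijective_skew hk2)) fun x y =>
    Subtype.ext (symCor_add x.1 y.1)

theorem skewEquiv_ksmul (hk2 : (2 : k) ≠ 0) (c : k) (x : C.pureSub) :
    skewEquiv hk2 (algebraMap k Et.E c • x) = c • skewEquiv (C := C) hk2 x :=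
  Subtype.ext (symCor_ksmul c x.1)

theorem skewEquiv_br (hk2 : (2 : k) ≠ 0) (x y : C.pureSub) :
    adOp (corestriction Et C) (skewEquiv hk2 x) (skewEquiv hk2 y) =
      skewEquiv hk2 ⟨br x.1 y.1, br_mem _ _⟩ :=
  Subtype.ext (br_symCor x.1 y.1)

/-- The action of the centre on the skew elements of the corestriction. -/
noncomputable def centreAction (hk2 : (2 : k) ≠ 0) :
    Et.E →ₐ[k] Module.End k (corestriction Et C).skew :=
  AlgHom.ofLinearMap
    { toFun := fun e =>
        { toFun := fun t => skewEquiv hk2 (e • (skewEquiv hk2).symm t)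
          map_add' := fun s t => by rw [map_add, smul_add, map_add]
          map_smul' := fun c t => by
            have : (skewEquiv hk2).symm (c • t) =
                algebraMap k Et.E c • (skewEquiv (C := C) hk2).symm t := by
              rw [AddEquiv.symm_apply_eq, skewEquiv_ksmul, AddEquiv.apply_symm_apply]
            rw [this, smul_comm, skewEquiv_ksmul]
            rfl }
      map_add' := fun d e => by
        ext1 t
        change skewEquiv hk2 _ = skewEquiv hk2 _ + skewEquiv hk2 _
        rw [add_smul, map_add]
      map_smul' := fun c e => by
        ext1 t
        change skewEquiv hk2 _ = c • skewEquiv hk2 _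
        rw [Algebra.smul_def, mul_smul, skewEquiv_ksmul] }
    (by
      ext1 t
      change skewEquiv hk2 _ = t
      rw [one_smul, AddEquiv.apply_symm_apply])
    (fun d e => by
      ext1 t
      change skewEquiv hk2 _ = skewEquiv hk2 (d • (skewEquiv hk2).symm (skewEquiv hk2 _))
      rw [AddEquiv.symm_apply_apply, mul_smul])

theorem centreAction_skewEquiv (hk2 : (2 : k) ≠ 0) (e : Et.E) (x : C.pureSub) :
    centreAction hk2 e (skewEquiv hk2 x) = skewEquiv hk2 (e • x) := by
  change skewEquiv hk2 (e • (skewEquiv hk2).symm (skewEquiv hk2 x)) = _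
  rw [AddEquiv.symm_apply_apply]

theorem end_ext (hk2 : (2 : k) ≠ 0) {f g : Module.End k (corestriction Et C).skew}
    (h : ∀ x : C.pureSub, f (skewEquiv hk2 x) = g (skewEquiv hk2 x)) : f = g := by
  ext1 t
  obtain ⟨x, rfl⟩ := (skewEquiv hk2).surjective t
  exact h x

theorem centreAction_mem (hk2 : (2 : k) ≠ 0) (P : UnitPair C) (e : Et.E) :
    centreAction hk2 e ∈ malcevCentroid (corestriction Et C) := by
  have hmem : ∀ u : C.pureSub, adOp (corestriction Et C) (skewEquiv hk2 u) ∈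
      malcevMultAlg (corestriction Et C) := fun u => Algebra.subset_adjoin ⟨_, rfl⟩
  refine ⟨?_, ?_⟩
  · obtain ⟨a, b, ha, hb⟩ := P.exists_inv hk2
    let x : C.pureSub := ⟨P.x, P.hx⟩
    let y : C.pureSub := ⟨P.y, P.hy⟩
    let ad : C.pureSub → Module.End k (corestriction Et C).skew :=
      fun u => adOp (corestriction Et C) (skewEquiv hk2 u)
    have : centreAction hk2 e = ad ((e * b) • y) * ad y + ad ((e * a) • x) * ad x -
        ad ((e * a) • x) * (ad x * (ad (b • y) * ad y)) := by
      refine end_ext hk2 fun z => ?_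
      simp only [LinearMap.sub_apply, LinearMap.add_apply, Module.End.mul_apply, ad,
        skewEquiv_br, centreAction_skewEquiv]
      rw [← map_add, ← map_sub]
      congr 1
      exact Subtype.ext (P.smul_eq ha hb e z.2)
    rw [this]
    exact sub_mem (add_mem (mul_mem (hmem _) (hmem _)) (mul_mem (hmem _) (hmem _)))
      (mul_mem (hmem _) (mul_mem (hmem _) (mul_mem (hmem _) (hmem _))))
  · have : malcevMultAlg (corestriction Et C) ≤
        Subalgebra.centralizer k {centreAction hk2 e} := by
      refine Algebra.adjoin_le ?_
      rintro _ ⟨u, rfl⟩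
      obtain ⟨u, rfl⟩ := (skewEquiv hk2).surjective u
      refine Subalgebra.mem_centralizer_iff k |>.2 ?_
      rintro _ rfl
      refine end_ext hk2 fun z => ?_
      simp only [Module.End.mul_apply, skewEquiv_br, centreAction_skewEquiv]
      congr 1
      exact Subtype.ext (br_smul e u.1 z.1).symm
    refine Subalgebra.mem_centralizer_iff k |>.2 fun g hg => ?_
    exact (Subalgebra.mem_centralizer_iff k |>.1 (this hg) _ rfl).symm

theorem bijective_centreAction (hk2 : (2 : k) ≠ 0) {m : ℕ} (hm : m = 4 ∨ m = 8)
    (hC : Module.finrank Et.E C.carrier = m) (P : UnitPair C) :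
    Function.Bijective ((centreAction hk2).codRestrict (malcevCentroid (corestriction Et C))
      (centreAction_mem hk2 P)) := by
  constructor
  · intro d e h
    have h' : centreAction (C := C) hk2 d = centreAction hk2 e := congrArg Subtype.val h
    refine eq_of_smul_pure hk2 hm hC fun z hz => ?_
    have := LinearMap.congr_fun h' (skewEquiv hk2 ⟨z, hz⟩)
    rw [centreAction_skewEquiv, centreAction_skewEquiv] at this
    exact congrArg Subtype.val ((skewEquiv hk2).injective this)
  · rintro ⟨φ, hφ⟩
    have hcomm : ∀ u z : C.pureSub, adOp (corestriction Et C) (skewEquiv hk2 u)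
        (φ (skewEquiv hk2 z)) = φ (skewEquiv hk2 ⟨br u.1 z.1, br_mem _ _⟩) := by
      intro u z
      rw [← skewEquiv_br]
      have := Subalgebra.mem_centralizer_iff k |>.1 hφ.2 (adOp (corestriction Et C) (skewEquiv hk2 u))
        (Algebra.subset_adjoin ⟨_, rfl⟩)
      exact LinearMap.congr_fun this _
    have h2 := Et.isUnit_two hk2
    let p : C.carrier →+ C.pureSub :=
      ((C.pureProj h2).codRestrict C.pureSub (pureProj_mem h2)).toAddMonoidHom
    have hp : ∀ z : C.pureSub, p z = z := fun z => Subtype.ext (pureProj_of_mem h2 z.2)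
    let f : C.carrier →+ C.carrier := C.pureSub.subtype.toAddMonoidHom.comp
      (((skewEquiv hk2).symm.toAddMonoidHom.comp φ.toAddMonoidHom).comp
        ((skewEquiv hk2).toAddMonoidHom.comp p))
    have hf : ∀ z : C.pureSub, f z = (skewEquiv hk2).symm (φ (skewEquiv hk2 z)) := by
      intro z
      change ((skewEquiv hk2).symm (φ (skewEquiv hk2 (p z))) : C.carrier) = _
      rw [hp]
    have hbr : ∀ u z : C.pureSub, f (br u.1 z.1) = br u.1 (f z) := by
      intro u z
      have h := hf ⟨br u.1 z.1, br_mem _ _⟩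
      rw [← hcomm] at h
      rw [h, hf z]
      have h3 := skewEquiv_br hk2 u ((skewEquiv hk2).symm (φ (skewEquiv hk2 z)))
      rw [AddEquiv.apply_symm_apply] at h3
      rw [h3, AddEquiv.symm_apply_apply]
    obtain ⟨e, he⟩ := P.exists_centroid hk2 f (fun z hz => by
        rw [hf ⟨z, hz⟩]; exact Subtype.property _) (fun x hx z hz => by
        rw [br_comm z x, map_neg, hbr ⟨z, hz⟩ ⟨x, hx⟩, br_comm (f x) z, neg_neg])
    refine ⟨e, Subtype.ext (end_ext hk2 fun z => ?_)⟩
    change centreAction hk2 e _ = _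
    rw [centreAction_skewEquiv, ← AddEquiv.eq_symm_apply]
    apply Subtype.ext
    rw [← hf z, he z.1 z.2]
    rfl

end Centroid

end Corestriction

namespace Corestriction

open CompositionAlgebraO

section Splitting

variable {Et : QuadraticEtale k} {C : CompositionAlgebraO Et.E}

/-- Data of a field `K` over `k` together with a pair of conjugate semilinear homomorphisms from
`C` to composition algebras over `K`, whose images span. -/
structure Splitting (C : CompositionAlgebraO Et.E) (K : Type u) [Field K] [Algebra k K]
    (D₁ D₂ : CompositionAlgebra K) where
  π : Et.E →ₐ[k] K
  ρ₁ : C.carrier →+ D₁.carrier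
  ρ₂ : C.carrier →+ D₂.carrier
  smul₁ : ∀ e x, ρ₁ (e • x) = π e • ρ₁ x
  smul₂ : ∀ e x, ρ₂ (e • x) = π (Et.iota e) • ρ₂ x
  mul₁ : ∀ x y, ρ₁ (x * y) = ρ₁ x * ρ₁ y
  mul₂ : ∀ x y, ρ₂ (x * y) = ρ₂ x * ρ₂ y
  one₁ : ρ₁ 1 = 1
  one₂ : ρ₂ 1 = 1
  conj₁ : ∀ x, ρ₁ (C.conj x) = D₁.conj (ρ₁ x)
  conj₂ : ∀ x, ρ₂ (C.conj x) = D₂.conj (ρ₂ x)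
  span₁ : Submodule.span K (Set.range ρ₁) = ⊤
  span₂ : Submodule.span K (Set.range ρ₂) = ⊤

namespace Splitting

variable {K : Type u} [Field K] [Algebra k K] {D₁ D₂ : CompositionAlgebra K}
  (S : Splitting C K D₁ D₂)

/-- The map `^ιx ⊗ y ↦ ρ₁ y ⊗ ρ₂ x`. -/
noncomputable def ambHom : Amb Et C →+ D₁.carrier ⊗[K] D₂.carrier :=
  TensorProduct.liftAddHom
    (AddMonoidHom.mk'
      (fun x => AddMonoidHom.mk' (fun y => S.ρ₁ y ⊗ₜ[K] S.ρ₂ x.unConj)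
        (fun y y' => by simp only [map_add, TensorProduct.add_tmul]))
      (fun x x' => by
        ext y
        change S.ρ₁ y ⊗ₜ[K] S.ρ₂ (x.unConj + x'.unConj) = _
        simp only [map_add, TensorProduct.tmul_add]
        rfl))
    (fun e x y => by
      change S.ρ₁ y ⊗ₜ[K] S.ρ₂ (Et.iota e • x.unConj) = S.ρ₁ (e • y) ⊗ₜ[K] S.ρ₂ x.unConj
      rw [S.smul₁, S.smul₂, Et.iota_iota, TensorProduct.smul_tmul])

theorem ambHom_tmul (x : ConjAlg Et C) (y : C.carrier) :
    S.ambHom (x ⊗ₜ y) = S.ρ₁ y ⊗ₜ[K] S.ρ₂ x.unConj := rfl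

theorem ambHom_smul (e : Et.E) (t : Amb Et C) : S.ambHom (e • t) = S.π e • S.ambHom t := by
  induction t using TensorProduct.induction_on with
  | zero => simp
  | tmul x y =>
    rw [← TensorProduct.tmul_smul, ambHom_tmul, ambHom_tmul, S.smul₁, TensorProduct.smul_tmul']
  | add a b ha hb => rw [smul_add, map_add, ha, hb, map_add, smul_add]

theorem ambHom_ksmul (c : k) (t : Amb Et C) :
    S.ambHom (c • t) = algebraMap k K c • S.ambHom t := by
  rw [ksmul_def, ambHom_smul, AlgHom.commutes]

theorem ambHom_one : S.ambHom 1 = 1 := by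
  rw [Algebra.TensorProduct.one_def, ambHom_tmul, S.one₁, ConjAlg.unConj_one, S.one₂]
  rfl

theorem ambHom_mul (s t : Amb Et C) : S.ambHom (s * t) = S.ambHom s * S.ambHom t := by
  induction s using TensorProduct.induction_on with
  | zero => simp
  | tmul x y =>
    induction t using TensorProduct.induction_on with
    | zero => simp
    | tmul x' y' =>
      rw [Algebra.TensorProduct.tmul_mul_tmul, ambHom_tmul, ambHom_tmul, ambHom_tmul,
        Algebra.TensorProduct.tmul_mul_tmul, S.mul₁, ConjAlg.unConj_mul, S.mul₂]
    | add a b ha hb => rw [mul_add, map_add, ha, hb, map_add, mul_add]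
  | add a b ha hb => rw [add_mul, map_add, ha, hb, map_add, add_mul]

theorem ambHom_invol (t : Amb Et C) :
    S.ambHom (involAux Et C t) = TensorProduct.map D₁.conj D₂.conj (S.ambHom t) := by
  induction t using TensorProduct.induction_on with
  | zero => simp
  | tmul x y =>
    rw [involAux_tmul, ambHom_tmul, ambHom_tmul, TensorProduct.map_tmul, S.conj₁, ← S.conj₂]
    rfl
  | add a b ha hb => rw [map_add, map_add, ha, hb, map_add, map_add]

/-- The additive map underlying `lin`. -/
noncomputable def linAux : K ⊗[k] corSubmodule Et C →+ D₁.carrier ⊗[K] D₂.carrier :=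
  TensorProduct.liftAddHom (R := k)
    (AddMonoidHom.mk'
      (fun s => AddMonoidHom.mk' (fun t : corSubmodule Et C => s • S.ambHom t.1)
        (fun t t' => by
          rw [Submodule.coe_add, map_add, smul_add]))
      (fun s s' => by
        apply AddMonoidHom.ext
        intro t
        exact add_smul _ _ _))
    (fun c s t => by
      change (c • s) • S.ambHom t.1 = s • S.ambHom (c • t.1)
      rw [ambHom_ksmul, Algebra.smul_def, mul_comm, mul_smul])

theorem linAux_tmul (s : K) (t : corSubmodule Et C) :
    S.linAux (s ⊗ₜ t) = s • S.ambHom t.1 := rfl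

/-- The `K`-linear extension of `ambHom` from the corestriction. -/
noncomputable def lin : K ⊗[k] corSubmodule Et C →ₗ[K] D₁.carrier ⊗[K] D₂.carrier :=
  { S.linAux with
    map_smul' := fun s t => by
      change S.linAux (s • t) = s • S.linAux t
      induction t using TensorProduct.induction_on with
      | zero => rw [smul_zero, map_zero, smul_zero]
      | tmul x y => rw [TensorProduct.smul_tmul', linAux_tmul, linAux_tmul, smul_eq_mul, mul_smul]
      | add a b ha hb => rw [smul_add, map_add, ha, hb, map_add, smul_add] }

theorem lin_tmul (s : K) (t : corSubmodule Et C) :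
    S.lin (s ⊗ₜ t) = s • S.ambHom t.1 := rfl

theorem lin_mul (x y : K ⊗[k] corSubmodule Et C) : S.lin (x * y) = S.lin x * S.lin y := by
  induction x using TensorProduct.induction_on with
  | zero => simp
  | add a b ha hb => rw [add_mul, map_add, ha, hb, map_add, add_mul]
  | tmul s x =>
    induction y using TensorProduct.induction_on with
    | zero => simp
    | add a b ha hb => rw [mul_add, map_add, ha, hb, map_add, mul_add]
    | tmul s' y =>
      rw [Algebra.TensorProduct.tmul_mul_tmul, lin_tmul, lin_tmul, lin_tmul, smul_mul_smul_comm,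
        ← ambHom_mul]
      rfl

theorem lin_one : S.lin 1 = 1 := by
  rw [Algebra.TensorProduct.one_def, lin_tmul, one_smul]
  exact S.ambHom_one

theorem lin_invol (j : corSubmodule Et C →ₗ[k] corSubmodule Et C)
    (hj : ∀ t, (j t).1 = involAux Et C t.1) (x : K ⊗[k] corSubmodule Et C) :
    S.lin (LinearMap.baseChange K j x) = TensorProduct.map D₁.conj D₂.conj (S.lin x) := by
  induction x using TensorProduct.induction_on with
  | zero => rw [map_zero, map_zero, map_zero]
  | add a b ha hb => rw [map_add, map_add, ha, hb, map_add, map_add]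
  | tmul s x => rw [LinearMap.baseChange_tmul, lin_tmul, lin_tmul, map_smul, hj, ← ambHom_invol]

theorem range_lin (hk2 : (2 : k) ≠ 0) : LinearMap.range S.lin = ⊤ := by
  obtain ⟨δ, d, hδ, hd, hδd⟩ := Et.exists_generator
  have hπ : S.π δ ≠ 0 := ((isUnit_delta hd hδd).map S.π).ne_zero
  have h2 : (2 : K) ≠ 0 := by
    have := (map_ne_zero (algebraMap k K)).2 hk2
    rwa [map_ofNat] at this
  have hmem : ∀ t : Amb Et C, S.ambHom (t + switchAux Et C t) ∈ LinearMap.range S.lin := fun t =>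
    ⟨1 ⊗ₜ (⟨_, add_switch_mem t⟩ : corSubmodule Et C), by
      rw [lin_tmul, one_smul]⟩
  have key : ∀ x y, S.ρ₁ x ⊗ₜ[K] S.ρ₂ y ∈ LinearMap.range S.lin := by
    intro x y
    have ha := hmem (ConjAlg.ofConj y ⊗ₜ x)
    have hb := hmem (ConjAlg.ofConj y ⊗ₜ (δ • x))
    rw [switchAux_tmul, map_add, ambHom_tmul, ambHom_tmul] at ha hb
    simp only [S.smul₁, S.smul₂, hδ, map_neg] at hb
    have hc := add_mem (Submodule.smul_mem _ (S.π δ) ha) hb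
    have he : S.π δ • (S.ρ₁ x ⊗ₜ[K] S.ρ₂ y + S.ρ₁ y ⊗ₜ[K] S.ρ₂ x) +
        ((S.π δ • S.ρ₁ x) ⊗ₜ[K] S.ρ₂ y + S.ρ₁ y ⊗ₜ[K] (-S.π δ • S.ρ₂ x)) =
        (2 * S.π δ) • (S.ρ₁ x ⊗ₜ[K] S.ρ₂ y) := by
      rw [TensorProduct.tmul_smul, ← TensorProduct.smul_tmul']
      module
    exact (Submodule.smul_mem_iff _ (mul_ne_zero h2 hπ)).1 (he ▸ hc)
  rw [eq_top_iff]
  rintro t -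
  induction t using TensorProduct.induction_on with
  | zero => exact zero_mem _
  | add a b ha hb => exact add_mem ha hb
  | tmul a b =>
    have ha : a ∈ Submodule.span K (Set.range S.ρ₁) := S.span₁ ▸ Submodule.mem_top
    have hb : b ∈ Submodule.span K (Set.range S.ρ₂) := S.span₂ ▸ Submodule.mem_top
    induction ha using Submodule.span_induction with
    | zero => rw [TensorProduct.zero_tmul]; exact zero_mem _
    | add u v _ _ hu hv => rw [TensorProduct.add_tmul]; exact add_mem hu hv
    | smul c u _ hu => rw [← TensorProduct.smul_tmul']; exact Submodule.smul_mem _ _ hu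
    | mem u hu =>
      obtain ⟨x, rfl⟩ := hu
      induction hb using Submodule.span_induction with
      | zero => rw [TensorProduct.tmul_zero]; exact zero_mem _
      | add u v _ _ hu hv => rw [TensorProduct.tmul_add]; exact add_mem hu hv
      | smul c u _ hu => rw [TensorProduct.tmul_smul]; exact Submodule.smul_mem _ _ hu
      | mem u hu =>
        obtain ⟨y, rfl⟩ := hu
        exact key x y

theorem finite_cor (hk2 : (2 : k) ≠ 0) {m : ℕ} (hm : m ≠ 0)
    (hC : Module.finrank Et.E C.carrier = m) : Module.Finite k (corSubmodule Et C) :=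
  Module.finite_of_finrank_pos (by rw [finrank_cor hk2 hC]; positivity)

theorem bijective_lin (hk2 : (2 : k) ≠ 0) {m : ℕ} (hm : m ≠ 0)
    (hC : Module.finrank Et.E C.carrier = m) (h₁ : Module.finrank K D₁.carrier = m)
    (h₂ : Module.finrank K D₂.carrier = m) : Function.Bijective S.lin := by
  have : Module.Finite k (corSubmodule Et C) := finite_cor hk2 hm hC
  have hs : Function.Surjective S.lin := LinearMap.range_eq_top.1 (S.range_lin hk2)
  refine ⟨(LinearMap.injective_iff_surjective_of_finrank_eq_finrank ?_).2 hs, hs⟩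
  rw [Module.finrank_baseChange, Module.finrank_tensorProduct, h₁, h₂, finrank_cor hk2 hC, sq]

/-- The isomorphism over `K` of the corestriction with the tensor product. -/
noncomputable def iso (hk2 : (2 : k) ≠ 0) {m : ℕ} (hm : m ≠ 0)
    (hC : Module.finrank Et.E C.carrier = m) (h₁ : Module.finrank K D₁.carrier = m)
    (h₂ : Module.finrank K D₂.carrier = m) :
    ((corestriction Et C).baseChange K).Iso (D₁.toAWI.tensor D₂.toAWI) :=
  AlgebraWithInvolution.Iso.mk
    (LinearEquiv.ofBijective S.lin (S.bijective_lin hk2 hm hC h₁ h₂))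
    S.lin_mul S.lin_one (S.lin_invol _ fun _ => rfl)

include S in
theorem isProductAlgebra (hk2 : (2 : k) ≠ 0) {m : ℕ} (hm : m ≠ 0)
    (hC : Module.finrank Et.E C.carrier = m) (h₁ : Module.finrank K D₁.carrier = m)
    (h₂ : Module.finrank K D₂.carrier = m) : IsProductAlgebra (corestriction Et C) m m :=
  ⟨⟨K, D₁, D₂, h₁, h₂, S.iso hk2 hm hC h₁ h₂⟩⟩

end Splitting

/-- Composition of isomorphisms of algebras with involution. -/
def isoTrans {R : Type u} [CommRing R] {A B D : AlgebraWithInvolution R} (F : A.Iso B)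
    (G : B.Iso D) : A.Iso D where
  toLinearEquiv := F.toLinearEquiv.trans G.toLinearEquiv
  map_mul x y := by simp [F.map_mul, G.map_mul]
  map_one := by simp [F.map_one, G.map_one]
  map_invol x := by simp [F.map_invol, G.map_invol]

/-- An algebra with involution is isomorphic to its trivial base change. -/
noncomputable def isoBaseChangeSelf (A : AlgebraWithInvolution k) : A.Iso (A.baseChange k) where
  toLinearEquiv := (TensorProduct.lid k A.carrier).symm
  map_mul x y := by
    refine Eq.trans ?_ (Algebra.TensorProduct.tmul_mul_tmul (1 : k) (1 : k) x y).symm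
    rw [one_mul]
    rfl
  map_one := rfl
  map_invol x := rfl

end Splitting

end Corestriction

namespace CompositionAlgebraO

open QuadraticMap

variable {F : Type u} [CommRing F]

/-- The fibre of a composition algebra over a ring at a field which is a direct factor. -/
theorem exists_fibre (C : CompositionAlgebraO F) (h2 : IsUnit (2 : F)) {K : Type u} [Field K]
    (π : F →+* K) (hπ : Function.Surjective π) {f : F} (hf : π f = 1)
    (hker : ∀ a, π a = 0 → f * a = 0) :
    ∃ (D : CompositionAlgebra K) (ρ : C.carrier →+ D.carrier),
      Module.finrank K D.carrier = Module.finrank F C.carrier ∧ Function.Surjective ρ ∧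
      (∀ e x, ρ (e • x) = π e • ρ x) ∧ (∀ x y, ρ (x * y) = ρ x * ρ y) ∧ ρ 1 = 1 ∧
      ∀ x, ρ (C.conj x) = D.conj (ρ x) := by
  have := π.domain_nontrivial
  let : Algebra F K := π.toAlgebra
  let : Invertible (2 : F) := h2.invertible
  let : Invertible (2 : K) := invertibleOfNonzero (by
    have := (h2.map π).ne_zero
    rwa [map_ofNat] at this)
  have hsm : ∀ (e : F) (x : C.carrier),
      (1 : K) ⊗ₜ[F] (e • x) = π e • ((1 : K) ⊗ₜ[F] x) := by
    intro e x
    rw [TensorProduct.tmul_smul, algebra_compatible_smul K e]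
    rfl
  have hs : ∀ t : K ⊗[F] C.carrier, ∃ x : C.carrier, t = 1 ⊗ₜ x := by
    intro t
    induction t using TensorProduct.induction_on with
    | zero => exact ⟨0, by simp⟩
    | tmul a x =>
      obtain ⟨b, rfl⟩ := hπ a
      refine ⟨b • x, ?_⟩
      rw [hsm, TensorProduct.smul_tmul', smul_eq_mul, mul_one]
    | add a b ha hb =>
      obtain ⟨x, rfl⟩ := ha
      obtain ⟨y, rfl⟩ := hb
      exact ⟨x + y, by rw [TensorProduct.tmul_add]⟩
  have hmul : ∀ x y : C.carrier,
      ((1 : K) ⊗ₜ[F] x) * (1 ⊗ₜ y) = (1 : K) ⊗ₜ[F] (x * y) := by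
    intro x y
    rw [Algebra.TensorProduct.tmul_mul_tmul, mul_one]
  have hn : ∀ x : C.carrier, QuadraticForm.baseChange K C.norm (1 ⊗ₜ x) = π (C.norm x) := by
    intro x
    rw [QuadraticForm.baseChange_tmul, mul_one, Algebra.smul_def, mul_one]
    rfl
  have hone : (1 : K ⊗[F] C.carrier) = 1 ⊗ₜ 1 := rfl
  have hconj : ∀ x : C.carrier,
      LinearMap.baseChange K C.conj (1 ⊗ₜ x) = 1 ⊗ₜ C.conj x := fun x => rfl
  refine ⟨{ carrier := K ⊗[F] C.carrier
            norm := QuadraticForm.baseChange K C.norm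
            norm_one := ?_
            norm_mul := ?_
            nondegenerate := ?_
            conj := LinearMap.baseChange K C.conj
            conj_def := ?_
            conj_one := ?_
            conj_mul := ?_
            conj_conj := ?_ },
    AddMonoidHom.mk' (fun x => (1 : K) ⊗ₜ[F] x) (fun x y => TensorProduct.tmul_add _ _ _),
    Module.finrank_baseChange, fun t => ?_, hsm, fun x y => (hmul x y).symm, rfl, fun x => rfl⟩
  · rw [hone, hn, C.norm_one, map_one]
  · intro x y
    obtain ⟨x, rfl⟩ := hs x
    obtain ⟨y, rfl⟩ := hs y
    rw [hmul, hn, hn, hn, C.norm_mul, map_mul]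
  · intro x hx
    obtain ⟨x, rfl⟩ := hs x
    have h : f • x = 0 := by
      refine C.nondegenerate _ fun y => ?_
      have h1 := hx (1 ⊗ₜ y)
      rw [← TensorProduct.tmul_add, hn, hn, hn, ← map_sub, ← map_sub] at h1
      have h3 := hker _ h1
      change f * polar C.norm x y = 0 at h3
      rw [← smul_eq_mul, ← polar_smul_left] at h3
      exact h3
    have h1 := hsm f x
    rw [h, hf, one_smul, TensorProduct.tmul_zero] at h1
    exact h1.symm
  · intro x
    obtain ⟨x, rfl⟩ := hs x
    rw [hconj, hone, ← TensorProduct.tmul_add, hn, hn, hn, ← map_sub, ← map_sub, ← hsm,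
      ← TensorProduct.tmul_sub, ← C.conj_def]
  · rw [hone, hconj, C.conj_one]
  · intro x y
    obtain ⟨x, rfl⟩ := hs x
    obtain ⟨y, rfl⟩ := hs y
    rw [hmul, hconj, hconj, hconj, hmul, C.conj_mul]
  · intro x
    obtain ⟨x, rfl⟩ := hs x
    rw [hconj, hconj, C.conj_conj]
  · obtain ⟨x, rfl⟩ := hs t
    exact ⟨x, rfl⟩

end CompositionAlgebraO

namespace Corestriction

open CompositionAlgebraO

/-- The corestriction of a composition algebra of rank `m` is an `(m, m)`-product algebra. -/
theorem isProductAlgebra_corestriction (hk2 : (2 : k) ≠ 0) {m : ℕ} (hm : m ≠ 0)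
    (Et : QuadraticEtale k) (C : CompositionAlgebraO Et.E)
    (hC : Module.finrank Et.E C.carrier = m) : IsProductAlgebra (corestriction Et C) m m := by
  obtain ⟨f, hff, hf0, hfu, -⟩ := Et.exists_idempotent hk2
  let I : Ideal Et.E := LinearMap.ker (LinearMap.mulLeft Et.E f)
  have hI : ∀ a, a ∈ I ↔ f * a = 0 := fun a => Iff.rfl
  have hf1 : f - 1 ∈ I := by rw [hI, mul_sub, hff, mul_one, sub_self]
  have hmax : I.IsMaximal := by
    refine Ideal.isMaximal_iff.2 ⟨by rwa [hI, mul_one], fun J x hIJ hx hxJ => ?_⟩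
    obtain ⟨b, hb⟩ := hfu x (by rwa [hI] at hx)
    have h1 : f ∈ J := hb ▸ J.mul_mem_right b hxJ
    have := sub_mem h1 (hIJ hf1)
    rwa [sub_sub_cancel] at this
  let : Field (Et.E ⧸ I) := Ideal.Quotient.field I
  let π : Et.E →ₐ[k] Et.E ⧸ I := Ideal.Quotient.mkₐ k I
  have hπ : Function.Surjective π := Ideal.Quotient.mk_surjective
  have hπf : π f = 1 := by
    rw [← sub_eq_zero, ← map_one π, ← map_sub]
    exact Ideal.Quotient.eq_zero_iff_mem.2 hf1
  have hker : ∀ a, π a = 0 → f * a = 0 := fun a ha => (hI a).1 (Ideal.Quotient.eq_zero_iff_mem.1 ha)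
  have h2 := Et.isUnit_two hk2
  obtain ⟨D₁, ρ₁, hD₁, hs₁, hsm₁, hm₁, ho₁, hc₁⟩ := C.exists_fibre h2 π.toRingHom hπ hπf hker
  obtain ⟨D₂, ρ₂, hD₂, hs₂, hsm₂, hm₂, ho₂, hc₂⟩ := C.exists_fibre h2
    (π.comp Et.iota.toAlgHom).toRingHom (hπ.comp Et.iota.surjective) (f := Et.iota f)
    (by change π (Et.iota (Et.iota f)) = 1; rwa [Et.iota_iota])
    (fun a ha => by
      have := congrArg Et.iota (hker _ ha)
      rw [map_mul, map_zero] at this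
      exact (congrArg _ (Et.iota_iota a)).symm.trans this)
  exact Splitting.isProductAlgebra (K := Et.E ⧸ I) (D₁ := D₁) (D₂ := D₂)
    { π := π, ρ₁ := ρ₁, ρ₂ := ρ₂, smul₁ := hsm₁, smul₂ := hsm₂, mul₁ := hm₁, mul₂ := hm₂
      one₁ := ho₁, one₂ := ho₂, conj₁ := hc₁, conj₂ := hc₂
      span₁ := by rw [hs₁.range_eq, Submodule.span_univ]
      span₂ := by rw [hs₂.range_eq, Submodule.span_univ] } hk2 hm hC (hD₁.trans hC) (hD₂.trans hC)

end Corestriction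

open QuadraticMap

section Split

variable {K : Type u} [Field K]

variable (K) in
/-- The split quadratic étale algebra `K × K`. -/
abbrev splitEtale : QuadraticEtale K where
  E := K × K
  finrank_eq := by rw [Module.finrank_prod, Module.finrank_self]
  reduced x hx := by
    rw [Prod.ext_iff] at hx
    exact Prod.ext (mul_self_eq_zero.1 hx.1) (mul_self_eq_zero.1 hx.2)
  iota := { RingEquiv.prodComm with commutes' := fun _ => rfl }
  iota_iota _ := rfl
  iota_ne := ⟨(1, 0), fun h => one_ne_zero (Prod.ext_iff.1 h).2⟩
  fixed x hx := ⟨x.1, Prod.ext rfl (Prod.ext_iff.1 hx).1⟩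

/-- The componentwise module structure on a product over a product of rings. -/
abbrev prodModule (K M N : Type*) [Field K] [AddCommGroup M] [AddCommGroup N] [Module K M]
    [Module K N] : Module (K × K) (M × N) where
  smul e x := (e.1 • x.1, e.2 • x.2)
  one_smul _ := Prod.ext (one_smul _ _) (one_smul _ _)
  mul_smul _ _ _ := Prod.ext (mul_smul _ _ _) (mul_smul _ _ _)
  smul_zero _ := Prod.ext (smul_zero _) (smul_zero _)
  smul_add _ _ _ := Prod.ext (smul_add _ _ _) (smul_add _ _ _)
  add_smul _ _ _ := Prod.ext (add_smul _ _ _) (add_smul _ _ _)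
  zero_smul _ := Prod.ext (zero_smul _ _) (zero_smul _ _)

attribute [local instance] prodModule

theorem prod_smul_def {M N : Type*} [AddCommGroup M] [AddCommGroup N] [Module K M]
    [Module K N] (e : K × K) (x : M × N) : e • x = (e.1 • x.1, e.2 • x.2) := rfl

/-- A product of spaces of equal dimension is free over `K × K`. -/
noncomputable def prodEquivFun {M N : Type*} [AddCommGroup M] [AddCommGroup N] [Module K M]
    [Module K N] {m : ℕ} (b : Module.Basis (Fin m) K M) (b' : Module.Basis (Fin m) K N) :
    (M × N) ≃ₗ[K × K] (Fin m → K × K) where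
  toFun x i := (b.repr x.1 i, b'.repr x.2 i)
  invFun c := (b.equivFun.symm fun i => (c i).1, b'.equivFun.symm fun i => (c i).2)
  map_add' x y := by ext i <;> simp
  map_smul' e x := by ext i <;> simp [prod_smul_def]
  left_inv x := by
    apply Prod.ext
    · exact b.equivFun.symm_apply_apply x.1
    · exact b'.equivFun.symm_apply_apply x.2
  right_inv c := by
    ext i
    · exact congrFun (b.equivFun.apply_symm_apply fun i => (c i).1) i
    · exact congrFun (b'.equivFun.apply_symm_apply fun i => (c i).2) i

/-- The componentwise quadratic map on a product. -/
def prodNorm {M N : Type*} [AddCommGroup M] [AddCommGroup N] [Module K M]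
    [Module K N] (n₁ : QuadraticForm K M) (n₂ : QuadraticForm K N) :
    QuadraticForm (K × K) (M × N) where
  toFun x := (n₁ x.1, n₂ x.2)
  toFun_smul e x := Prod.ext (n₁.map_smul _ _) (n₂.map_smul _ _)
  exists_companion' := ⟨LinearMap.mk₂ (K × K) (fun x y => (polar n₁ x.1 y.1, polar n₂ x.2 y.2))
      (fun x x' y => Prod.ext (polar_add_left _ _ _ _) (polar_add_left _ _ _ _))
      (fun e x y => Prod.ext (polar_smul_left _ _ _ _) (polar_smul_left _ _ _ _))
      (fun x x' y => Prod.ext (polar_add_right _ _ _ _) (polar_add_right _ _ _ _))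
      (fun e x y => Prod.ext (polar_smul_right _ _ _ _) (polar_smul_right _ _ _ _)),
    fun x y => Prod.ext (by simp [polar]) (by simp [polar])⟩

theorem CompositionAlgebra.nontrivial (D : CompositionAlgebra K) : Nontrivial D.carrier :=
  ⟨1, 0, fun h => one_ne_zero (α := K) (by rw [← D.norm_one, h, QuadraticMap.map_zero])⟩

theorem CompositionAlgebra.finrank_ne_zero (D : CompositionAlgebra K) :
    Module.finrank K D.carrier ≠ 0 :=
  have := D.nontrivial
  Module.finrank_pos.ne'

/-- The product of two composition algebras of the same dimension, over the split quadratic étale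
algebra. -/
noncomputable def prodComp (D₁ D₂ : CompositionAlgebra K) {m : ℕ}
    (h₁ : Module.finrank K D₁.carrier = m) (h₂ : Module.finrank K D₂.carrier = m) :
    CompositionAlgebraO (K × K) :=
  let b := Module.finBasisOfFinrankEq K D₁.carrier h₁
  let b' := Module.finBasisOfFinrankEq K D₂.carrier h₂
  { carrier := D₁.carrier × D₂.carrier
    isModule := prodModule K _ _
    isSMulCommClass := ⟨fun _ _ _ => Prod.ext (mul_smul_comm _ _ _).symm (mul_smul_comm _ _ _).symm⟩
    isScalarTower := ⟨fun _ _ _ => Prod.ext (smul_mul_assoc _ _ _) (smul_mul_assoc _ _ _)⟩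
    isFinite := Module.Finite.equiv (prodEquivFun b b').symm
    isFree := Module.Free.of_equiv (prodEquivFun b b').symm
    norm := prodNorm D₁.norm D₂.norm
    norm_one := Prod.ext D₁.norm_one D₂.norm_one
    norm_mul := fun _ _ => Prod.ext (D₁.norm_mul _ _) (D₂.norm_mul _ _)
    nondegenerate := fun _ hx => Prod.ext
      (D₁.nondegenerate _ fun y => congrArg Prod.fst (hx (y, 0)))
      (D₂.nondegenerate _ fun y => congrArg Prod.snd (hx (0, y)))
    conj :=
      { toFun := fun x => (D₁.conj x.1, D₂.conj x.2)
        map_add' := fun _ _ => Prod.ext (map_add _ _ _) (map_add _ _ _)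
        map_smul' := fun _ _ => Prod.ext (map_smul _ _ _) (map_smul _ _ _) }
    conj_def := fun _ => Prod.ext (D₁.conj_def _) (D₂.conj_def _)
    conj_one := Prod.ext D₁.conj_one D₂.conj_one
    conj_mul := fun _ _ => Prod.ext (D₁.conj_mul _ _) (D₂.conj_mul _ _)
    conj_conj := fun _ => Prod.ext (D₁.conj_conj _) (D₂.conj_conj _) }

variable (D₁ D₂ : CompositionAlgebra K) {m : ℕ}
    (h₁ : Module.finrank K D₁.carrier = m) (h₂ : Module.finrank K D₂.carrier = m)

theorem finrank_prodComp :
    Module.finrank (K × K) (prodComp D₁ D₂ h₁ h₂).carrier = m := by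
  have := (prodEquivFun (Module.finBasisOfFinrankEq K D₁.carrier h₁)
    (Module.finBasisOfFinrankEq K D₂.carrier h₂)).finrank_eq
  rw [Module.finrank_fin_fun] at this
  exact this

/-- The projections of a product, as splitting data. -/
noncomputable def splittingProdComp :
    Corestriction.Splitting (Et := splitEtale K) (prodComp D₁ D₂ h₁ h₂) K D₁ D₂ where
  π := AlgHom.fst K K K
  ρ₁ := AddMonoidHom.fst D₁.carrier D₂.carrier
  ρ₂ := AddMonoidHom.snd D₁.carrier D₂.carrier
  smul₁ := fun _ _ => rfl
  smul₂ := fun _ _ => rfl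
  mul₁ := fun _ _ => rfl
  mul₂ := fun _ _ => rfl
  one₁ := rfl
  one₂ := rfl
  conj₁ := fun _ => rfl
  conj₂ := fun _ => rfl
  span₁ := (congrArg _ Prod.fst_surjective.range_eq).trans Submodule.span_univ
  span₂ := (congrArg _ Prod.snd_surjective.range_eq).trans Submodule.span_univ

/-- The corestriction of a product is the tensor product. -/
noncomputable def isoProdComp (hK : (2 : K) ≠ 0) :
    (Corestriction.corestriction (splitEtale K) (prodComp D₁ D₂ h₁ h₂)).Iso
      (D₁.toAWI.tensor D₂.toAWI) :=
  Corestriction.isoTrans (Corestriction.isoBaseChangeSelf _)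
    ((splittingProdComp D₁ D₂ h₁ h₂).iso hK (h₁ ▸ D₁.finrank_ne_zero)
      (finrank_prodComp D₁ D₂ h₁ h₂) h₁ h₂)

theorem isoProdComp_symCor (hK : (2 : K) ≠ 0) (x : (prodComp D₁ D₂ h₁ h₂).carrier) :
    (isoProdComp D₁ D₂ h₁ h₂ hK).toLinearEquiv (Corestriction.symCor (Et := splitEtale K) x) =
      (1 : D₁.carrier) ⊗ₜ[K] Prod.snd (α := D₁.carrier) (β := D₂.carrier) x +
        Prod.fst (α := D₁.carrier) (β := D₂.carrier) x ⊗ₜ[K] (1 : D₂.carrier) := by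
  change (1 : K) • (splittingProdComp D₁ D₂ h₁ h₂).ambHom (Corestriction.symAmb x) = _
  rw [one_smul, Corestriction.symAmb_apply, map_add, Corestriction.Splitting.ambHom_tmul,
    Corestriction.Splitting.ambHom_tmul]
  rfl

end Split

/-- The corestriction of `C` decomposes if and only if `C` does. -/
theorem decomposable_iff (hk2 : (2 : k) ≠ 0) {m : ℕ} (hm : m = 4 ∨ m = 8) (Et : QuadraticEtale k)
    (C : CompositionAlgebraO Et.E) (hC : Module.finrank Et.E C.carrier = m)
    (D₁ D₂ : CompositionAlgebra k) (h₁ : Module.finrank k D₁.carrier = m)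
    (h₂ : Module.finrank k D₂.carrier = m) :
    Nonempty ((Corestriction.corestriction Et C).Iso (D₁.toAWI.tensor D₂.toAWI)) ↔
      ∃ e : C.carrier ≃+ (D₁.carrier × D₂.carrier),
        (∀ x y : C.carrier, e (x * y) = e x * e y) ∧ e 1 = 1 ∧
        (∀ (c : k) (x : C.carrier), e (algebraMap k Et.E c • x) = c • e x) := by
  let G := isoProdComp D₁ D₂ h₁ h₂ hk2
  have hD := finrank_prodComp D₁ D₂ h₁ h₂
  constructor
  · rintro ⟨F⟩
    obtain ⟨g, -⟩ := Corestriction.exists_kIso_of_iso hk2 hm hC hD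
      (Corestriction.isoTrans F (Corestriction.isoSymm G))
    exact ⟨g.toAddEquiv, g.map_mul, g.map_one, g.map_smul⟩
  · rintro ⟨e, hm1, h1, hs⟩
    obtain ⟨P⟩ := CompositionAlgebraO.nonempty_unitPair hk2 hm hC
    obtain ⟨P'⟩ := CompositionAlgebraO.nonempty_unitPair (Et := splitEtale k) hk2 hm hD
    obtain ⟨F, -⟩ := Corestriction.exists_iso hk2 P P' ⟨e, hm1, h1, hs⟩
    exact ⟨Corestriction.isoTrans F G⟩

open CompositionAlgebraO in
/-- A `k`-form `W` of the space of pure elements of a composition algebra over `K × K`, closed under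
the commutator product. -/
structure RationalForm (k : Type u) [Field k] {K : Type u} [Field K] [Algebra k K]
    (D : CompositionAlgebraO (K × K)) (W : Type u) [AddCommGroup W] [Module k W] where
  ad : W → Module.End k W
  Θ : K ⊗[k] W ≃+ D.pureSub
  map_smul : ∀ (c : K) (u : K ⊗[k] W), (Θ (c • u)).1 = ((c, c) : K × K) • (Θ u).1
  map_br : ∀ a b : W, br (Θ ((1 : K) ⊗ₜ[k] a)).1 (Θ ((1 : K) ⊗ₜ[k] b)).1 =
    (Θ ((1 : K) ⊗ₜ[k] ad a b)).1

namespace RationalForm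

open CompositionAlgebraO

section Basic

variable {K : Type u} [Field K] [Algebra k K] {D : CompositionAlgebraO (K × K)}
  {W : Type u} [AddCommGroup W] [Module k W] (S : RationalForm k D W)

/-- The inclusion of the `k`-form. -/
def w (a : W) : D.carrier := (S.Θ ((1 : K) ⊗ₜ[k] a)).1

theorem w_mem (a : W) : S.w a ∈ D.pureSub := (S.Θ _).2

theorem Θ_tmul (c : K) (a : W) :
    (S.Θ (c ⊗ₜ[k] a)).1 = ((c, c) : K × K) • S.w a := by
  rw [w, ← S.map_smul, TensorProduct.smul_tmul', smul_eq_mul, mul_one]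

theorem w_add (a b : W) : S.w (a + b) = S.w a + S.w b := by
  rw [w, TensorProduct.tmul_add, map_add]; rfl

theorem w_zero : S.w 0 = 0 := by
  rw [w, TensorProduct.tmul_zero, map_zero]; rfl

theorem w_smul (c : k) (a : W) :
    S.w (c • a) = ((algebraMap k K c, algebraMap k K c) : K × K) • S.w a := by
  rw [← Θ_tmul, w, TensorProduct.tmul_smul, TensorProduct.smul_tmul', Algebra.smul_def, mul_one]

theorem w_neg (a : W) : S.w (-a) = -S.w a := by
  rw [w, TensorProduct.tmul_neg, map_neg]; rfl

theorem br_w (a b : W) : br (S.w a) (S.w b) = S.w (S.ad a b) := S.map_br a b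

theorem w_injective : Function.Injective S.w := by
  intro a b h
  have h1 := S.Θ.injective (Subtype.ext h)
  have hinj := Module.Flat.rTensor_preserves_injective_linearMap (M := W)
    (Algebra.linearMap k K) (algebraMap k K).injective
  apply (TensorProduct.lid k W).symm.injective
  apply hinj
  simpa using h1

/-- The coefficient map attached to a functional on `K`. -/
noncomputable def coeff (l : K →ₗ[k] k) : D.pureSub →+ W :=
  ((TensorProduct.lid k W).toLinearMap ∘ₗ LinearMap.rTensor W l).toAddMonoidHom.comp
    S.Θ.symm.toAddMonoidHom

theorem coeff_Θ (l : K →ₗ[k] k) (u : K ⊗[k] W) :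
    S.coeff l (S.Θ u) = TensorProduct.lid k W (LinearMap.rTensor W l u) :=
  congrArg (fun v => TensorProduct.lid k W (LinearMap.rTensor W l v)) (S.Θ.symm_apply_apply u)

theorem coeff_tmul (l : K →ₗ[k] k) (c : K) (a : W) : S.coeff l (S.Θ (c ⊗ₜ[k] a)) = l c • a := by
  rw [coeff_Θ, LinearMap.rTensor_tmul, TensorProduct.lid_tmul]

theorem coeff_smul_w (l : K →ₗ[k] k) (c : K) (a : W)
    (h : ((c, c) : K × K) • S.w a ∈ D.pureSub) :
    S.coeff l ⟨((c, c) : K × K) • S.w a, h⟩ = l c • a := by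
  rw [← coeff_tmul]
  exact congrArg _ (Subtype.ext (S.Θ_tmul c a).symm)

theorem coeff_w (l : K →ₗ[k] k) (a : W) (h : S.w a ∈ D.pureSub) :
    S.coeff l ⟨S.w a, h⟩ = l 1 • a := S.coeff_tmul l 1 a

theorem coeff_ksmul (l : K →ₗ[k] k) (c : k) (z : D.pureSub) :
    S.coeff l (((algebraMap k K c, algebraMap k K c) : K × K) • z) =
      c • S.coeff l z := by
  obtain ⟨u, rfl⟩ := S.Θ.surjective z
  have : ((algebraMap k K c, algebraMap k K c) : K × K) • S.Θ u =
      S.Θ (c • u) := Subtype.ext <| by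
    rw [← algebraMap_smul K c u, S.map_smul]; rfl
  rw [this, coeff_Θ, coeff_Θ, _root_.map_smul, _root_.map_smul]

theorem pure_induction {p : D.carrier → Prop} (hw : ∀ a, p (S.w a))
    (h0 : p 0) (hadd : ∀ x ∈ D.pureSub, ∀ y ∈ D.pureSub, p x → p y → p (x + y))
    (hs : ∀ (c : K), ∀ x ∈ D.pureSub, p x → p (((c, c) : K × K) • x)) :
    ∀ x ∈ D.pureSub, p x := by
  intro x hx
  obtain ⟨u, hu⟩ := S.Θ.surjective ⟨x, hx⟩
  have : x = (S.Θ u).1 := by rw [hu]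
  rw [this]
  clear this hu hx x
  induction u with
  | zero => rw [map_zero]; exact h0
  | tmul c a => rw [Θ_tmul]; exact hs _ _ (S.w_mem a) (hw a)
  | add u v hu hv => rw [map_add]; exact hadd _ (S.Θ u).2 _ (S.Θ v).2 hu hv

theorem coeff_br (l : K →ₗ[k] k) (b : W) (z : D.carrier) (hz : z ∈ D.pureSub) :
    S.coeff l ⟨br (S.w b) z, br_mem _ _⟩ = S.ad b (S.coeff l ⟨z, hz⟩) := by
  obtain ⟨u, hu⟩ := S.Θ.surjective ⟨z, hz⟩
  obtain rfl : (S.Θ u).1 = z := by rw [hu]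
  clear hu
  have key : ∀ u, (⟨br (S.w b) (S.Θ u).1, br_mem _ _⟩ : D.pureSub) =
      S.Θ (LinearMap.lTensor K (S.ad b) u) := by
    intro u
    apply Subtype.ext
    change br (S.w b) (S.Θ u).1 = _
    induction u with
    | zero => rw [map_zero, map_zero, map_zero]; simp [br]
    | tmul c a => rw [Θ_tmul, br_smul, br_w, LinearMap.lTensor_tmul, Θ_tmul]
    | add u v hu hv =>
      rw [map_add, map_add, map_add]
      change br (S.w b) ((S.Θ u).1 + (S.Θ v).1) = (S.Θ _).1 + (S.Θ _).1
      rw [br_add, hu, hv]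
  rw [key]
  change _ = S.ad b (S.coeff l (S.Θ u))
  rw [coeff_Θ, coeff_Θ]
  clear hz
  induction u with
  | zero => simp
  | tmul c a => simp
  | add u v hu hv => simp only [map_add, hu, hv]

end Basic

end RationalForm

namespace RationalForm

open CompositionAlgebraO

section Centroid

variable {K : Type u} [Field K] [Algebra k K] {D : CompositionAlgebraO (K × K)}
  {W : Type u} [AddCommGroup W] [Module k W] (S : RationalForm k D W)

theorem ad_comm (a b : W) : S.ad a b = -S.ad b a := by
  apply S.w_injective
  rw [← br_w, w_neg, ← br_w, br_comm]

theorem isUnit_two (hK : (2 : K) ≠ 0) : IsUnit (2 : K × K) := (splitEtale K).isUnit_two hK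

/-- Endomorphisms of `W` commuting with the bracket are multiplications by scalars. -/
theorem exists_centroid (hK : (2 : K) ≠ 0) {m : ℕ} (hm : m = 4 ∨ m = 8)
    (hD : Module.finrank (K × K) D.carrier = m) (g : W →ₗ[k] W)
    (hg : ∀ a b, g (S.ad b a) = S.ad b (g a)) :
    ∃ e : K × K, ∀ a, S.w (g a) = e • S.w a := by
  obtain ⟨P⟩ := nonempty_unitPair (Et := splitEtale K) (C := D) hK hm hD
  have h2 := isUnit_two (K := K) hK
  let G : D.pureSub →+ D.pureSub := (S.Θ.toAddMonoidHom.comp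
    (LinearMap.lTensor K g).toAddMonoidHom).comp S.Θ.symm.toAddMonoidHom
  let p : D.carrier →+ D.pureSub :=
    ((D.pureProj h2).codRestrict D.pureSub (pureProj_mem h2)).toAddMonoidHom
  have hp : ∀ x (hx : x ∈ D.pureSub), p x = ⟨x, hx⟩ := fun x hx =>
    Subtype.ext (pureProj_of_mem h2 hx)
  have hG : ∀ u, G (S.Θ u) = S.Θ (LinearMap.lTensor K g u) := fun u =>
    congrArg (fun v => S.Θ (LinearMap.lTensor K g v)) (S.Θ.symm_apply_apply u)
  let φ : D.carrier →+ D.carrier := (D.pureSub.subtype.toAddMonoidHom.comp G).comp p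
  have hφ : ∀ u, φ (S.Θ u).1 = (S.Θ (LinearMap.lTensor K g u)).1 := fun u => by
    change (G (p (S.Θ u).1)).1 = _
    rw [hp _ (S.Θ u).2]
    exact congrArg Subtype.val (hG u)
  have hφw : ∀ a, φ (S.w a) = S.w (g a) := fun a => by
    rw [w, hφ, LinearMap.lTensor_tmul]; rfl
  have hφs : ∀ (c : K), ∀ x ∈ D.pureSub, φ (((c, c) : K × K) • x) = ((c, c) : K × K) • φ x := by
    intro c x hx
    obtain ⟨u, hu⟩ := S.Θ.surjective ⟨x, hx⟩
    obtain rfl : (S.Θ u).1 = x := by rw [hu]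
    rw [← S.map_smul, hφ, hφ, ← S.map_smul]
    exact congrArg (fun v => (S.Θ v).1) (LinearMap.map_smul (LinearMap.baseChange K g) c u)
  obtain ⟨e, he⟩ := P.exists_centroid hK φ (fun z _ => (G (p z)).2) (by
    intro x hx z hz
    refine S.pure_induction (p := fun x => φ (br x z) = br (φ x) z) ?_ ?_ ?_ ?_ x hx
    · intro a
      refine S.pure_induction (p := fun z => φ (br (S.w a) z) = br (φ (S.w a)) z) ?_ ?_ ?_ ?_ z hz
      · intro b
        rw [br_w, hφw, hφw, br_w, S.ad_comm a b, _root_.map_neg, hg, S.ad_comm _ b]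
      · simp [br]
      · intro x _ y _ hx hy
        rw [br_add, _root_.map_add, hx, hy, br_add]
      · intro c x hx h
        rw [br_smul, hφs _ _ (br_mem _ _), h, br_smul]
    · simp [br]
    · intro x _ y _ hx hy
      rw [add_br, _root_.map_add, hx, hy, _root_.map_add, add_br]
    · intro c x hx h
      rw [smul_br, hφs _ _ (br_mem _ _), h, hφs _ _ hx, smul_br])
  exact ⟨e, fun a => by rw [← hφw]; exact he _ (S.w_mem a)⟩

/-- The coefficient maps of multiplication by a scalar are multiplications by scalars. -/
theorem exists_coeff_smul (hK : (2 : K) ≠ 0) {m : ℕ} (hm : m = 4 ∨ m = 8)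
    (hD : Module.finrank (K × K) D.carrier = m) (l : K →ₗ[k] k) (e : K × K) :
    ∃ e' : K × K, ∀ a, S.w (S.coeff l ⟨e • S.w a, D.pureSub.smul_mem e (S.w_mem a)⟩) =
      e' • S.w a := by
  let g : W →ₗ[k] W :=
    { toFun := fun a => S.coeff l ⟨e • S.w a, D.pureSub.smul_mem e (S.w_mem a)⟩
      map_add' := fun a b => by
        rw [← _root_.map_add]
        congr 1
        exact Subtype.ext (show e • S.w (a + b) = e • S.w a + e • S.w b by rw [w_add, smul_add])
      map_smul' := fun c a => by
        rw [RingHom.id_apply, ← coeff_ksmul]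
        congr 1
        exact Subtype.ext (show e • S.w (c • a) =
          ((algebraMap k K c, algebraMap k K c) : K × K) • e • S.w a by rw [w_smul, smul_comm]) }
  refine S.exists_centroid hK hm hD g fun a b => ?_
  change S.coeff l _ = S.ad b (S.coeff l _)
  rw [← coeff_br]
  congr 1
  exact Subtype.ext (show e • S.w (S.ad b a) = br (S.w b) (e • S.w a) by rw [br_smul, br_w])

/-- The scalars preserving the `k`-form. -/
def scalars : Subalgebra k (K × K) where
  carrier := {e | ∀ a, ∃ b, e • S.w a = S.w b}
  mul_mem' := by
    intro e f he hf a
    obtain ⟨b, hb⟩ := hf a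
    obtain ⟨c, hc⟩ := he b
    exact ⟨c, by rw [mul_smul, hb, hc]⟩
  add_mem' := by
    intro e f he hf a
    obtain ⟨b, hb⟩ := hf a
    obtain ⟨c, hc⟩ := he a
    exact ⟨c + b, by rw [add_smul, hb, hc, w_add]⟩
  algebraMap_mem' := fun c a => ⟨c • a, (S.w_smul c a).symm⟩

theorem coeff_mem_scalars {l : K →ₗ[k] k} {e e' : K × K}
    (h : ∀ a, S.w (S.coeff l ⟨e • S.w a, D.pureSub.smul_mem e (S.w_mem a)⟩) = e' • S.w a) :
    e' ∈ S.scalars := fun a => ⟨_, (h a).symm⟩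

theorem eq_of_smul_w (hK : (2 : K) ≠ 0) {m : ℕ} (hm : m = 4 ∨ m = 8)
    (hD : Module.finrank (K × K) D.carrier = m) {e e' : K × K}
    (h : ∀ a, e • S.w a = e' • S.w a) : e = e' := by
  refine eq_of_smul_pure (Et := splitEtale K) (C := D) hK hm hD fun z hz => ?_
  refine S.pure_induction (p := fun z => e • z = e' • z) h ?_ ?_ ?_ z hz
  · rw [smul_zero, smul_zero]
  · intro x _ y _ hx hy
    rw [smul_add, smul_add, hx, hy]
  · intro c x _ hx
    rw [smul_comm, hx, smul_comm]

end Centroid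

end RationalForm

theorem exists_unital_functional (k K : Type*) [Field k] [Field K] [Algebra k K] :
    ∃ l : K →ₗ[k] k, l 1 = 1 := by
  obtain ⟨l, hl⟩ := (Algebra.linearMap k K).exists_leftInverse_of_injective
    (LinearMap.ker_eq_bot.2 (algebraMap k K).injective)
  exact ⟨l, by simpa using LinearMap.congr_fun hl 1⟩

theorem tmul_ext_functional {k K W : Type*} [Field k] [Field K] [Algebra k K] [AddCommGroup W]
    [Module k W] {u v : K ⊗[k] W} (h : ∀ l : K →ₗ[k] k,
      TensorProduct.lid k W (LinearMap.rTensor W l u) =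
        TensorProduct.lid k W (LinearMap.rTensor W l v)) : u = v := by
  classical
  let b := Module.Basis.ofVectorSpace k K
  apply (TensorProduct.equivFinsuppOfBasisLeft (N := W) b).injective
  ext i
  rw [TensorProduct.equivFinsuppOfBasisLeft_apply, TensorProduct.equivFinsuppOfBasisLeft_apply]
  exact h _

namespace RationalForm

open CompositionAlgebraO QuadraticMap

section Scalars

variable {K : Type u} [Field K] [Algebra k K] {D : CompositionAlgebraO (K × K)}
  {W : Type u} [AddCommGroup W] [Module k W] (S : RationalForm k D W)
  (hk2 : (2 : k) ≠ 0) {m : ℕ} (hm : m = 4 ∨ m = 8)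
  (hD : Module.finrank (K × K) D.carrier = m)

include hk2 in
theorem two_ne_zero_of_algebra : (2 : K) ≠ 0 := by
  rw [← map_ofNat (algebraMap k K) 2]
  exact (map_ne_zero _).2 hk2

theorem eq_zero_of_diag_smul {c : K} {a : W} (ha : a ≠ 0)
    (h : ((c, c) : K × K) • S.w a = 0) : c = 0 := by
  by_contra hc
  apply ha
  apply S.w_injective
  rw [w_zero, ← one_smul (K × K) (S.w a),
    show (1 : K × K) = (c⁻¹, c⁻¹) * (c, c) from Prod.ext (inv_mul_cancel₀ hc).symm
      (inv_mul_cancel₀ hc).symm, mul_smul, h, smul_zero]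

include hk2 hm hD

include S in
theorem exists_ne_zero : ∃ a : W, a ≠ 0 := by
  by_contra! h
  have := S.eq_of_smul_w (two_ne_zero_of_algebra hk2) hm hD (e := 0) (e' := 1) fun a => by
    rw [h a, w_zero, smul_zero, smul_zero]
  exact zero_ne_one (Prod.ext_iff.1 this).1

theorem mem_range_of_diag_mem {c : K} (h : ((c, c) : K × K) ∈ S.scalars) :
    ∃ r : k, c = algebraMap k K r := by
  obtain ⟨l, hl⟩ := exists_unital_functional k K
  obtain ⟨a, ha⟩ := S.exists_ne_zero hk2 hm hD
  obtain ⟨b, hb⟩ := h a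
  have h1 := S.coeff_smul_w l c a (D.pureSub.smul_mem _ (S.w_mem a))
  have h2 := S.coeff_w l b (S.w_mem b)
  have h3 : l c • a = b := by
    rw [← h1, ← one_smul k b, ← hl, ← h2]
    exact congrArg _ (Subtype.ext hb)
  refine ⟨l c, sub_eq_zero.1 (S.eq_zero_of_diag_smul ha ?_)⟩
  rw [show ((c - algebraMap k K (l c), c - algebraMap k K (l c)) : K × K) =
    (c, c) - (algebraMap k K (l c), algebraMap k K (l c)) from rfl, sub_smul, hb, ← w_smul, h3,
    sub_self]

theorem exists_not_diag : ∃ t ∈ S.scalars, t.1 ≠ t.2 := by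
  by_contra! hcon
  have hK := two_ne_zero_of_algebra (K := K) hk2
  obtain ⟨a₀, ha₀⟩ := S.exists_ne_zero hk2 hm hD
  obtain ⟨f, hf⟩ := Module.Projective.exists_dual_eq_one k ha₀
  let e : K × K := (1, 0)
  have hc : ∀ l : K →ₗ[k] k, ∃ r : k, ∀ a,
      S.coeff l ⟨e • S.w a, D.pureSub.smul_mem e (S.w_mem a)⟩ = r • a := by
    intro l
    obtain ⟨e', he'⟩ := S.exists_coeff_smul hK hm hD l e
    have hmem := S.coeff_mem_scalars he'
    obtain ⟨c, c'⟩ := e'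
    obtain rfl : c = c' := hcon _ hmem
    obtain ⟨r, rfl⟩ := S.mem_range_of_diag_mem hk2 hm hD hmem
    refine ⟨r, fun a => S.w_injective ?_⟩
    rw [he', w_smul]
  choose r hr using hc
  let μ : K := TensorProduct.rid k K (LinearMap.lTensor K f
    (S.Θ.symm ⟨e • S.w a₀, D.pureSub.smul_mem e (S.w_mem a₀)⟩))
  have hcomm : ∀ (l : K →ₗ[k] k) (u : K ⊗[k] W),
      l (TensorProduct.rid k K (LinearMap.lTensor K f u)) =
        f (TensorProduct.lid k W (LinearMap.rTensor W l u)) := by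
    intro l u
    induction u with
    | zero => simp
    | tmul c a => simp [mul_comm]
    | add u v hu hv => simp only [_root_.map_add, hu, hv]
  have hμ : ∀ l : K →ₗ[k] k, l μ = r l := by
    intro l
    rw [hcomm]
    change f (S.coeff l ⟨e • S.w a₀, _⟩) = _
    rw [hr, _root_.map_smul, hf, smul_eq_mul, mul_one]
  have key : ∀ a, e • S.w a = ((μ, μ) : K × K) • S.w a := by
    intro a
    rw [← Θ_tmul]
    suffices h : (⟨e • S.w a, D.pureSub.smul_mem e (S.w_mem a)⟩ : D.pureSub) = S.Θ (μ ⊗ₜ a) from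
      congrArg Subtype.val h
    rw [← S.Θ.symm_apply_eq]
    apply tmul_ext_functional
    intro l
    rw [LinearMap.rTensor_tmul, TensorProduct.lid_tmul, hμ, ← hr]
    rfl
  have := S.eq_of_smul_w hK hm hD key
  have h1 : (1 : K) = μ := (Prod.ext_iff.1 this).1
  have h2 : (0 : K) = μ := (Prod.ext_iff.1 this).2
  exact one_ne_zero (h1.trans h2.symm)

theorem exists_coords {t : K × K} (ht : t ∈ S.scalars) (hne : t.1 ≠ t.2) {e : K × K}
    (he : e ∈ S.scalars) : ∃ α β : k, e = algebraMap k (K × K) α + algebraMap k (K × K) β * t := by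
  obtain ⟨l, hl⟩ := exists_unital_functional k K
  have hd := sub_ne_zero.2 hne
  let β : K := (e.1 - e.2) / (t.1 - t.2)
  let α : K := e.1 - β * t.1
  have hβ : β * (t.1 - t.2) = e.1 - e.2 := div_mul_cancel₀ _ hd
  have hαβ : e = ((α, α) : K × K) + (β, β) * t :=
    Prod.ext (show e.1 = α + β * t.1 by simp only [α]; ring)
      (show e.2 = α + β * t.2 by simp only [α]; linear_combination hβ)
  refine ⟨l α, l β, S.eq_of_smul_w (two_ne_zero_of_algebra hk2) hm hD fun a => ?_⟩
  obtain ⟨b, hb⟩ := he a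
  obtain ⟨c, hc⟩ := ht a
  have hb' : b = l α • a + l β • c := by
    have h2 := S.coeff_w l b (S.w_mem b)
    rw [hl, one_smul] at h2
    rw [← h2, ← S.coeff_smul_w l α a (D.pureSub.smul_mem _ (S.w_mem a)),
      ← S.coeff_smul_w l β c (D.pureSub.smul_mem _ (S.w_mem c)), ← _root_.map_add]
    refine congrArg _ (Subtype.ext ?_)
    change S.w b = ((α, α) : K × K) • S.w a + ((β, β) : K × K) • S.w c
    rw [← hb, ← hc, smul_smul, ← add_smul, ← hαβ]
  rw [hb, hb', w_add, w_smul, w_smul, ← hc, add_smul, mul_smul]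
  rfl

theorem exists_delta : ∃ d : K, d ≠ 0 ∧ ((d, -d) : K × K) ∈ S.scalars := by
  obtain ⟨t, ht, hne⟩ := S.exists_not_diag hk2 hm hD
  obtain ⟨α, β, h⟩ := S.exists_coords hk2 hm hD ht hne (mul_mem ht ht)
  have h1 : t.1 * t.1 = algebraMap k K α + algebraMap k K β * t.1 := (Prod.ext_iff.1 h).1
  have h2 : t.2 * t.2 = algebraMap k K α + algebraMap k K β * t.2 := (Prod.ext_iff.1 h).2
  have hβ : algebraMap k K β = t.1 + t.2 :=
    mul_right_cancel₀ (sub_ne_zero.2 hne) (by linear_combination h2 - h1)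
  refine ⟨t.1 - t.2, sub_ne_zero.2 hne, ?_⟩
  have := sub_mem (add_mem ht ht) (S.scalars.algebraMap_mem β)
  convert this using 1
  exact Prod.ext (show t.1 - t.2 = t.1 + t.1 - algebraMap k K β by rw [hβ]; ring)
    (show -(t.1 - t.2) = t.2 + t.2 - algebraMap k K β by rw [hβ]; ring)

theorem norm_mem (a : W) : D.norm (S.w a) ∈ S.scalars := by
  have hK := two_ne_zero_of_algebra (K := K) hk2
  obtain ⟨l, hl⟩ := exists_unital_functional k K
  set N : K × K := 4 * D.norm (S.w a) with hN
  obtain ⟨N', hN'⟩ := S.exists_coeff_smul hK hm hD l N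
  have hmem := S.coeff_mem_scalars hN'
  have key : ∀ b, ∃ β : K × K, (N - N') • S.w b = β • S.w a := by
    intro b
    set p : K × K := 2 * polar D.norm (S.w a) (S.w b) with hp
    obtain ⟨p', hp'⟩ := S.exists_coeff_smul hK hm hD l p
    refine ⟨p - p', ?_⟩
    have h1 := br_br_of_mem (S.w_mem a) (S.w_mem b)
    rw [br_w, br_w, ← hN, ← hp] at h1
    have h2 : S.ad a (S.ad a b) =
        -S.coeff l ⟨N • S.w b, D.pureSub.smul_mem N (S.w_mem b)⟩ +
          S.coeff l ⟨p • S.w a, D.pureSub.smul_mem p (S.w_mem a)⟩ := by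
      have h3 := S.coeff_w l (S.ad a (S.ad a b)) (S.w_mem _)
      rw [hl, one_smul] at h3
      rw [← h3, ← _root_.map_neg, ← _root_.map_add]
      exact congrArg _ (Subtype.ext h1)
    have h4 := congrArg S.w h2
    rw [w_add, w_neg, hN', hp', h1] at h4
    rw [sub_smul, sub_smul]
    rw [eq_neg_add_iff_add_eq, ← sub_eq_zero] at h4
    rw [← sub_eq_zero, ← neg_eq_zero, ← h4]
    abel
  have hN0 : N - N' = 0 := by
    refine eq_zero_of_forall_pure (Et := splitEtale K) (C := D) (v := S.w a) hK hm hD ?_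
    refine S.pure_induction (p := fun z => ∃ β : K × K, (N - N') • z = β • S.w a) key ?_ ?_ ?_
    · exact ⟨0, by rw [smul_zero, zero_smul]⟩
    · rintro x _ y _ ⟨β, h⟩ ⟨β', h'⟩
      exact ⟨β + β', by rw [smul_add, h, h', add_smul]⟩
    · rintro c x _ ⟨β, h⟩
      exact ⟨(c, c) * β, by rw [smul_comm, h, mul_smul]⟩
  rw [← sub_eq_zero.1 hN0] at hmem
  have := S.scalars.smul_mem hmem (4 : k)⁻¹
  have h4 : (4 : k) ≠ 0 := by
    rw [show (4 : k) = 2 * 2 by norm_num]; exact mul_ne_zero hk2 hk2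
  rwa [Algebra.smul_def, hN, ← mul_assoc, ← map_ofNat (algebraMap k (K × K)) 4, ← map_mul,
    inv_mul_cancel₀ h4, map_one, one_mul] at this

theorem polar_mem (a b : W) : polar D.norm (S.w a) (S.w b) ∈ S.scalars := by
  rw [polar, ← w_add]
  exact sub_mem (sub_mem (S.norm_mem hk2 hm hD _) (S.norm_mem hk2 hm hD _))
    (S.norm_mem hk2 hm hD _)

end Scalars

end RationalForm

section FreeDescent

open Submodule in
theorem exists_notMem_span_of_finrank_lt {K V A : Type*} [Field K] [AddCommGroup V] [Module K V]
    (p : A → V) (hs : span K (Set.range p) = ⊤) {n : ℕ} (h : n < Module.finrank K V)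
    (v : Fin n → V) : ∃ a, p a ∉ span K (Set.range v) := by
  by_contra! hcon
  have htop : span K (Set.range v) = ⊤ :=
    top_unique (hs ▸ span_le.2 (Set.range_subset_iff.2 hcon))
  have := finrank_range_le_card (R := K) v
  rw [Set.finrank, htop, finrank_top, Fintype.card_fin] at this
  omega

open Submodule in
theorem exists_linearIndependent_pair {K A V₁ V₂ : Type*} [Field K] [AddCommGroup A]
    [AddCommGroup V₁] [AddCommGroup V₂] [Module K V₁] [Module K V₂] [FiniteDimensional K V₁]
    [FiniteDimensional K V₂] (p₁ : A →+ V₁) (p₂ : A →+ V₂) {m : ℕ}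
    (h₁ : Module.finrank K V₁ = m) (h₂ : Module.finrank K V₂ = m)
    (hs₁ : span K (Set.range p₁) = ⊤) (hs₂ : span K (Set.range p₂) = ⊤) (n : ℕ) (hn : n ≤ m) :
    ∃ v : Fin n → A, LinearIndependent K (fun i => p₁ (v i)) ∧
      LinearIndependent K (fun i => p₂ (v i)) := by
  induction n with
  | zero => exact ⟨Fin.elim0, linearIndependent_empty_type, linearIndependent_empty_type⟩
  | succ n ih =>
    obtain ⟨v, hv₁, hv₂⟩ := ih (by omega)
    suffices h : ∃ a, p₁ a ∉ span K (Set.range fun i => p₁ (v i)) ∧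
        p₂ a ∉ span K (Set.range fun i => p₂ (v i)) by
      obtain ⟨a, ha₁, ha₂⟩ := h
      refine ⟨Fin.snoc v a, ?_, ?_⟩
      · convert linearIndependent_finSnoc.2 ⟨hv₁, ha₁⟩ using 1
        exact Fin.comp_snoc p₁ v a
      · convert linearIndependent_finSnoc.2 ⟨hv₂, ha₂⟩ using 1
        exact Fin.comp_snoc p₂ v a
    obtain ⟨a, ha⟩ := exists_notMem_span_of_finrank_lt p₁ hs₁ (n := n) (by omega) (fun i => p₁ (v i))
    obtain ⟨b, hb⟩ := exists_notMem_span_of_finrank_lt p₂ hs₂ (n := n) (by omega) (fun i => p₂ (v i))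
    by_cases ha' : p₂ a ∈ span K (Set.range fun i => p₂ (v i))
    · by_cases hb' : p₁ b ∈ span K (Set.range fun i => p₁ (v i))
      · refine ⟨a + b, ?_, ?_⟩
        · rwa [map_add, add_mem_cancel_right hb']
        · rwa [map_add, add_mem_cancel_left ha']
      · exact ⟨b, hb', hb⟩
    · exact ⟨a, ha, ha'⟩

theorem nonempty_equivFun_of_span {K E A V₁ V₂ : Type*} [Field K] [CommRing E] [AddCommGroup A]
    [Algebra k E] [Module.Finite k E] [Module E A] [Module k A] [IsScalarTower k E A]
    [Module.Finite k A]
    [AddCommGroup V₁] [AddCommGroup V₂] [Module K V₁] [Module K V₂] [FiniteDimensional K V₁]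
    [FiniteDimensional K V₂] (q₁ q₂ : E →+* K) (hq : ∀ e, q₁ e = 0 → q₂ e = 0 → e = 0)
    (p₁ : A →+ V₁) (p₂ : A →+ V₂) (hp₁ : ∀ e a, p₁ (e • a) = q₁ e • p₁ a)
    (hp₂ : ∀ e a, p₂ (e • a) = q₂ e • p₂ a) {m : ℕ}
    (h₁ : Module.finrank K V₁ = m) (h₂ : Module.finrank K V₂ = m)
    (hs₁ : Submodule.span K (Set.range p₁) = ⊤) (hs₂ : Submodule.span K (Set.range p₂) = ⊤)
    (hA : Module.finrank k A = m * Module.finrank k E) :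
    Nonempty ((Fin m → E) ≃ₗ[E] A) := by
  obtain ⟨v, hv₁, hv₂⟩ := exists_linearIndependent_pair p₁ p₂ h₁ h₂ hs₁ hs₂ m le_rfl
  let f : (Fin m → E) →ₗ[E] A := Fintype.linearCombination E v
  have hinj : Function.Injective f := by
    rw [injective_iff_map_eq_zero]
    intro c hc
    rw [Fintype.linearCombination_apply] at hc
    have hc₁ := congrArg p₁ hc
    have hc₂ := congrArg p₂ hc
    rw [map_sum, map_zero] at hc₁ hc₂
    simp only [hp₁] at hc₁
    simp only [hp₂] at hc₂
    rw [Fintype.linearIndependent_iff] at hv₁ hv₂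
    exact funext fun i => hq _ (hv₁ _ hc₁ i) (hv₂ _ hc₂ i)
  have hsurj : Function.Surjective (f.restrictScalars k) := by
    rw [← LinearMap.injective_iff_surjective_of_finrank_eq_finrank]
    · exact hinj
    · rw [Module.finrank_pi_fintype, Finset.sum_const, Finset.card_univ, Fintype.card_fin, hA,
        smul_eq_mul]
  exact ⟨LinearEquiv.ofBijective f ⟨hinj, hsurj⟩⟩

end FreeDescent

namespace RationalForm

open CompositionAlgebraO QuadraticMap

section Etale

variable {K : Type u} [Field K] [Algebra k K] {D : CompositionAlgebraO (K × K)}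
  {W : Type u} [AddCommGroup W] [Module k W] (S : RationalForm k D W)
  (hk2 : (2 : k) ≠ 0) {m : ℕ} (hm : m = 4 ∨ m = 8)
  (hD : Module.finrank (K × K) D.carrier = m)

include hk2 hm hD

omit hm in
include S in
theorem finrank_add_two : Module.finrank k W + 2 = m * 2 := by
  have h2 := isUnit_two (two_ne_zero_of_algebra (K := K) hk2)
  have : Nontrivial (K × K) := inferInstance
  let b := Module.finBasisOfFinrankEq (K × K) D.carrier hD
  let f : ((K ⊗[k] W) × (K × K)) →ₗ[K] (Fin m → K × K) :=
    { toFun := fun x => b.equivFun (x.2 • (1 : D.carrier) + (S.Θ x.1).1)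
      map_add' := fun x y => by
        rw [← _root_.map_add]
        congr 1
        simp only [Prod.fst_add, Prod.snd_add, add_smul, _root_.map_add, Submodule.coe_add]
        abel
      map_smul' := fun c x => by
        rw [Prod.smul_fst, Prod.smul_snd, S.map_smul, RingHom.id_apply]
        have : c • x.2 = ((c, c) : K × K) * x.2 := rfl
        rw [this, mul_smul, ← smul_add, _root_.map_smul]
        rfl }
  have hinj : Function.Injective f := by
    rw [injective_iff_map_eq_zero]
    intro x hx
    have h0 := b.equivFun.map_eq_zero_iff.1 hx
    obtain ⟨h3, h4⟩ := smul_one_add_eq_zero h2 (S.Θ x.1).2 h0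
    exact Prod.ext (S.Θ.map_eq_zero_iff.1 (Subtype.ext h4)) h3
  have hsurj : Function.Surjective f := by
    intro y
    obtain ⟨e, z, hz, h⟩ := exists_decomp h2 (b.equivFun.symm y)
    obtain ⟨u, hu⟩ := S.Θ.surjective ⟨z, hz⟩
    refine ⟨(u, e), ?_⟩
    change b.equivFun (e • (1 : D.carrier) + (S.Θ u).1) = y
    rw [hu, ← h, LinearEquiv.apply_symm_apply]
  have := Module.Finite.of_injective (f ∘ₗ LinearMap.inl K _ _)
    (hinj.comp LinearMap.inl_injective)
  have h := (LinearEquiv.ofBijective f ⟨hinj, hsurj⟩).finrank_eq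
  rwa [Module.finrank_prod, Module.finrank_prod, Module.finrank_self, Module.finrank_pi_fintype,
    Finset.sum_const, Finset.card_univ, Fintype.card_fin, Module.finrank_prod,
    Module.finrank_self, smul_eq_mul, Module.finrank_baseChange] at h

include S in
theorem finite_W : Module.Finite k W :=
  Module.finite_of_finrank_pos (by have := S.finrank_add_two hk2 hD; omega)

theorem swap_mem {e : K × K} (he : e ∈ S.scalars) : e.swap ∈ S.scalars := by
  obtain ⟨d, hd, hmem⟩ := S.exists_delta hk2 hm hD
  obtain ⟨α, β, h⟩ := S.exists_coords hk2 hm hD hmem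
    (fun h => hd (by
      have h' : (2 : K) * d = 0 := by linear_combination (h : d = -d)
      exact (mul_eq_zero.1 h').resolve_left (two_ne_zero_of_algebra hk2))) he
  have : e.swap = algebraMap k (K × K) α - algebraMap k (K × K) β * (d, -d) := by
    rw [h]
    exact Prod.ext (show algebraMap k K α + algebraMap k K β * -d =
        algebraMap k K α - algebraMap k K β * d by ring)
      (show algebraMap k K α + algebraMap k K β * d =
        algebraMap k K α - algebraMap k K β * -d by ring)
  rw [this]
  exact sub_mem (S.scalars.algebraMap_mem α) (mul_mem (S.scalars.algebraMap_mem β) hmem)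

theorem finrank_scalars : Module.finrank k S.scalars = 2 := by
  obtain ⟨d, hd, hmem⟩ := S.exists_delta hk2 hm hD
  have hdd : d ≠ -d := fun h => hd (by
    have h' : (2 : K) * d = 0 := by linear_combination h
    exact (mul_eq_zero.1 h').resolve_left (two_ne_zero_of_algebra hk2))
  let f : (k × k) →ₗ[k] S.scalars :=
    (LinearMap.toSpanSingleton k S.scalars 1).coprod
      (LinearMap.toSpanSingleton k S.scalars ⟨(d, -d), hmem⟩)
  have hf : ∀ x, (f x).1 = algebraMap k (K × K) x.1 + algebraMap k (K × K) x.2 * (d, -d) := by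
    intro x
    rw [← Algebra.smul_def, Algebra.algebraMap_eq_smul_one]
    rfl
  have hinj : Function.Injective f := by
    rw [injective_iff_map_eq_zero]
    intro x hx
    have h := hf x
    rw [hx] at h
    have h1 : (0 : K) = algebraMap k K x.1 + algebraMap k K x.2 * d := (Prod.ext_iff.1 h).1
    have h2 : (0 : K) = algebraMap k K x.1 + algebraMap k K x.2 * -d := (Prod.ext_iff.1 h).2
    have h3 : algebraMap k K x.2 * (2 * d) = 0 := by linear_combination h2 - h1
    have h4 : algebraMap k K x.2 = 0 := (mul_eq_zero.1 h3).resolve_right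
      (mul_ne_zero (two_ne_zero_of_algebra hk2) hd)
    rw [h4, zero_mul, add_zero] at h1
    exact Prod.ext ((map_eq_zero _).1 h1.symm) ((map_eq_zero _).1 h4)
  have hsurj : Function.Surjective f := by
    rintro ⟨e, he⟩
    obtain ⟨α, β, h⟩ := S.exists_coords hk2 hm hD hmem hdd he
    exact ⟨(α, β), Subtype.ext ((hf _).trans h.symm)⟩
  rw [← (LinearEquiv.ofBijective f ⟨hinj, hsurj⟩).finrank_eq, Module.finrank_prod,
    Module.finrank_self]

omit hk2 hm hD in
theorem exists_algebraMap_of_swap (hk2 : (2 : k) ≠ 0) {m : ℕ} (hm : m = 4 ∨ m = 8)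
    (hD : Module.finrank (K × K) D.carrier = m) {e : K × K} (he : e ∈ S.scalars)
    (h : e.swap = e) : ∃ c : k, e = algebraMap k (K × K) c := by
  obtain ⟨c, c'⟩ := e
  obtain rfl : c' = c := (Prod.ext_iff.1 h).1
  obtain ⟨r, rfl⟩ := S.mem_range_of_diag_mem hk2 hm hD he
  exact ⟨r, rfl⟩

/-- The centre of the descended composition algebra. -/
abbrev etale : QuadraticEtale k where
  E := S.scalars
  finrank_eq := S.finrank_scalars hk2 hm hD
  reduced x hx := by
    have h := Prod.ext_iff.1 (congrArg Subtype.val hx)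
    exact Subtype.ext (Prod.ext (mul_self_eq_zero.1 h.1) (mul_self_eq_zero.1 h.2))
  iota :=
    { toFun := fun e => ⟨e.1.swap, S.swap_mem hk2 hm hD e.2⟩
      invFun := fun e => ⟨e.1.swap, S.swap_mem hk2 hm hD e.2⟩
      left_inv := fun _ => rfl
      right_inv := fun _ => rfl
      map_mul' := fun _ _ => rfl
      map_add' := fun _ _ => rfl
      commutes' := fun _ => rfl }
  iota_iota _ := rfl
  iota_ne := by
    obtain ⟨d, hd, hmem⟩ := S.exists_delta hk2 hm hD
    refine ⟨⟨(d, -d), hmem⟩, fun h => hd ?_⟩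
    have h1 : -d = d := (Prod.ext_iff.1 (congrArg Subtype.val h)).1
    have h' : (2 : K) * d = 0 := by linear_combination -h1
    exact (mul_eq_zero.1 h').resolve_left (two_ne_zero_of_algebra hk2)
  fixed x hx := by
    obtain ⟨c, hc⟩ := S.exists_algebraMap_of_swap hk2 hm hD x.2 (congrArg Subtype.val hx)
    exact ⟨c, Subtype.ext hc⟩

end Etale

end RationalForm

namespace RationalForm

open CompositionAlgebraO QuadraticMap

section Form

variable {K : Type u} [Field K] [Algebra k K] {D : CompositionAlgebraO (K × K)}
  {W : Type u} [AddCommGroup W] [Module k W] (S : RationalForm k D W)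

/-- The descended composition algebra, as a submodule. -/
def form : Submodule S.scalars D.carrier where
  carrier := {x | ∃ e ∈ S.scalars, ∃ a, x = e • (1 : D.carrier) + S.w a}
  add_mem' := by
    rintro _ _ ⟨e, he, a, rfl⟩ ⟨e', he', a', rfl⟩
    exact ⟨e + e', add_mem he he', a + a', by rw [w_add, add_smul]; abel⟩
  zero_mem' := ⟨0, zero_mem _, 0, by rw [w_zero, zero_smul, add_zero]⟩
  smul_mem' := by
    rintro c _ ⟨e, he, a, rfl⟩
    obtain ⟨b, hb⟩ := c.2 a
    refine ⟨c.1 * e, mul_mem c.2 he, b, ?_⟩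
    rw [← hb, mul_smul, ← smul_add]
    rfl

theorem smul_mem_form {e : K × K} (he : e ∈ S.scalars) {x : D.carrier} (hx : x ∈ S.form) :
    e • x ∈ S.form := S.form.smul_mem ⟨e, he⟩ hx

theorem one_mem_form : (1 : D.carrier) ∈ S.form :=
  ⟨1, one_mem _, 0, by rw [w_zero, one_smul, add_zero]⟩

theorem w_mem_form (a : W) : S.w a ∈ S.form :=
  ⟨0, zero_mem _, a, by rw [zero_smul, zero_add]⟩

variable (hk2 : (2 : k) ≠ 0) {m : ℕ} (hm : m = 4 ∨ m = 8)
  (hD : Module.finrank (K × K) D.carrier = m)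

include hk2 hm hD

theorem w_mul_w_mem (a b : W) : S.w a * S.w b ∈ S.form := by
  have h2 := isUnit_two (two_ne_zero_of_algebra (K := K) hk2)
  have hinv : (h2.unit⁻¹ : (K × K)ˣ).val ∈ S.scalars := by
    have : (h2.unit⁻¹ : (K × K)ˣ).val = algebraMap k (K × K) (2 : k)⁻¹ := by
      rw [Units.inv_eq_of_mul_eq_one_right (a := algebraMap k (K × K) (2 : k)⁻¹)]
      rw [IsUnit.unit_spec, ← map_ofNat (algebraMap k (K × K)) 2, ← _root_.map_mul,
        mul_inv_cancel₀ hk2, _root_.map_one]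
    rw [this]
    exact S.scalars.algebraMap_mem _
  rw [mul_of_mem h2 (S.w_mem a) (S.w_mem b), br_w]
  exact S.smul_mem_form hinv (sub_mem (S.w_mem_form _)
    (S.smul_mem_form (S.polar_mem hk2 hm hD a b) S.one_mem_form))

theorem mul_mem_form {x y : D.carrier} (hx : x ∈ S.form) (hy : y ∈ S.form) : x * y ∈ S.form := by
  obtain ⟨e, he, a, rfl⟩ := hx
  obtain ⟨f, hf, b, rfl⟩ := hy
  rw [add_mul, mul_add (S.w a), smul_mul_assoc, one_mul, mul_smul_comm, mul_one]
  exact add_mem (S.smul_mem_form he ⟨f, hf, b, rfl⟩)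
    (add_mem (S.smul_mem_form hf (S.w_mem_form a)) (S.w_mul_w_mem hk2 hm hD a b))

omit hm hD in
theorem norm_form (e : K × K) (a : W) :
    D.norm (e • (1 : D.carrier) + S.w a) = e * e + D.norm (S.w a) := by
  have h2 := isUnit_two (two_ne_zero_of_algebra (K := K) hk2)
  have h := polar_comm D.norm (S.w a) (e • (1 : D.carrier))
  rw [polar_smul_right, polar_one_of_mem h2 (S.w_mem a), smul_zero, polar, sub_sub,
    eq_comm, sub_eq_zero] at h
  rw [h, QuadraticMap.map_smul, D.norm_one, smul_eq_mul, mul_one]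

theorem norm_mem_form {x : D.carrier} (hx : x ∈ S.form) : D.norm x ∈ S.scalars := by
  obtain ⟨e, he, a, rfl⟩ := hx
  rw [S.norm_form hk2]
  exact add_mem (mul_mem he he) (S.norm_mem hk2 hm hD a)

theorem polar_mem_form {x y : D.carrier} (hx : x ∈ S.form) (hy : y ∈ S.form) :
    polar D.norm x y ∈ S.scalars :=
  sub_mem (sub_mem (S.norm_mem_form hk2 hm hD (add_mem hx hy)) (S.norm_mem_form hk2 hm hD hx))
    (S.norm_mem_form hk2 hm hD hy)

theorem conj_mem_form {x : D.carrier} (hx : x ∈ S.form) : D.conj x ∈ S.form := by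
  rw [conj_eq]
  exact sub_mem (S.smul_mem_form (S.polar_mem_form hk2 hm hD hx S.one_mem_form) S.one_mem_form) hx

omit hk2 hm hD in
/-- The ring structure on the descended algebra. -/
abbrev formRing (hmul : ∀ {x y : D.carrier}, x ∈ S.form → y ∈ S.form → x * y ∈ S.form) :
    NonAssocRing S.form :=
  letI : One S.form := ⟨⟨1, S.one_mem_form⟩⟩
  letI : Mul S.form := ⟨fun x y => ⟨x.1 * y.1, hmul x.2 y.2⟩⟩
  letI : NatCast S.form :=
    ⟨fun n => ⟨n, by rw [← nsmul_one]; exact nsmul_mem S.one_mem_form n⟩⟩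
  letI : IntCast S.form :=
    ⟨fun n => ⟨n, by rw [← zsmul_one]; exact zsmul_mem S.one_mem_form n⟩⟩
  Subtype.val_injective.nonAssocRing _ rfl rfl (fun _ _ => rfl) (fun _ _ => rfl) (fun _ => rfl)
    (fun _ _ => rfl) (fun _ _ => rfl) (fun _ _ => rfl) (fun _ => rfl) (fun _ => rfl)

omit hm hD in
theorem span_form {V : Type*} [AddCommGroup V] [Module K V] (q : K × K →+* K)
    (hq : ∀ c, q (c, c) = c) (p : D.carrier →+ V) (hp : ∀ (e : K × K) x, p (e • x) = q e • p x)
    (hsurj : Function.Surjective p) :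
    Submodule.span K (Set.range (p.comp S.form.subtype.toAddMonoidHom)) = ⊤ := by
  have h2 := isUnit_two (two_ne_zero_of_algebra (K := K) hk2)
  have hpure : ∀ x ∈ D.pureSub,
      p x ∈ Submodule.span K (Set.range (p.comp S.form.subtype.toAddMonoidHom)) := by
    refine S.pure_induction ?_ ?_ ?_ ?_
    · intro a
      exact Submodule.subset_span ⟨⟨_, S.w_mem_form a⟩, rfl⟩
    · rw [_root_.map_zero]; exact zero_mem _
    · intro x _ y _ hx hy
      rw [_root_.map_add]; exact add_mem hx hy
    · intro c x _ hx
      rw [hp, hq]; exact Submodule.smul_mem _ _ hx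
  refine top_unique fun v _ => ?_
  obtain ⟨x, rfl⟩ := hsurj v
  obtain ⟨e, y, hy, rfl⟩ := exists_decomp h2 x
  rw [_root_.map_add, hp]
  exact add_mem (Submodule.smul_mem _ _ (Submodule.subset_span ⟨⟨_, S.one_mem_form⟩, rfl⟩))
    (hpure y hy)

omit hk2 hm hD in
/-- The `k`-module structure on the descended algebra. -/
abbrev formModule : Module k S.form := Module.compHom _ (algebraMap k S.scalars)

omit hk2 hm hD in
/-- The descended algebra as the sum of scalars and pure elements. -/
def formMap : letI := S.formModule; (S.scalars × W) →ₗ[k] S.form :=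
  letI := S.formModule
  { toFun := fun x => ⟨x.1.1 • (1 : D.carrier) + S.w x.2, x.1.1, x.1.2, x.2, rfl⟩
    map_add' := fun x y => Subtype.ext (by
      change (x.1.1 + y.1.1) • (1 : D.carrier) + S.w (x.2 + y.2) =
        (x.1.1 • (1 : D.carrier) + S.w x.2) + (y.1.1 • (1 : D.carrier) + S.w y.2)
      rw [w_add, add_smul]
      abel)
    map_smul' := fun c x => Subtype.ext (by
      change (c • x.1.1) • (1 : D.carrier) + S.w (c • x.2) =
        algebraMap k (K × K) c • (x.1.1 • (1 : D.carrier) + S.w x.2)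
      rw [w_smul, smul_add, smul_smul, Algebra.smul_def]
      rfl) }

omit hm hD in
theorem bijective_formMap : Function.Bijective S.formMap := by
  have h2 := isUnit_two (two_ne_zero_of_algebra (K := K) hk2)
  constructor
  · refine (injective_iff_map_eq_zero S.formMap).2 fun x hx => ?_
    obtain ⟨h3, h4⟩ := smul_one_add_eq_zero h2 (S.w_mem x.2) (congrArg Subtype.val hx)
    exact Prod.ext (Subtype.ext h3) (S.w_injective (h4.trans S.w_zero.symm))
  · rintro ⟨_, e, he, a, rfl⟩
    exact ⟨(⟨e, he⟩, a), rfl⟩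

theorem nonempty_equivFun_form : Nonempty ((Fin m → S.scalars) ≃ₗ[S.scalars] S.form) := by
  let _ := S.formModule
  have : IsScalarTower k S.scalars S.form := ⟨fun c e x => by
    rw [Algebra.smul_def, mul_smul]; rfl⟩
  have := S.finite_W hk2 hm hD
  have hfs : Module.Finite k S.scalars :=
    Module.finite_of_finrank_pos (by rw [S.finrank_scalars hk2 hm hD]; exact two_pos)
  let F := LinearEquiv.ofBijective S.formMap (S.bijective_formMap hk2)
  have hfin : Module.Finite k S.form := Module.Finite.equiv F
  have hrank : Module.finrank k S.form = m * Module.finrank k S.scalars := by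
    rw [← F.finrank_eq, Module.finrank_prod, S.finrank_scalars hk2 hm hD, add_comm,
      S.finrank_add_two hk2 hD]
  have hnt : Nontrivial (K × K) := inferInstance
  let b := Module.finBasisOfFinrankEq (K × K) D.carrier hD
  let p₁ : D.carrier →+ (Fin m → K) :=
    { toFun := fun x j => (b.equivFun x j).1
      map_zero' := by rw [_root_.map_zero]; rfl
      map_add' := fun x y => by rw [_root_.map_add]; rfl }
  let p₂ : D.carrier →+ (Fin m → K) :=
    { toFun := fun x j => (b.equivFun x j).2
      map_zero' := by rw [_root_.map_zero]; rfl
      map_add' := fun x y => by rw [_root_.map_add]; rfl }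
  have hp₁ : ∀ (e : K × K) x, p₁ (e • x) = RingHom.fst K K e • p₁ x := fun e x => by
    change (fun j => (b.equivFun (e • x) j).1) = _
    rw [_root_.map_smul]; rfl
  have hp₂ : ∀ (e : K × K) x, p₂ (e • x) = RingHom.snd K K e • p₂ x := fun e x => by
    change (fun j => (b.equivFun (e • x) j).2) = _
    rw [_root_.map_smul]; rfl
  have hs₁ := S.span_form hk2 (RingHom.fst K K) (fun _ => rfl) p₁ hp₁ fun v =>
    ⟨b.equivFun.symm fun j => (v j, 0), by
      change (fun j => (b.equivFun (b.equivFun.symm fun j => (v j, 0)) j).1) = v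
      rw [LinearEquiv.apply_symm_apply]⟩
  have hs₂ := S.span_form hk2 (RingHom.snd K K) (fun _ => rfl) p₂ hp₂ fun v =>
    ⟨b.equivFun.symm fun j => (0, v j), by
      change (fun j => (b.equivFun (b.equivFun.symm fun j => (0, v j)) j).2) = v
      rw [LinearEquiv.apply_symm_apply]⟩
  have hfr : Module.finrank K (Fin m → K) = m := Module.finrank_fin_fun K
  clear_value p₁ p₂
  have h := nonempty_equivFun_of_span (k := k) (E := S.scalars) (A := S.form)
    ((RingHom.fst K K).comp S.scalars.toSubring.subtype)
    ((RingHom.snd K K).comp S.scalars.toSubring.subtype)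
    (fun e h h' => Subtype.ext (Prod.ext h h')) (p₁.comp S.form.subtype.toAddMonoidHom)
    (p₂.comp S.form.subtype.toAddMonoidHom)
  have h := h (fun e x => hp₁ e.1 x.1) (fun e x => hp₂ e.1 x.1) (m := m)
  exact h hfr hfr hs₁ hs₂ hrank

omit hm hD in
theorem eq_zero_of_polar_form {x : D.carrier} (h : ∀ y ∈ S.form, polar D.norm x y = 0) :
    x = 0 := by
  have h2 := isUnit_two (two_ne_zero_of_algebra (K := K) hk2)
  have hpure : ∀ y ∈ D.pureSub, polar D.norm x y = 0 := by
    refine S.pure_induction (fun a => h _ (S.w_mem_form a)) (polar_zero_right ..) ?_ ?_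
    · intro y _ z _ hy hz
      rw [polar_add_right, hy, hz, add_zero]
    · intro c y _ hy
      rw [polar_smul_right, hy, smul_zero]
  refine eq_of_polar fun z => ?_
  obtain ⟨e, y, hy, rfl⟩ := exists_decomp h2 z
  rw [polar_add_right, polar_smul_right, h _ S.one_mem_form, hpure y hy, smul_zero, add_zero,
    polar_zero_left]

/-- The norm form of the descended composition algebra. -/
def formNorm : QuadraticForm S.scalars S.form where
  toFun x := ⟨D.norm x.1, S.norm_mem_form hk2 hm hD x.2⟩
  toFun_smul e x := Subtype.ext (QuadraticMap.map_smul D.norm e.1 x.1)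
  exists_companion' :=
    ⟨LinearMap.mk₂ S.scalars
      (fun x y => ⟨polar D.norm x.1 y.1, S.polar_mem_form hk2 hm hD x.2 y.2⟩)
      (fun x x' y => Subtype.ext (polar_add_left D.norm x.1 x'.1 y.1))
      (fun e x y => Subtype.ext (polar_smul_left D.norm e.1 x.1 y.1))
      (fun x y y' => Subtype.ext (polar_add_right D.norm x.1 y.1 y'.1))
      (fun e x y => Subtype.ext (polar_smul_right D.norm e.1 x.1 y.1)),
    fun x y => Subtype.ext (QuadraticMap.map_add D.norm x.1 y.1)⟩

theorem formNorm_nondegenerate (x : S.form)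
    (h : ∀ y, S.formNorm hk2 hm hD (x + y) - S.formNorm hk2 hm hD x - S.formNorm hk2 hm hD y = 0) :
    x = 0 :=
  Subtype.ext (S.eq_zero_of_polar_form hk2 fun y hy => congrArg Subtype.val (h ⟨y, hy⟩))

/-- The descended composition algebra. -/
def formComp : CompositionAlgebraO (S.etale hk2 hm hD).E :=
  letI : NonAssocRing S.form := S.formRing (S.mul_mem_form hk2 hm hD)
  { carrier := S.form
    isModule := inferInstanceAs (Module S.scalars S.form)
    isSMulCommClass := ⟨fun e x y => Subtype.ext (mul_smul_comm e.1 x.1 y.1).symm⟩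
    isScalarTower := ⟨fun e x y => Subtype.ext (smul_mul_assoc e.1 x.1 y.1)⟩
    isFinite := Module.Finite.equiv (S.nonempty_equivFun_form hk2 hm hD).some
    isFree := Module.Free.of_equiv (S.nonempty_equivFun_form hk2 hm hD).some
    norm := S.formNorm hk2 hm hD
    norm_one := Subtype.ext D.norm_one
    norm_mul := fun x y => Subtype.ext (D.norm_mul x.1 y.1)
    nondegenerate := S.formNorm_nondegenerate hk2 hm hD
    conj :=
      { toFun := fun x => ⟨D.conj x.1, S.conj_mem_form hk2 hm hD x.2⟩
        map_add' := fun x y => Subtype.ext (_root_.map_add D.conj x.1 y.1)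
        map_smul' := fun e x => Subtype.ext (_root_.map_smul D.conj e.1 x.1) }
    conj_def := fun x => Subtype.ext (D.conj_def x.1)
    conj_one := Subtype.ext D.conj_one
    conj_mul := fun x y => Subtype.ext (D.conj_mul x.1 y.1)
    conj_conj := fun x => Subtype.ext (D.conj_conj x.1) }

theorem finrank_formComp :
    Module.finrank (S.etale hk2 hm hD).E (S.formComp hk2 hm hD).carrier = m := by
  have : Nontrivial S.scalars := inferInstance
  refine (LinearEquiv.finrank_eq (S.nonempty_equivFun_form hk2 hm hD).some).symm.trans ?_
  rw [Module.finrank_pi, Fintype.card_fin]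

end Form

end RationalForm

namespace AlgebraWithInvolution

theorem mem_skew {R : Type u} [CommRing R] {A : AlgebraWithInvolution R} {x : A.carrier} :
    x ∈ A.skew ↔ A.invol x = -x := Iff.rfl

/-- The restriction of an isomorphism to the skew elements. -/
def Iso.skewEquiv {R : Type u} [CommRing R] {A B : AlgebraWithInvolution R} (F : A.Iso B) :
    A.skew ≃ₗ[R] B.skew :=
  F.toLinearEquiv.submoduleMap A.skew ≪≫ₗ LinearEquiv.ofEq _ _ (by
    ext y
    rw [Submodule.mem_map]
    constructor
    · rintro ⟨x, hx, rfl⟩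
      rw [mem_skew] at hx ⊢
      rw [LinearEquiv.coe_coe, ← F.map_invol, hx, map_neg]
    · intro hy
      rw [mem_skew] at hy
      refine ⟨F.toLinearEquiv.symm y, ?_, F.toLinearEquiv.apply_symm_apply y⟩
      apply F.toLinearEquiv.injective
      rw [F.map_invol, map_neg, F.toLinearEquiv.apply_symm_apply, hy])

theorem Iso.coe_skewEquiv {R : Type u} [CommRing R] {A B : AlgebraWithInvolution R} (F : A.Iso B)
    (x : A.skew) : (F.skewEquiv x).1 = F.toLinearEquiv x.1 := rfl

variable (A : AlgebraWithInvolution k) (K : Type u) [Field K] [Algebra k K]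

theorem baseChange_subtype_mem (u : K ⊗[k] A.skew) :
    (LinearMap.baseChange K A.skew.subtype u : (A.baseChange K).carrier) ∈
      (A.baseChange K).skew := by
  change LinearMap.baseChange K A.invol (LinearMap.baseChange K A.skew.subtype u) =
    -LinearMap.baseChange K A.skew.subtype u
  induction u with
  | zero => simp
  | add u v hu hv => rw [map_add, map_add, hu, hv, neg_add]
  | tmul c a =>
    rw [LinearMap.baseChange_tmul, LinearMap.baseChange_tmul, Submodule.subtype_apply,
      mem_skew.1 a.2, TensorProduct.tmul_neg]

/-- The projection onto the skew elements. -/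
noncomputable def skewProj : A.carrier →ₗ[k] A.skew :=
  ((2 : k)⁻¹ • (LinearMap.id - A.invol)).codRestrict A.skew fun x => by
    rw [mem_skew, LinearMap.smul_apply, map_smul, LinearMap.sub_apply, map_sub, A.invol_invol,
      ← smul_neg, neg_sub]
    rfl

theorem baseChange_skewProj (t : K ⊗[k] A.carrier) :
    LinearMap.baseChange K A.skew.subtype (LinearMap.baseChange K A.skewProj t) =
      algebraMap k K (2 : k)⁻¹ • (t - LinearMap.baseChange K A.invol t) := by
  induction t with
  | zero => simp
  | add u v hu hv =>
    rw [map_add, map_add, hu, hv, map_add, ← smul_add]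
    congr 1
    abel
  | tmul c a =>
    rw [LinearMap.baseChange_tmul, LinearMap.baseChange_tmul, LinearMap.baseChange_tmul,
      ← TensorProduct.tmul_sub, algebraMap_smul, ← TensorProduct.tmul_smul]
    rfl

theorem baseChange_skewProj_of_skew (hk2 : (2 : k) ≠ 0) {t : K ⊗[k] A.carrier}
    (h : LinearMap.baseChange K A.invol t = -t) :
    LinearMap.baseChange K A.skew.subtype (LinearMap.baseChange K A.skewProj t) = t := by
  have hK : (2 : K) ≠ 0 := RationalForm.two_ne_zero_of_algebra hk2
  rw [A.baseChange_skewProj K, h, sub_neg_eq_add, ← two_smul K, smul_smul, map_inv₀, map_ofNat,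
    inv_mul_cancel₀ hK, one_smul]

theorem bijective_baseChange_skew (hk2 : (2 : k) ≠ 0) : Function.Bijective fun u : K ⊗[k] A.skew =>
    (⟨LinearMap.baseChange K A.skew.subtype u, A.baseChange_subtype_mem K u⟩ :
      (A.baseChange K).skew) := by
  constructor
  · intro u v h
    exact Module.Flat.lTensor_preserves_injective_linearMap (M := K) A.skew.subtype
      A.skew.subtype_injective (congrArg Subtype.val h)
  · rintro ⟨t, ht⟩
    exact ⟨LinearMap.baseChange K A.skewProj t,
      Subtype.ext (A.baseChange_skewProj_of_skew K hk2 ht)⟩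

/-- The skew elements of a scalar extension. -/
noncomputable def skewBaseChange (hk2 : (2 : k) ≠ 0) :
    K ⊗[k] A.skew ≃+ (A.baseChange K).skew :=
  AddEquiv.mk' (Equiv.ofBijective _ (A.bijective_baseChange_skew K hk2)) fun u v =>
    Subtype.ext (map_add (LinearMap.baseChange K A.skew.subtype) u v)

theorem skewBaseChange_smul (hk2 : (2 : k) ≠ 0) (c : K) (u : K ⊗[k] A.skew) :
    A.skewBaseChange K hk2 (c • u) = c • A.skewBaseChange K hk2 u :=
  Subtype.ext (map_smul (LinearMap.baseChange K A.skew.subtype) c u)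

theorem coe_adOp {A : AlgebraWithInvolution k} (s t : A.skew) :
    (adOp A s t).1 = s.1 * t.1 - t.1 * s.1 := rfl

theorem Iso.skewEquiv_adOp {A B : AlgebraWithInvolution k} (F : A.Iso B) (s t : A.skew) :
    F.skewEquiv (adOp A s t) = adOp B (F.skewEquiv s) (F.skewEquiv t) := by
  apply Subtype.ext
  rw [F.coe_skewEquiv, coe_adOp, coe_adOp, map_sub, F.map_mul, F.map_mul]
  rfl

theorem skewBaseChange_adOp (hk2 : (2 : k) ≠ 0) (s t : A.skew) :
    A.skewBaseChange K hk2 (1 ⊗ₜ adOp A s t) = adOp (A.baseChange K)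
      (A.skewBaseChange K hk2 (1 ⊗ₜ s)) (A.skewBaseChange K hk2 (1 ⊗ₜ t)) := by
  apply Subtype.ext
  rw [coe_adOp]
  have h : ∀ a b : A.carrier, (1 : K) ⊗ₜ[k] (a * b - b * a) =
      ((1 : K) ⊗ₜ[k] a) * ((1 : K) ⊗ₜ[k] b) - ((1 : K) ⊗ₜ[k] b) * ((1 : K) ⊗ₜ[k] a) :=
    fun a b => by rw [Algebra.TensorProduct.tmul_mul_tmul, Algebra.TensorProduct.tmul_mul_tmul,
      one_mul, TensorProduct.tmul_sub]
  exact h s.1 t.1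

end AlgebraWithInvolution

namespace RationalForm

open CompositionAlgebraO Corestriction

variable {K : Type u} [Field K] [Algebra k K] {D : CompositionAlgebraO (K × K)}
  {A : AlgebraWithInvolution k}

/-- The rational form on the skew elements of a form of a split corestriction. -/
noncomputable def ofIso (hk2 : (2 : k) ≠ 0)
    (φ : (A.baseChange K).Iso (corestriction (splitEtale K) D)) : RationalForm k D A.skew where
  ad := adOp A
  Θ := ((A.skewBaseChange K hk2).trans φ.skewEquiv.toAddEquiv).trans
    (skewEquiv (Et := splitEtale K) (two_ne_zero_of_algebra hk2)).symm
  map_smul c u := by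
    let s := skewEquiv (Et := splitEtale K) (C := D) (two_ne_zero_of_algebra hk2)
    refine congrArg Subtype.val (?_ : s.symm (φ.skewEquiv (A.skewBaseChange K hk2 (c • u))) =
      ((c, c) : K × K) • s.symm (φ.skewEquiv (A.skewBaseChange K hk2 u)))
    rw [AddEquiv.symm_apply_eq]
    refine Eq.trans ?_ (skewEquiv_ksmul (Et := splitEtale K) _ c _).symm
    rw [AddEquiv.apply_symm_apply]
    rw [A.skewBaseChange_smul, _root_.map_smul]
  map_br a b := by
    refine congrArg Subtype.val (?_ : (⟨br _ _, br_mem _ _⟩ : D.pureSub) = _)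
    apply (skewEquiv (Et := splitEtale K) (two_ne_zero_of_algebra hk2)).injective
    rw [← skewEquiv_br]
    simp only [AddEquiv.trans_apply, AddEquiv.apply_symm_apply]
    change adOp _ (φ.skewEquiv _) (φ.skewEquiv _) = φ.skewEquiv _
    rw [A.skewBaseChange_adOp, φ.skewEquiv_adOp]

theorem symCor_ofIso (hk2 : (2 : k) ≠ 0)
    (φ : (A.baseChange K).Iso (corestriction (splitEtale K) D)) (a : A.skew) :
    symCor (Et := splitEtale K) ((ofIso hk2 φ).w a) =
      φ.toLinearEquiv ((1 : K) ⊗ₜ[k] a.1 : K ⊗[k] A.carrier) :=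
  congrArg Subtype.val ((skewEquiv (Et := splitEtale K) (two_ne_zero_of_algebra hk2)).apply_symm_apply
    (φ.skewEquiv (A.skewBaseChange K hk2 (1 ⊗ₜ a))))

end RationalForm

namespace AlgebraWithInvolution

theorem one_tmul_injective {A K : Type*} [AddCommGroup A] [Module k A] [Field K] [Algebra k K] :
    Function.Injective fun a : A => (1 : K) ⊗ₜ[k] a := by
  intro a b h
  have hinj := Module.Flat.rTensor_preserves_injective_linearMap (M := A)
    (Algebra.linearMap k K) (algebraMap k K).injective
  apply (TensorProduct.lid k A).symm.injective
  apply hinj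
  simpa using h

/-- An isomorphism over an extension field that respects the rational structure descends. -/
theorem nonempty_iso_of_baseChange {A B : AlgebraWithInvolution k} {K : Type u} [Field K]
    [Algebra k K] (Ψ : (B.baseChange K).Iso (A.baseChange K))
    (h : ∀ t : B.carrier, ∃ a : A.carrier, Ψ.toLinearEquiv ((1 : K) ⊗ₜ[k] t : K ⊗[k] B.carrier) =
      ((1 : K) ⊗ₜ[k] a : K ⊗[k] A.carrier))
    (hB : 0 < Module.finrank k B.carrier) : Nonempty (B.Iso A) := by
  have hrank : Module.finrank k B.carrier = Module.finrank k A.carrier := by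
    have := Ψ.toLinearEquiv.finrank_eq
    rwa [show Module.finrank K (B.baseChange K).carrier = _ from
      Module.finrank_baseChange (R := K) (S := k) (M' := B.carrier),
      show Module.finrank K (A.baseChange K).carrier = _ from
      Module.finrank_baseChange (R := K) (S := k) (M' := A.carrier)] at this
  have := Module.finite_of_finrank_pos hB
  have := Module.finite_of_finrank_pos (hrank ▸ hB)
  choose f hf using h
  have hext : ∀ {a b : A.carrier}, (1 : K) ⊗ₜ[k] a = (1 : K) ⊗ₜ[k] b → a = b :=
    fun h => one_tmul_injective h
  let F : B.carrier →ₗ[k] A.carrier :=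
    { toFun := f
      map_add' := fun x y => hext <| by
        rw [← hf, TensorProduct.tmul_add, TensorProduct.tmul_add, ← hf, ← hf]
        exact map_add Ψ.toLinearEquiv _ _
      map_smul' := fun c x => hext <| by
        have h1 : ∀ {C : AlgebraWithInvolution k} (x : C.carrier),
            ((1 : K) ⊗ₜ[k] (c • x) : K ⊗[k] C.carrier) = algebraMap k K c • ((1 : K) ⊗ₜ[k] x) :=
          fun x => by rw [TensorProduct.tmul_smul, algebraMap_smul]
        rw [RingHom.id_apply, h1, ← hf, ← hf]
        exact (congrArg Ψ.toLinearEquiv (h1 x)).trans (map_smul Ψ.toLinearEquiv _ _) }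
  have hinj : Function.Injective F := fun x y hxy => by
    have h1 : (1 : K) ⊗ₜ[k] f x = (1 : K) ⊗ₜ[k] f y := congrArg _ hxy
    rw [← hf, ← hf] at h1
    exact one_tmul_injective (Ψ.toLinearEquiv.injective h1)
  refine ⟨⟨LinearEquiv.ofBijective F
    ⟨hinj, (LinearMap.injective_iff_surjective_of_finrank_eq_finrank hrank).1 hinj⟩, ?_, ?_, ?_⟩⟩
  · intro x y
    refine hext ?_
    refine (hf (x * y)).symm.trans ?_
    have h1 := Ψ.map_mul ((1 : K) ⊗ₜ[k] x : K ⊗[k] B.carrier) ((1 : K) ⊗ₜ[k] y : K ⊗[k] B.carrier)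
    rw [hf, hf] at h1
    have h2 : ∀ {C : AlgebraWithInvolution k} (x y : C.carrier),
        ((1 : K) ⊗ₜ[k] x : K ⊗[k] C.carrier) * ((1 : K) ⊗ₜ[k] y) = (1 : K) ⊗ₜ[k] (x * y) :=
      fun x y => by rw [Algebra.TensorProduct.tmul_mul_tmul, one_mul]
    exact (congrArg Ψ.toLinearEquiv (h2 x y).symm).trans (h1.trans (h2 (f x) (f y)))
  · exact hext ((hf 1).symm.trans Ψ.map_one)
  · intro x
    refine hext ((hf (B.invol x)).symm.trans ?_)
    have h1 := Ψ.map_invol ((1 : K) ⊗ₜ[k] x : K ⊗[k] B.carrier)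
    rw [hf] at h1
    exact h1

end AlgebraWithInvolution

namespace RationalForm

open CompositionAlgebraO Corestriction

section Descent

variable {K : Type u} [Field K] [Algebra k K] {D₁ D₂ : CompositionAlgebra K}
  {m : ℕ} (h₁ : Module.finrank K D₁.carrier = m) (h₂ : Module.finrank K D₂.carrier = m)
  {W : Type u} [AddCommGroup W] [Module k W] (S : RationalForm k (prodComp D₁ D₂ h₁ h₂) W)
  (hk2 : (2 : k) ≠ 0) (hm : m = 4 ∨ m = 8)

/-- The projections of the descended algebra, as splitting data. -/
noncomputable def splitting : Splitting (Et := S.etale hk2 hm (finrank_prodComp D₁ D₂ h₁ h₂))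
    (S.formComp hk2 hm (finrank_prodComp D₁ D₂ h₁ h₂)) K D₁ D₂ where
  π := (AlgHom.fst k K K).comp S.scalars.val
  ρ₁ := (AddMonoidHom.fst D₁.carrier D₂.carrier).comp S.form.subtype.toAddMonoidHom
  ρ₂ := (AddMonoidHom.snd D₁.carrier D₂.carrier).comp S.form.subtype.toAddMonoidHom
  smul₁ := fun _ _ => rfl
  smul₂ := fun _ _ => rfl
  mul₁ := fun _ _ => rfl
  mul₂ := fun _ _ => rfl
  one₁ := rfl
  one₂ := rfl
  conj₁ := fun _ => rfl
  conj₂ := fun _ => rfl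
  span₁ := S.span_form hk2 (RingHom.fst K K) (fun _ => rfl) (AddMonoidHom.fst D₁.carrier D₂.carrier)
    (fun _ _ => rfl) Prod.fst_surjective
  span₂ := S.span_form hk2 (RingHom.snd K K) (fun _ => rfl) (AddMonoidHom.snd D₁.carrier D₂.carrier)
    (fun _ _ => rfl) Prod.snd_surjective

theorem exists_w_of_mem_pureSub {D : CompositionAlgebraO (K × K)} (S : RationalForm k D W)
    (hD : Module.finrank (K × K) D.carrier = m)
    {x : (S.formComp hk2 hm hD).carrier} (hx : x ∈ (S.formComp hk2 hm hD).pureSub) :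
    ∃ a, Subtype.val (p := (· ∈ S.form)) x = S.w a := by
  have h2 := isUnit_two (two_ne_zero_of_algebra (K := K) hk2)
  obtain ⟨⟨y, e, he, a, rfl⟩, rfl⟩ : ∃ y : S.form, y = x := ⟨x, rfl⟩
  have hx' : e • (1 : D.carrier) + S.w a ∈ D.pureSub := congrArg Subtype.val hx
  have := (smul_one_add_eq_zero h2 (e := e) (sub_mem (S.w_mem a) hx') (by abel)).1
  exact ⟨a, show e • (1 : D.carrier) + S.w a = S.w a by rw [this, zero_smul, zero_add]⟩

theorem ambHom_symCor (hK : (2 : K) ≠ 0)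
    (x : (S.formComp hk2 hm (finrank_prodComp D₁ D₂ h₁ h₂)).carrier) :
    (S.splitting h₁ h₂ hk2 hm).ambHom (symAmb x) =
      (isoProdComp D₁ D₂ h₁ h₂ hK).toLinearEquiv
        (symCor (Et := splitEtale K) (Subtype.val (p := (· ∈ S.form)) x)) := by
  rw [isoProdComp_symCor, symAmb_apply, _root_.map_add, Splitting.ambHom_tmul,
    Splitting.ambHom_tmul]
  rfl

end Descent

end RationalForm

namespace Corestriction

open CompositionAlgebraO

theorem exists_corestriction_iso (hk2 : (2 : k) ≠ 0) {m : ℕ} (hm : m = 4 ∨ m = 8)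
    (A : AlgebraWithInvolution k) (hA : IsProductAlgebra A m m) :
    ∃ (Et : QuadraticEtale k) (C : CompositionAlgebraO Et.E),
      Module.finrank Et.E C.carrier = m ∧ Nonempty ((corestriction Et C).Iso A) := by
  obtain ⟨⟨K, D₁, D₂, h₁, h₂, Φ⟩⟩ := hA
  have hm0 : m ≠ 0 := by omega
  have hK : (2 : K) ≠ 0 := RationalForm.two_ne_zero_of_algebra hk2
  have hD := finrank_prodComp D₁ D₂ h₁ h₂
  let G := isoProdComp D₁ D₂ h₁ h₂ hK
  let φ := isoTrans Φ (isoSymm G)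
  let S := RationalForm.ofIso hk2 φ
  let C := S.formComp hk2 hm hD
  let σ := S.splitting h₁ h₂ hk2 hm
  have hC : Module.finrank _ C.carrier = m := S.finrank_formComp hk2 hm hD
  refine ⟨S.etale hk2 hm hD, C, hC, ?_⟩
  have key : ∀ x ∈ C.pureSub, ∃ a : A.carrier,
      Φ.toLinearEquiv ((1 : K) ⊗ₜ[k] a : K ⊗[k] A.carrier) = σ.ambHom (symAmb x) := by
    intro x hx
    obtain ⟨a, ha⟩ := RationalForm.exists_w_of_mem_pureSub hk2 hm S hD hx
    refine ⟨a.1, ?_⟩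
    have h1 : σ.ambHom (symAmb x) = G.toLinearEquiv (symCor (Et := splitEtale K) (S.w a)) :=
      (RationalForm.ambHom_symCor h₁ h₂ S hk2 hm hK x).trans
        (congrArg (fun y => G.toLinearEquiv (symCor (Et := splitEtale K) y)) ha)
    have h2 := RationalForm.symCor_ofIso hk2 φ a
    exact (h1.trans ((congrArg G.toLinearEquiv h2).trans
      (G.toLinearEquiv.apply_symm_apply _))).symm
  have hΦk : ∀ (c : k) (a : A.carrier),
      Φ.toLinearEquiv ((1 : K) ⊗ₜ[k] (c • a) : K ⊗[k] A.carrier) =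
        algebraMap k K c • Φ.toLinearEquiv ((1 : K) ⊗ₜ[k] a : K ⊗[k] A.carrier) := by
    intro c a
    have h1 : ((1 : K) ⊗ₜ[k] (c • a) : K ⊗[k] A.carrier) = algebraMap k K c • ((1 : K) ⊗ₜ[k] a) := by
      rw [TensorProduct.tmul_smul, algebraMap_smul]
    exact (congrArg Φ.toLinearEquiv h1).trans (map_smul Φ.toLinearEquiv _ _)
  have hΦadd : ∀ a b : A.carrier,
      Φ.toLinearEquiv ((1 : K) ⊗ₜ[k] (a + b) : K ⊗[k] A.carrier) =
        Φ.toLinearEquiv ((1 : K) ⊗ₜ[k] a : K ⊗[k] A.carrier) +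
          Φ.toLinearEquiv ((1 : K) ⊗ₜ[k] b : K ⊗[k] A.carrier) := fun a b =>
    (congrArg Φ.toLinearEquiv (TensorProduct.tmul_add (1 : K) a b)).trans
      (map_add Φ.toLinearEquiv _ _)
  have hΦmul : ∀ a b : A.carrier,
      Φ.toLinearEquiv ((1 : K) ⊗ₜ[k] (a * b) : K ⊗[k] A.carrier) =
        Φ.toLinearEquiv ((1 : K) ⊗ₜ[k] a : K ⊗[k] A.carrier) *
          Φ.toLinearEquiv ((1 : K) ⊗ₜ[k] b : K ⊗[k] A.carrier) := by
    intro a b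
    have h1 : ((1 : K) ⊗ₜ[k] (a * b) : K ⊗[k] A.carrier) = (1 ⊗ₜ[k] a) * ((1 : K) ⊗ₜ[k] b) := by
      rw [Algebra.TensorProduct.tmul_mul_tmul, one_mul]
    exact (congrArg Φ.toLinearEquiv h1).trans (Φ.map_mul _ _)
  let T : Submodule k (corSubmodule (S.etale hk2 hm hD) C) :=
    { carrier := {t | ∃ a : A.carrier,
        Φ.toLinearEquiv ((1 : K) ⊗ₜ[k] a : K ⊗[k] A.carrier) = σ.ambHom t.1}
      add_mem' := by
        rintro x y ⟨a, ha⟩ ⟨b, hb⟩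
        refine ⟨a + b, (hΦadd a b).trans ?_⟩
        rw [ha, hb]
        exact (map_add σ.ambHom _ _).symm
      zero_mem' := ⟨0, by
        rw [TensorProduct.tmul_zero]
        exact (map_zero Φ.toLinearEquiv).trans (map_zero σ.ambHom).symm⟩
      smul_mem' := by
        rintro c x ⟨a, ha⟩
        refine ⟨c • a, (hΦk c a).trans ?_⟩
        rw [ha]
        exact (σ.ambHom_ksmul c x.1).symm }
  have hT : T = ⊤ := eq_top_of_symCor_mem hk2 T ⟨1, Φ.map_one.trans σ.ambHom_one.symm⟩ key
    fun x hx y hy => by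
      obtain ⟨a, ha⟩ := key x hx
      obtain ⟨b, hb⟩ := key y hy
      refine ⟨a * b, (hΦmul a b).trans ?_⟩
      rw [ha, hb]
      exact (σ.ambHom_mul _ _).symm
  have hmem : ∀ t : corSubmodule (S.etale hk2 hm hD) C, t ∈ T := fun t => by
    rw [show T = ⊤ from hT]
    trivial
  refine AlgebraWithInvolution.nonempty_iso_of_baseChange
    (isoTrans (σ.iso hk2 hm0 hC h₁ h₂) (isoSymm Φ)) (fun t => ?_) ?_
  · obtain ⟨a, ha⟩ := hmem t
    refine ⟨a, Φ.toLinearEquiv.symm_apply_eq.2 ?_⟩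
    exact ((σ.lin_tmul 1 t).trans (one_smul K _)).trans ha.symm
  · exact (finrank_cor hk2 hC).symm ▸ by positivity

section Functor

variable {Et Et' : QuadraticEtale k} {C : CompositionAlgebraO Et.E} {C' : CompositionAlgebraO Et'.E}

/-- Isomorphism classes are reflected by the corestriction. -/
theorem nonempty_iso_iff (hk2 : (2 : k) ≠ 0) {m : ℕ} (hm : m = 4 ∨ m = 8)
    (hC : Module.finrank Et.E C.carrier = m) (hC' : Module.finrank Et'.E C'.carrier = m) :
    Nonempty ((corestriction Et C).Iso (corestriction Et' C')) ↔ Nonempty (KIso C C') := by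
  constructor
  · rintro ⟨F⟩
    obtain ⟨g, -⟩ := exists_kIso_of_iso hk2 hm hC hC' F
    exact ⟨g⟩
  · rintro ⟨g⟩
    obtain ⟨P⟩ := nonempty_unitPair hk2 hm hC
    obtain ⟨P'⟩ := nonempty_unitPair hk2 hm hC'
    obtain ⟨F, -⟩ := exists_iso hk2 P P' g
    exact ⟨F⟩

theorem iso_apply_eq (hk2 : (2 : k) ≠ 0) {F F' : (corestriction Et C).Iso (corestriction Et' C')}
    (h : ∀ x ∈ C.pureSub, F.toLinearEquiv (symCor x) = F'.toLinearEquiv (symCor x)) :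
    F.toLinearEquiv = F'.toLinearEquiv :=
  LinearEquiv.toLinearMap_injective <| linearMap_ext hk2 F.map_mul F'.map_mul
    (F.map_one.trans F'.map_one.symm) h

/-- The functor induced by the corestriction on isomorphisms. -/
noncomputable def mapIso (hk2 : (2 : k) ≠ 0) (P : UnitPair C) (P' : UnitPair C') (g : KIso C C') :
    (corestriction Et C).Iso (corestriction Et' C') :=
  (exists_iso hk2 P P' g).choose

theorem mapIso_symCor (hk2 : (2 : k) ≠ 0) (P : UnitPair C) (P' : UnitPair C') (g : KIso C C')
    (x : C.carrier) : (mapIso hk2 P P' g).toLinearEquiv (symCor x) = symCor (g.toAddEquiv x) :=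
  (exists_iso hk2 P P' g).choose_spec x

theorem mapIso_injective (hk2 : (2 : k) ≠ 0) (P : UnitPair C) (P' : UnitPair C') {g g' : KIso C C'}
    (h : (mapIso hk2 P P' g).toLinearEquiv = (mapIso hk2 P P' g').toLinearEquiv) :
    g.toAddEquiv = g'.toAddEquiv := by
  have := P.eq_of_eqOn_pure hk2 (g := g.toAddEquiv.toAddMonoidHom)
    (g' := g'.toAddEquiv.toAddMonoidHom) g.map_mul g'.map_mul fun z hz =>
      symCor_injOn hk2 (g.map_pure hk2 P hz) (g'.map_pure hk2 P hz) <| by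
        have h1 := mapIso_symCor hk2 P P' g z
        rw [h, mapIso_symCor] at h1
        exact h1.symm
  exact AddEquiv.ext fun x => DFunLike.congr_fun this x

theorem exists_mapIso_eq (hk2 : (2 : k) ≠ 0) {m : ℕ} (hm : m = 4 ∨ m = 8)
    (hC : Module.finrank Et.E C.carrier = m) (hC' : Module.finrank Et'.E C'.carrier = m)
    (P : UnitPair C) (P' : UnitPair C') (F : (corestriction Et C).Iso (corestriction Et' C')) :
    ∃ g : KIso C C', (mapIso hk2 P P' g).toLinearEquiv = F.toLinearEquiv := by
  obtain ⟨g, hg⟩ := exists_kIso_of_iso hk2 hm hC hC' F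
  exact ⟨g, iso_apply_eq hk2 fun x hx => (mapIso_symCor hk2 P P' g x).trans (hg x hx).symm⟩

theorem mapIso_comp (hk2 : (2 : k) ≠ 0) (P : UnitPair C) {g g' g'' : KIso C C}
    (h : ∀ x, g''.toAddEquiv x = g'.toAddEquiv (g.toAddEquiv x)) (a : (corestriction Et C).carrier) :
    (mapIso hk2 P P g'').toLinearEquiv a =
      (mapIso hk2 P P g').toLinearEquiv ((mapIso hk2 P P g).toLinearEquiv a) := by
  have := iso_apply_eq hk2 (F := mapIso hk2 P P g'')
    (F' := isoTrans (mapIso hk2 P P g) (mapIso hk2 P P g')) fun x _ => by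
      refine (mapIso_symCor hk2 P P g'' x).trans ?_
      refine Eq.trans ?_ (congrArg (mapIso hk2 P P g').toLinearEquiv
        (mapIso_symCor hk2 P P g x)).symm
      rw [mapIso_symCor, h]
  exact LinearEquiv.congr_fun this a

end Functor

end Corestriction

open Corestriction in
/-- Let `k` be a field of characteristic not 2 or 3 and `m = 4` or `8`.  The
corestriction `C ↦ cor_{Z(C)/k}(C)` is an equivalence from the groupoid of `m`-dimensional
composition algebras over quadratic étale extensions of `k` (with `k`-algebra isomorphisms) to
the groupoid of `(m,m)`-product algebras over `k` (with involution-preserving `k`-algebra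
isomorphisms): it lands in `(m,m)`-product algebras, is essentially surjective, and induces
bijections on isomorphism classes and on automorphism groups.  Moreover, if `C` and `(A,−)`
correspond: (i) `Aut_k(C) ≅ Aut_k(A,−)`; (ii) the centre `E` of `C` is isomorphic to the
centroid of the Malcev algebra `Skew(A,−)⁻`; (iii) `(A,−)` is decomposable iff `C ≅ C₁ × C₂`. -/
theorem corestriction_equivalence
    {k : Type u} [Field k] (hk2 : (2 : k) ≠ 0) (hk3 : (3 : k) ≠ 0)
    (m : ℕ) (hm : m = 4 ∨ m = 8) :
    -- the corestriction of a rank-`m` composition algebra over a quadratic étale extension is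
    -- an `(m,m)`-product algebra:
    (∀ (Et : QuadraticEtale k) (C : CompositionAlgebraO Et.E),
      Module.finrank Et.E C.carrier = m →
      IsProductAlgebra (corestriction Et C) m m) ∧
    -- essential surjectivity:
    (∀ A : AlgebraWithInvolution k, IsProductAlgebra A m m →
      ∃ (Et : QuadraticEtale k) (C : CompositionAlgebraO Et.E),
        Module.finrank Et.E C.carrier = m ∧
        Nonempty ((corestriction Et C).Iso A)) ∧
    -- bijectivity on isomorphism classes (fully faithfulness at the level of groupoids):
    (∀ (Et Et' : QuadraticEtale k) (C : CompositionAlgebraO Et.E)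
        (C' : CompositionAlgebraO Et'.E),
      Module.finrank Et.E C.carrier = m → Module.finrank Et'.E C'.carrier = m →
      (Nonempty ((corestriction Et C).Iso (corestriction Et' C')) ↔
        ∃ e : C.carrier ≃+ C'.carrier,
          (∀ x y : C.carrier, e (x * y) = e x * e y) ∧ e 1 = 1 ∧
          (∀ (c : k) (x : C.carrier),
            e (algebraMap k Et.E c • x) = algebraMap k Et'.E c • e x))) ∧
    -- (i) `Aut_k(C) ≅ Aut_k(A,−)`: a multiplicative bijection of automorphism groups:
    (∀ (Et : QuadraticEtale k) (C : CompositionAlgebraO Et.E),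
      Module.finrank Et.E C.carrier = m →
      ∃ F : {e : C.carrier ≃+ C.carrier //
              (∀ x y : C.carrier, e (x * y) = e x * e y) ∧ e 1 = 1 ∧
              (∀ (c : k) (x : C.carrier),
                e (algebraMap k Et.E c • x) = algebraMap k Et.E c • e x)} →
            {f : (corestriction Et C).carrier ≃ₗ[k] (corestriction Et C).carrier //
              (∀ x y, f (x * y) = f x * f y) ∧ f 1 = 1 ∧
              (∀ x, f ((corestriction Et C).invol x) = (corestriction Et C).invol (f x))},
        Function.Bijective F ∧
        (∀ g g' g'', (∀ x, g''.1 x = g'.1 (g.1 x)) →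
          ∀ a, (F g'').1 a = (F g').1 ((F g).1 a))) ∧
    -- (ii) the centre `E` of `C` is isomorphic to the centroid of `Skew(A,−)⁻`:
    (∀ (Et : QuadraticEtale k) (C : CompositionAlgebraO Et.E),
      Module.finrank Et.E C.carrier = m →
      Nonempty (↥(malcevCentroid (corestriction Et C)) ≃ₐ[k] Et.E)) ∧
    -- (iii) `(A,−)` is decomposable iff `C ≅ C₁ × C₂`:
    (∀ (Et : QuadraticEtale k) (C : CompositionAlgebraO Et.E),
      Module.finrank Et.E C.carrier = m →
      ((∃ D₁ D₂ : CompositionAlgebra k,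
          Module.finrank k D₁.carrier = m ∧ Module.finrank k D₂.carrier = m ∧
          Nonempty ((corestriction Et C).Iso (D₁.toAWI.tensor D₂.toAWI))) ↔
        (∃ C₁ C₂ : CompositionAlgebra k,
          Module.finrank k C₁.carrier = m ∧ Module.finrank k C₂.carrier = m ∧
          ∃ e : C.carrier ≃+ (C₁.carrier × C₂.carrier),
            (∀ x y : C.carrier, e (x * y) = e x * e y) ∧ e 1 = 1 ∧
            (∀ (c : k) (x : C.carrier), e (algebraMap k Et.E c • x) = c • e x)))) := by
  have hm0 : m ≠ 0 := by omega
  refine ⟨fun Et C hC => isProductAlgebra_corestriction hk2 hm0 Et C hC,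
    exists_corestriction_iso hk2 hm, fun Et Et' C C' hC hC' => ?_, fun Et C hC => ?_,
    fun Et C hC => ?_, fun Et C hC => ?_⟩
  · rw [nonempty_iso_iff hk2 hm hC hC']
    exact ⟨fun ⟨g⟩ => ⟨g.toAddEquiv, g.map_mul, g.map_one, g.map_smul⟩,
      fun ⟨e, h, h1, hs⟩ => ⟨⟨e, h, h1, hs⟩⟩⟩
  · obtain ⟨P⟩ := CompositionAlgebraO.nonempty_unitPair hk2 hm hC
    refine ⟨fun g =>
      let G := mapIso hk2 P P ⟨g.1, g.2.1, g.2.2.1, g.2.2.2⟩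
      ⟨G.toLinearEquiv, G.map_mul, G.map_one, G.map_invol⟩, ⟨?_, ?_⟩, ?_⟩
    · intro g g' h
      exact Subtype.ext (mapIso_injective hk2 P P (congrArg Subtype.val h))
    · rintro ⟨f, hf, hf1, hfi⟩
      obtain ⟨g, hg⟩ := exists_mapIso_eq hk2 hm hC hC P P ⟨f, hf, hf1, hfi⟩
      exact ⟨⟨g.toAddEquiv, g.map_mul, g.map_one, g.map_smul⟩, Subtype.ext hg⟩
    · intro g g' g'' h a
      exact mapIso_comp hk2 P h a
  · obtain ⟨P⟩ := CompositionAlgebraO.nonempty_unitPair hk2 hm hC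
    exact ⟨(AlgEquiv.ofBijective _ (bijective_centreAction hk2 hm hC P)).symm⟩
  · constructor
    · rintro ⟨D₁, D₂, h₁, h₂, h⟩
      exact ⟨D₁, D₂, h₁, h₂, (decomposable_iff hk2 hm Et C hC D₁ D₂ h₁ h₂).1 h⟩
    · rintro ⟨D₁, D₂, h₁, h₂, h⟩
      exact ⟨D₁, D₂, h₁, h₂, (decomposable_iff hk2 hm Et C hC D₁ D₂ h₁ h₂).2 h⟩
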